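/- Let (A, σ, f) be an F-algebra with quadratic pair which is a quadratic extension of an F-algebra with K/F-unitary involution (C, σ_C), and assume C has even degree (so deg A is divisible by 4). Then the quadratic pair (σ, f) has trivial discriminant, and its Clifford invariant coincides with the class of the discriminant algebra D(C, σ_C) in the quotient Br(F)/⟨[A]⟩ of the Brauer group of F by the subgroup generated by the class of A. -/

import Mathlib

/-!  Common definitions for formalizing results of
"Triality over fields with I³ = 0" (F. K. Bingöl, A. Quéguiner-Mathieu).

We model an algebra with quadratic pair `(A, σ, f)` by the data of the reduced trace
`T` of `A` (given together with the property `IsReducedTrace` characterising it via a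
splitting field), the involution `σ`, and an element `ℓ ∈ A` with `ℓ + σ(ℓ) = 1`; the
semi-trace is `f = f_ℓ : s ↦ T(ℓ s)`.  By [KMRT, (5.7)] every semi-trace is of this
form, so this is an equivalent description of quadratic pairs.  -/

open scoped TensorProduct
open Module

noncomputable section

namespace Triality

variable (F : Type) [CommRing F]

/-- A (finite-dimensional) central simple algebra. -/
def IsCSA (A : Type) [Ring A] [Algebra F A] : Prop :=
  Algebra.IsCentral F A ∧ IsSimpleRing A ∧ Module.Finite F A

/-- The degree of a central simple algebra: the square root of its dimension. -/
def deg (A : Type) [Ring A] [Algebra F A] : ℕ := Nat.sqrt (Module.finrank F A)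

/-- Brauer equivalence of two algebras. -/
def BrauerEquiv (A B : Type) [Ring A] [Algebra F A] [Ring B] [Algebra F B] : Prop :=
  ∃ n m : ℕ, 0 < n ∧ 0 < m ∧
    Nonempty (Matrix (Fin n) (Fin n) A ≃ₐ[F] Matrix (Fin m) (Fin m) B)

/-- An algebra is split if it is isomorphic to a matrix algebra over the base. -/
def IsSplit (A : Type) [Ring A] [Algebra F A] : Prop :=
  ∃ n : ℕ, 0 < n ∧ Nonempty (A ≃ₐ[F] Matrix (Fin n) (Fin n) F)

/-- The Schur index of a central simple algebra: the smallest degree of a central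
simple algebra in its Brauer class (realised by the underlying division algebra). -/
def schurIndex (A : Type) [Ring A] [Algebra F A] : ℕ :=
  sInf { d : ℕ | 0 < d ∧ ∃ (D : Type) (_ : Ring D) (_ : Algebra F D),
    IsCSA F D ∧ Module.finrank F D = d * d ∧ BrauerEquiv F A D }

/-- A linear involution (anti-automorphism of period 2) on an algebra. -/
def IsInvolution {A : Type} [Ring A] [Algebra F A] (σ : A →ₗ[F] A) : Prop :=
  (∀ x y : A, σ (x * y) = σ y * σ x) ∧ (∀ x : A, σ (σ x) = x)

/-- `T` is the reduced trace of the central simple algebra `A`: over some splitting field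
it is given by the trace of matrices. -/
def IsReducedTrace (A : Type) [Ring A] [Algebra F A] (T : A →ₗ[F] F) : Prop :=
  ∃ (E : Type) (_ : Field E) (_ : Algebra F E) (n : ℕ)
    (e : E ⊗[F] A ≃ₐ[E] Matrix (Fin n) (Fin n) E),
    ∀ a : A, algebraMap F E (T a) = Matrix.trace (e ((1 : E) ⊗ₜ[F] a))

/-- The submodule of symmetric elements of an involution. -/
def symSet {A : Type} [Ring A] [Algebra F A] (σ : A →ₗ[F] A) : Submodule F A :=
  LinearMap.ker (σ - LinearMap.id)

/-- A quadratic pair on a central simple algebra `A` with reduced trace `T`, encoded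
by the involution `σ` together with an element `ℓ` with `ℓ + σ(ℓ) = 1`; the semi-trace of
the pair is `f_ℓ : s ↦ T(ℓ s)` on symmetric elements. -/
def IsQuadraticPair (A : Type) [Ring A] [Algebra F A] (T : A →ₗ[F] F)
    (σ : A →ₗ[F] A) (ℓ : A) : Prop :=
  IsInvolution F σ ∧
  2 * Module.finrank F (symSet F σ) = deg F A * (deg F A + 1) ∧
  (∀ x : A, σ x = -x → T x = 0) ∧
  ℓ + σ ℓ = 1

/-- A right ideal of `A`, as a submodule over the base. -/
def IsRightIdeal (A : Type) [Ring A] [Algebra F A] (I : Submodule F A) : Prop :=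
  ∀ x ∈ I, ∀ a : A, x * a ∈ I

/-- An isotropic right ideal for the quadratic pair `(σ, f_ℓ)`:
`σ(I)·I = 0` and the semi-trace `f_ℓ = T(ℓ·)` vanishes on `I ∩ Sym(A,σ)`. -/
def IsIsotropicIdeal (A : Type) [Ring A] [Algebra F A] (T : A →ₗ[F] F)
    (σ : A →ₗ[F] A) (ℓ : A) (I : Submodule F A) : Prop :=
  IsRightIdeal F A I ∧
  (∀ x ∈ I, ∀ y ∈ I, σ x * y = 0) ∧
  (∀ x ∈ I, σ x = x → T (ℓ * x) = 0)

/-- The algebra with quadratic pair `(A, σ, f_ℓ)` is isotropic. -/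
def QPIsotropic (A : Type) [Ring A] [Algebra F A] (T : A →ₗ[F] F)
    (σ : A →ₗ[F] A) (ℓ : A) : Prop :=
  ∃ I : Submodule F A, IsIsotropicIdeal F A T σ ℓ I ∧ I ≠ ⊥

/-- The algebra with quadratic pair `(A, σ, f_ℓ)` is hyperbolic. -/
def QPHyperbolic (A : Type) [Ring A] [Algebra F A] (T : A →ₗ[F] F)
    (σ : A →ₗ[F] A) (ℓ : A) : Prop :=
  ∃ I : Submodule F A, IsIsotropicIdeal F A T σ ℓ I ∧
    2 * Module.finrank F I = Module.finrank F A

/-- The index of an algebra with quadratic pair: the set of reduced dimensions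
`dim_F I / deg A` of isotropic right ideals `I`. -/
def qpIndexSet (A : Type) [Ring A] [Algebra F A] (T : A →ₗ[F] F)
    (σ : A →ₗ[F] A) (ℓ : A) : Set ℕ :=
  { r : ℕ | ∃ I : Submodule F A, IsIsotropicIdeal F A T σ ℓ I ∧
      Module.finrank F I = r * deg F A }

/-- A symplectic involution, characterised characteristic-freely: in characteristic 2,
`1` is an alternating element; in characteristic `≠ 2`, the symmetric elements have
dimension `n(n-1)/2`. -/
def IsSymplectic (A : Type) [Ring A] [Algebra F A] (σ : A →ₗ[F] A) : Prop :=
  IsInvolution F σ ∧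
    ((ringChar F = 2 ∧ ∃ y : A, 1 = y + σ y) ∨
     (ringChar F ≠ 2 ∧ 2 * Module.finrank F (symSet F σ) = deg F A * (deg F A - 1)))

/-- The sandwich map `Sand : A ⊗ A → End_F(A)`, `Sand(a ⊗ b)(x) = a x b`. -/
def sand (A : Type) [Ring A] [Algebra F A] : A ⊗[F] A →ₗ[F] A →ₗ[F] A :=
  TensorProduct.lift
    (LinearMap.mk₂ F (fun a b => (LinearMap.mulRight F b).comp (LinearMap.mulLeft F a))
      (fun a a' b => by ext x; simp [add_mul])
      (fun c a b => by ext x; simp [smul_mul_assoc])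
      (fun a b b' => by ext x; simp [mul_add])
      (fun c a b => by ext x; simp [mul_smul_comm]))

/-- The degree-two part map `A ⊗ A → T(A)`, `a ⊗ b ↦ ι a * ι b`. -/
def mu2 (A : Type) [Ring A] [Algebra F A] : A ⊗[F] A →ₗ[F] TensorAlgebra F A :=
  TensorProduct.lift
    (LinearMap.mk₂ F (fun a b => TensorAlgebra.ι F a * TensorAlgebra.ι F b)
      (fun a a' b => by simp [add_mul])
      (fun c a b => by simp [smul_mul_assoc])
      (fun a b b' => by simp [mul_add])
      (fun c a b => by simp [mul_smul_comm]))

/-- The defining relations of the Clifford algebra `C(A, σ, f)` of an algebra with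
quadratic pair, following [KMRT, §8.B]: in the tensor algebra `T(A)`, a symmetric
element `s`, viewed in degree one, is identified with the scalar `f(s) = T(ℓ s)`, and a
`σ₂`-symmetric element `c ∈ A ⊗ A` (i.e. `Sand(c) ∘ σ = Sand(c)`), viewed in degree two,
is identified with the degree-one element `Sand(c)(ℓ)`.  (In the split case
`A = End(V)`, `(σ, f) = ad(q)`, these are the Bichsel–Knus relations presenting
the even Clifford algebra `C₀(q)`.) -/
inductive CliffordRel (A : Type) [Ring A] [Algebra F A] (T : A →ₗ[F] F)
    (σ : A →ₗ[F] A) (ℓ : A) : TensorAlgebra F A → TensorAlgebra F A → Prop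
  | sym (s : A) (hs : σ s = s) :
      CliffordRel A T σ ℓ (TensorAlgebra.ι F s) (algebraMap F _ (T (ℓ * s)))
  | deg2 (c : A ⊗[F] A) (hc : ∀ x : A, sand F A c (σ x) = sand F A c x) :
      CliffordRel A T σ ℓ (mu2 F A c) (TensorAlgebra.ι F (sand F A c ℓ))

/-- The Clifford algebra of an algebra with quadratic pair [KMRT, §8.B]. -/
def CliffordAlg (A : Type) [Ring A] [Algebra F A] (T : A →ₗ[F] F)
    (σ : A →ₗ[F] A) (ℓ : A) : Type :=
  RingQuot (CliffordRel F A T σ ℓ)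

instance (A : Type) [Ring A] [Algebra F A] (T : A →ₗ[F] F) (σ : A →ₗ[F] A) (ℓ : A) :
    Ring (CliffordAlg F A T σ ℓ) := inferInstanceAs (Ring (RingQuot _))

instance (A : Type) [Ring A] [Algebra F A] (T : A →ₗ[F] F) (σ : A →ₗ[F] A) (ℓ : A) :
    Algebra F (CliffordAlg F A T σ ℓ) := inferInstanceAs (Algebra F (RingQuot _))

/-- The canonical image of `a ∈ A` as a degree-one element of the Clifford algebra. -/
def cliffGen (A : Type) [Ring A] [Algebra F A] (T : A →ₗ[F] F)
    (σ : A →ₗ[F] A) (ℓ : A) (a : A) : CliffordAlg F A T σ ℓ :=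
  RingQuot.mkAlgHom F (CliffordRel F A T σ ℓ) (TensorAlgebra.ι F a)

/-- The quadratic pair `(σ, f)` has trivial discriminant: the centre of its Clifford
algebra is the split étale quadratic algebra, i.e. contains a nontrivial idempotent. -/
def HasTrivialDiscriminant (A : Type) [Ring A] [Algebra F A] (T : A →ₗ[F] F)
    (σ : A →ₗ[F] A) (ℓ : A) : Prop :=
  ∃ e : CliffordAlg F A T σ ℓ, e ∈ Subalgebra.center F (CliffordAlg F A T σ ℓ) ∧
    e * e = e ∧ e ≠ 0 ∧ e ≠ 1

/-- `(A, σ)` (an algebra with involution) is a quadratic extension of the algebra with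
unitary involution `(C, σ_C)`, where `uC` is a distinguished generator of the centre `K`
of `C` over `F`:  `C` embeds in `A` compatibly with the involutions, with image the
centralizer of the image of `K`. -/
def IsInvQuadExt (A : Type) [Ring A] [Algebra F A] (σ : A →ₗ[F] A)
    (C : Type) [Ring C] [Algebra F C] (σC : C →ₗ[F] C) (uC : C) : Prop :=
  ∃ j : C →ₐ[F] A, Function.Injective j ∧ (∀ x : C, σ (j x) = j (σC x)) ∧
    (Set.range (j : C → A) = Set.centralizer {j uC})

/-- `(A, σ, f_ℓ)` (an algebra with quadratic pair) is a quadratic extension of the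
algebra with unitary involution `(C, σ_C)`:  in addition to the conditions of
`IsInvQuadExt`, the semi-trace `f_ℓ` coincides on symmetric elements with `f_{ℓK}` for
some generator `ℓK` of the quadratic étale algebra `K = F[j(uC)] ⊆ A` with
`ℓK² - ℓK ∈ F`. -/
def IsQPQuadExt (A : Type) [Ring A] [Algebra F A] (T : A →ₗ[F] F)
    (σ : A →ₗ[F] A) (ℓ : A)
    (C : Type) [Ring C] [Algebra F C] (σC : C →ₗ[F] C) (uC : C) : Prop :=
  ∃ j : C →ₐ[F] A, Function.Injective j ∧ (∀ x : C, σ (j x) = j (σC x)) ∧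
    (Set.range (j : C → A) = Set.centralizer {j uC}) ∧
    ∃ ℓK ∈ Algebra.adjoin F ({j uC} : Set A),
      ℓK ∉ Set.range (algebraMap F A) ∧
      (ℓK * ℓK - ℓK) ∈ Set.range (algebraMap F A) ∧
      ∀ s : A, σ s = s → T (ℓ * s) = T (ℓK * s)

/-- The algebra with unitary involution `(C, σ_C)` is isotropic: there is a nonzero
right ideal `J` with `σ_C(J)·J = 0`. -/
def UnitaryIsotropic (C : Type) [Ring C] [Algebra F C] (σC : C →ₗ[F] C) : Prop :=
  ∃ J : Submodule F C, IsRightIdeal F C J ∧ (∀ x ∈ J, ∀ y ∈ J, σC x * y = 0) ∧ J ≠ ⊥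

/-- The algebra with unitary involution `(C, σ_C)` is hyperbolic: there is a right
ideal `J` with `σ_C(J)·J = 0` of half the dimension (over `F`; equivalently, of half the
dimension over the centre). -/
def UnitaryHyperbolic (C : Type) [Ring C] [Algebra F C] (σC : C →ₗ[F] C) : Prop :=
  ∃ J : Submodule F C, IsRightIdeal F C J ∧ (∀ x ∈ J, ∀ y ∈ J, σC x * y = 0) ∧
    2 * Module.finrank F J = Module.finrank F C

/-- The 3-fold quadratic Pfister form `⟨⟨a, b, c]]` on `F⁸`. -/
def pfister3Form (a b c : F) : (Fin 8 → F) → F := fun v =>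
  (v 0 * v 0 + v 0 * v 1 + c * (v 1 * v 1))
  + a * (v 2 * v 2 + v 2 * v 3 + c * (v 3 * v 3))
  + b * (v 4 * v 4 + v 4 * v 5 + c * (v 5 * v 5))
  + a * b * (v 6 * v 6 + v 6 * v 7 + c * (v 7 * v 7))

/-- `I_q³ F = 0`: every 3-fold quadratic Pfister form over `F` is hyperbolic, i.e.
vanishes on a totally isotropic subspace of half the dimension. -/
def I3Trivial : Prop :=
  ∀ a b c : F, a ≠ 0 → b ≠ 0 → (1 : F) - 4 * c ≠ 0 →
    ∃ W : Submodule F (Fin 8 → F), Module.finrank F W = 4 ∧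
      ∀ v ∈ W, pfister3Form F a b c v = 0

/-- An algebra with quadratic pair, bundled. -/
structure QPAlgebra : Type 1 where
  A : Type
  [ring : Ring A]
  [alg : Algebra F A]
  T : A →ₗ[F] F
  σ : A →ₗ[F] A
  ℓ : A
  csa : IsCSA F A
  trd : IsReducedTrace F A T
  pair : IsQuadraticPair F A T σ ℓ

attribute [instance] QPAlgebra.ring QPAlgebra.alg

/-- A trialitarian triple: three degree-8 algebras with quadratic pair such that the
Clifford algebra of the first, with its canonical quadratic pair, is isomorphic to the
product of the other two.  The isomorphism intertwines the canonical involution of the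
Clifford algebra (which maps the degree-one generator attached to `a` to the one
attached to `σ(a)`) with the product involution; since the degree-one elements generate
the Clifford algebra, this is recorded on generators. -/
def IsTrialitarianTriple (X Y Z : QPAlgebra F) : Prop :=
  Module.finrank F X.A = 64 ∧ Module.finrank F Y.A = 64 ∧ Module.finrank F Z.A = 64 ∧
  ∃ φ : CliffordAlg F X.A X.T X.σ X.ℓ ≃ₐ[F] (Y.A × Z.A),
    ∀ a : X.A,
      φ (cliffGen F X.A X.T X.σ X.ℓ (X.σ a)) =
        (Y.σ (φ (cliffGen F X.A X.T X.σ X.ℓ a)).1,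
         Z.σ (φ (cliffGen F X.A X.T X.σ X.ℓ a)).2)

/-- A trialitarian triple is isotropic if one of its three members is isotropic
(equivalently, by triality, each of them is). -/
def TripleIsotropic (X Y Z : QPAlgebra F) : Prop :=
  QPIsotropic F X.A X.T X.σ X.ℓ ∨ QPIsotropic F Y.A Y.T Y.σ Y.ℓ ∨
    QPIsotropic F Z.A Z.T Z.σ Z.ℓ

/-- The (unordered) triple of Schur indices of a trialitarian triple; the index
`ind T = (a, b, c)` with `a ≤ b ≤ c` of the paper corresponds to this multiset being
`{a, b, c}`. -/
def indexMultiset (X Y Z : QPAlgebra F) : Multiset ℕ :=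
  {schurIndex F X.A, schurIndex F Y.A, schurIndex F Z.A}

/-- The relations of the quaternion algebra `[a, b)_F = F⟨i, j⟩` with
`i² - i = a`, `j² = b`, `ji = (1 - i)j`. -/
inductive QuatRel (a b : F) : FreeAlgebra F (Fin 2) → FreeAlgebra F (Fin 2) → Prop
  | ii : QuatRel a b (FreeAlgebra.ι F 0 * FreeAlgebra.ι F 0)
      (FreeAlgebra.ι F 0 + algebraMap F _ a)
  | jj : QuatRel a b (FreeAlgebra.ι F 1 * FreeAlgebra.ι F 1) (algebraMap F _ b)
  | ji : QuatRel a b (FreeAlgebra.ι F 1 * FreeAlgebra.ι F 0)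
      ((1 - FreeAlgebra.ι F 0) * FreeAlgebra.ι F 1)

/-- The quaternion algebra `[a, b)_F`, presented by generators and relations. -/
def QuatAlg (a b : F) : Type := RingQuot (QuatRel F a b)

instance (a b : F) : Ring (QuatAlg F a b) := inferInstanceAs (Ring (RingQuot _))
instance (a b : F) : Algebra F (QuatAlg F a b) := inferInstanceAs (Algebra F (RingQuot _))

/-- A ring in which every nonzero element is invertible. -/
def IsDivision (A : Type) [Ring A] : Prop := ∀ x : A, x ≠ 0 → IsUnit x

end Triality

end

namespace Triality

noncomputable section

/-- A bundled central simple `F`-algebra. -/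
structure CSAlg (F : Type) [Field F] : Type 1 where
  A : Type
  [ring : Ring A]
  [alg : Algebra F A]
  csa : IsCSA F A

attribute [instance] CSAlg.ring CSAlg.alg

/-- `D` is the discriminant algebra `D(C, σ_C)` of the algebra with `K/F`-unitary
involution `(C, σ_C)` [KMRT, §10.E], characterised here through its Brauer class over
all splitting extensions [KMRT, (10.35)]: `D` is a central simple `F`-algebra such
that for every field extension `E/F` for which `(C, σ_C) ⊗ E` becomes adjoint to a
diagonal hermitian form `⟨α₁, …, α_m⟩` over `K ⊗ E` (via an isomorphism `ψ` with the
matrix algebra intertwining `σ_C` with the hermitian transpose-conjugate involution),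
`D ⊗ E` is Brauer-equivalent to the quaternion `E`-algebra
`(K ⊗ E, disc h) = (K ⊗ E) ⊕ (K ⊗ E)·z`, `z² = disc h = (-1)^{m(m-1)/2} ∏ αᵢ`,
`z·x = ι(x)·z`, realised as the `E`-subalgebra of `2×2` matrices over `K ⊗ E` generated
by `x ↦ diag(x, ι x)` and `z = [[0, disc h], [1, 0]]`. -/
def IsDiscriminantAlgebraOf (F : Type) [Field F]
    (K : Type) [CommRing K] [Algebra F K] (ι : K ≃ₐ[F] K)
    (C : Type) [Ring C] [Algebra F C] (σC : C →ₗ[F] C)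
    (D : Type) [Ring D] [Algebra F D] : Prop :=
  IsCSA F D ∧
  ∀ (E : Type) [Field E] [Algebra F E] (m : ℕ) (α : Fin m → E), (∀ i, α i ≠ 0) →
    ∀ ψ : E ⊗[F] C ≃ₐ[E] Matrix (Fin m) (Fin m) (E ⊗[F] K),
      (∀ x : C,
        ψ ((1 : E) ⊗ₜ[F] σC x) =
          Matrix.diagonal (fun i => algebraMap E (E ⊗[F] K) (α i)⁻¹) *
            Matrix.transpose ((ψ ((1 : E) ⊗ₜ[F] x)).map
              (Algebra.TensorProduct.map (AlgHom.id E E) ι.toAlgHom)) *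
            Matrix.diagonal (fun i => algebraMap E (E ⊗[F] K) (α i))) →
      BrauerEquiv E (E ⊗[F] D)
        (Algebra.adjoin E
          ((Set.range fun x : E ⊗[F] K =>
              (Matrix.diagonal
                ![x, Algebra.TensorProduct.map (AlgHom.id E E) ι.toAlgHom x] :
                Matrix (Fin 2) (Fin 2) (E ⊗[F] K))) ∪
            {!![0, algebraMap E (E ⊗[F] K)
                  ((-1 : E) ^ (m * (m - 1) / 2) * ∏ i, α i); 1, 0]}))

section Sandwich

variable {F : Type} [Field F] {A : Type} [Ring A] [Algebra F A]

theorem mulLeftRight_mul_tmul (a b : A) (t : A ⊗[F] Aᵐᵒᵖ) (x : A) :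
    AlgHom.mulLeftRight F A ((a ⊗ₜ MulOpposite.op b) * t) x =
      a * AlgHom.mulLeftRight F A t x * b := by
  rw [map_mul, Module.End.mul_apply, AlgHom.mulLeftRight_apply, MulOpposite.unop_op]

theorem one_mem_of_twoSided [IsSimpleRing A] (S : Submodule F A) {x : A} (hx : x ∈ S) (hx0 : x ≠ 0)
    (h : ∀ a b : A, ∀ y ∈ S, a * y * b ∈ S) : (1 : A) ∈ S := by
  let I : TwoSidedIdeal A := TwoSidedIdeal.mk' (S : Set A) S.zero_mem S.add_mem S.neg_mem
    (fun {a y} hy => by simpa using! h a 1 y hy) (fun {y b} hy => by simpa using! h 1 b y hy)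
  have : (1 : A) ∈ I := IsSimpleRing.one_mem_of_ne_zero_mem I hx0 (by
    simpa [I, TwoSidedIdeal.mem_mk'] using! hx)
  simpa [I, TwoSidedIdeal.mem_mk'] using! this

variable [Algebra.IsCentral F A] [IsSimpleRing A]

theorem exists_sandwich_separating (s : Finset A) : ∀ {x : A}, x ∉ Submodule.span F (s : Set A) →
    ∃ t : A ⊗[F] Aᵐᵒᵖ, (∀ w ∈ s, AlgHom.mulLeftRight F A t w = 0) ∧
      AlgHom.mulLeftRight F A t x ≠ 0 := by
  classical
  induction s using Finset.induction_on with
  | empty =>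
    intro x hx
    refine ⟨1, by simp, ?_⟩
    rw [map_one]
    simpa using hx
  | insert y s hys ih =>
    intro x hx
    by_contra! hcon
    have hys' : y ∉ Submodule.span F (s : Set A) := by
      intro hy
      have hxs : x ∉ Submodule.span F (s : Set A) := fun h => hx (by
        rw [Finset.coe_insert]; exact Submodule.span_mono (Set.subset_insert _ _) h)
      obtain ⟨t, ht, htx⟩ := ih hxs
      refine htx (hcon t fun w hw => ?_)
      rcases Finset.mem_insert.1 hw with rfl | hw
      · have : Submodule.span F (s : Set A) ≤ LinearMap.ker (AlgHom.mulLeftRight F A t) :=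
          Submodule.span_le.2 fun z hz => ht z hz
        exact this hy
      · exact ht w hw
    let J : Submodule F (A ⊗[F] Aᵐᵒᵖ) :=
      { carrier := {t | ∀ w ∈ s, AlgHom.mulLeftRight F A t w = 0}
        add_mem' := fun {p q} hp hq w hw => by
          rw [map_add, LinearMap.add_apply, hp w hw, hq w hw, add_zero]
        zero_mem' := fun w _ => by rw [map_zero, LinearMap.zero_apply]
        smul_mem' := fun c p hp w hw => by
          rw [map_smul, LinearMap.smul_apply, hp w hw, smul_zero] }
    have hJmul : ∀ a b : A, ∀ t ∈ J, (a ⊗ₜ MulOpposite.op b) * t ∈ J := fun a b t ht w hw => by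
      rw [mulLeftRight_mul_tmul, ht w hw, mul_zero, zero_mul]
    let ev (z : A) : A ⊗[F] Aᵐᵒᵖ →ₗ[F] A :=
      (LinearMap.applyₗ z).comp (AlgHom.mulLeftRight F A).toLinearMap
    have hev : ∀ z t, ev z t = AlgHom.mulLeftRight F A t z := fun _ _ => rfl
    have key : ∀ t ∈ J, ev y t = 0 → ev x t = 0 := by
      intro t ht hy
      refine hcon t fun w hw => ?_
      rcases Finset.mem_insert.1 hw with rfl | hw
      · exact hy
      · exact ht w hw
    have hJy : ∀ z : A, ∃ t ∈ J, ev y t = z := by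
      obtain ⟨t₀, ht₀, ht₀y⟩ := ih hys'
      have h1 : (1 : A) ∈ J.map (ev y) := by
        refine one_mem_of_twoSided _ (Submodule.mem_map_of_mem (f := ev y) (p := J) (r := t₀) ht₀)
          ht₀y ?_
        rintro a b _ ⟨t, ht, rfl⟩
        exact ⟨_, hJmul a b t ht, by rw [hev, mulLeftRight_mul_tmul, hev]⟩
      obtain ⟨t, ht, h1⟩ := h1
      intro z
      exact ⟨_, hJmul z 1 t ht, by rw [hev, mulLeftRight_mul_tmul, ← hev, h1, mul_one, mul_one]⟩
    obtain ⟨t₁, ht₁, ht₁y⟩ := hJy 1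
    set c := ev x t₁ with hc
    have hcy : ∀ t ∈ J, ev x t = ev y t * c := by
      intro t ht
      have h := key (t - (ev y t ⊗ₜ MulOpposite.op 1) * t₁) (J.sub_mem ht (hJmul _ _ _ ht₁)) (by
        rw [map_sub, hev _ (_ * _), mulLeftRight_mul_tmul, ← hev, ht₁y, mul_one, mul_one, sub_self])
      rw [map_sub, hev _ (_ * _), mulLeftRight_mul_tmul, ← hev, mul_one, sub_eq_zero] at h
      exact h
    have hcc : c ∈ Subalgebra.center F A := by
      rw [Subalgebra.mem_center_iff]
      intro b
      have h := hcy _ (hJmul 1 b t₁ ht₁)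
      rw [hev, hev, mulLeftRight_mul_tmul, mulLeftRight_mul_tmul, ← hev, ← hev, ht₁y, one_mul,
        one_mul, one_mul] at h
      exact h.symm
    obtain ⟨k, hk⟩ := (Algebra.mem_bot).1 (Algebra.IsCentral.out hcc)
    have hxk : x - k • y ∉ Submodule.span F (s : Set A) := by
      intro h
      refine hx ?_
      rw [Finset.coe_insert]
      have := Submodule.add_mem _ (Submodule.span_mono (Set.subset_insert y _) h)
        (Submodule.smul_mem _ k (Submodule.subset_span (Set.mem_insert y _)))
      simpa using this
    obtain ⟨t, ht, h⟩ := ih hxk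
    refine h ?_
    have h2 := hcy t ht
    rw [hev, hev] at h2
    rw [map_sub, map_smul, h2, ← hk, ← Algebra.commutes, ← Algebra.smul_def, sub_self]

variable (F A) in
theorem mulLeftRight_surjective [Module.Finite F A] :
    Function.Surjective (AlgHom.mulLeftRight F A) := by
  classical
  set ι := Module.Free.ChooseBasisIndex F A
  let b : Basis ι F A := Module.Free.chooseBasis F A
  have h1 : ∀ i, ∃ t : A ⊗[F] Aᵐᵒᵖ, ∀ j, AlgHom.mulLeftRight F A t (b j) =
      if j = i then 1 else 0 := by
    intro i
    have hi : b i ∉ Submodule.span F (((Finset.univ.erase i).image b : Finset A) : Set A) := by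
      have := b.linearIndependent.notMem_span_image (s := {j | j ≠ i}) (x := i) (by simp)
      convert this using 3
      ext; simp
    obtain ⟨t, ht, hti⟩ := exists_sandwich_separating _ hi
    let ev : A ⊗[F] Aᵐᵒᵖ →ₗ[F] A :=
      (LinearMap.applyₗ (b i)).comp (AlgHom.mulLeftRight F A).toLinearMap
    have hev : ∀ t, ev t = AlgHom.mulLeftRight F A t (b i) := fun _ => rfl
    let J : Submodule F (A ⊗[F] Aᵐᵒᵖ) :=
      { carrier := {t | ∀ j, j ≠ i → AlgHom.mulLeftRight F A t (b j) = 0}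
        add_mem' := fun {p q} hp hq w hw => by
          rw [map_add, LinearMap.add_apply, hp w hw, hq w hw, add_zero]
        zero_mem' := fun w _ => by rw [map_zero, LinearMap.zero_apply]
        smul_mem' := fun c p hp w hw => by
          rw [map_smul, LinearMap.smul_apply, hp w hw, smul_zero] }
    have h1 : (1 : A) ∈ J.map ev := by
      refine one_mem_of_twoSided _ (Submodule.mem_map_of_mem (f := ev) (p := J) (r := t)
        (fun j hj => ht _ (by simpa using ⟨j, hj, rfl⟩))) hti ?_
      rintro a c _ ⟨t, ht, rfl⟩
      refine ⟨(a ⊗ₜ MulOpposite.op c) * t, fun j hj => ?_, by rw [hev, mulLeftRight_mul_tmul, hev]⟩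
      rw [mulLeftRight_mul_tmul, ht j hj, mul_zero, zero_mul]
    obtain ⟨t', ht', h1⟩ := h1
    refine ⟨t', fun j => ?_⟩
    split_ifs with hji
    · rw [hji]; exact h1
    · exact ht' j hji
  choose t ht using h1
  intro f
  refine ⟨∑ i, (f (b i) ⊗ₜ MulOpposite.op 1) * t i, b.ext fun j => ?_⟩
  rw [map_sum, LinearMap.sum_apply]
  simp only [mulLeftRight_mul_tmul, ht]
  simp

variable (F A) in
theorem mulLeftRight_bijective [Module.Finite F A] :
    Function.Bijective (AlgHom.mulLeftRight F A) := by
  refine ⟨?_, mulLeftRight_surjective F A⟩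
  have : Module.Finite F Aᵐᵒᵖ := Module.Finite.equiv (MulOpposite.opLinearEquiv F)
  refine (LinearMap.injective_iff_surjective_of_finrank_eq_finrank
    (f := (AlgHom.mulLeftRight F A).toLinearMap) ?_).2 (mulLeftRight_surjective F A)
  change _ = finrank F (A →ₗ[F] A)
  rw [Module.finrank_tensorProduct, Module.finrank_linearMap,
    ← (MulOpposite.opLinearEquiv F : A ≃ₗ[F] Aᵐᵒᵖ).finrank_eq]

/-- Every linear functional on a central simple algebra is a sum of two-sided multiplications. -/
theorem exists_sandwich_eq [Module.Finite F A] (φ : A →ₗ[F] F) :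
    ∃ (n : ℕ) (x y : Fin n → A), ∀ a, ∑ i, x i * a * y i = algebraMap F A (φ a) := by
  obtain ⟨t, ht⟩ := mulLeftRight_surjective F A ((Algebra.linearMap F A).comp φ)
  obtain ⟨n, x, y, rfl⟩ : ∃ (n : ℕ) (x : Fin n → A) (y : Fin n → A),
      t = ∑ i, x i ⊗ₜ MulOpposite.op (y i) := by
    clear ht
    induction t using TensorProduct.induction_on with
    | zero => exact ⟨0, fun _ => 0, fun _ => 0, by simp⟩
    | tmul a b => exact ⟨1, fun _ => a, fun _ => b.unop, by simp⟩
    | add p q hp hq =>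
      obtain ⟨n, x, y, rfl⟩ := hp
      obtain ⟨m, z, w, rfl⟩ := hq
      exact ⟨n + m, Fin.append x z, Fin.append y w, by simp [Fin.sum_univ_add]⟩
  refine ⟨n, x, y, fun a => ?_⟩
  have := LinearMap.congr_fun ht a
  rw [map_sum, LinearMap.sum_apply] at this
  simpa using this

end Sandwich

section TensorSimple

variable {F : Type} [Field F] {A : Type} [Ring A] [Algebra F A] {B : Type} [Ring B] [Algebra F B]

/-- The partial evaluation `A ⊗ B → B` at a linear functional on `A`. -/
def partialEval (φ : A →ₗ[F] F) : A ⊗[F] B →ₗ[F] B :=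
  (TensorProduct.lid F B).toLinearMap.comp (TensorProduct.map φ LinearMap.id)

@[simp] theorem partialEval_tmul (φ : A →ₗ[F] F) (a : A) (b : B) :
    partialEval φ (a ⊗ₜ b) = φ a • b := by simp [partialEval]

theorem eq_zero_of_partialEval {t : A ⊗[F] B} (h : ∀ φ : A →ₗ[F] F, partialEval φ t = 0) :
    t = 0 := by
  classical
  let b := Basis.ofVectorSpace F A
  refine (TensorProduct.equivFinsuppOfBasisLeft b).injective ?_
  ext i
  have : ∀ s : A ⊗[F] B, TensorProduct.equivFinsuppOfBasisLeft b s i = partialEval (b.coord i) s := by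
    intro s
    induction s using TensorProduct.induction_on with
    | zero => simp
    | tmul a b => simp
    | add p q hp hq => simp only [map_add, Finsupp.add_apply, hp, hq]
  rw [this, h, map_zero, Finsupp.zero_apply]

theorem partialEval_eq_sandwich {n : ℕ} {x y : Fin n → A} {φ : A →ₗ[F] F}
    (h : ∀ a, ∑ i, x i * a * y i = algebraMap F A (φ a)) (t : A ⊗[F] B) :
    ∑ i, (x i ⊗ₜ[F] (1 : B)) * t * (y i ⊗ₜ[F] (1 : B)) = 1 ⊗ₜ[F] partialEval φ t := by
  induction t using TensorProduct.induction_on with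
  | zero => simp
  | tmul a b =>
    simp only [Algebra.TensorProduct.tmul_mul_tmul, one_mul, mul_one, partialEval_tmul,
      ← TensorProduct.sum_tmul, h]
    rw [Algebra.algebraMap_eq_smul_one, TensorProduct.smul_tmul]
  | add p q hp hq =>
    simp only [mul_add, add_mul, Finset.sum_add_distrib, hp, hq, map_add, TensorProduct.tmul_add]

variable [Algebra.IsCentral F A] [IsSimpleRing A] [Module.Finite F A]

theorem isSimpleRing_tensor_left [IsSimpleRing B] : IsSimpleRing (A ⊗[F] B) := by
  refine IsSimpleRing.of_eq_bot_or_eq_top fun I => or_iff_not_imp_left.2 fun hI => ?_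
  obtain ⟨t, htI, ht0⟩ : ∃ t ∈ I, t ≠ 0 := by
    by_contra! h
    refine hI (le_antisymm (fun x hx => ?_) bot_le)
    rw [h x hx]; exact zero_mem _
  obtain ⟨φ, hφ⟩ : ∃ φ : A →ₗ[F] F, partialEval φ t ≠ 0 := by
    by_contra! h
    exact ht0 (eq_zero_of_partialEval h)
  obtain ⟨n, x, y, hxy⟩ := exists_sandwich_eq φ
  have hmem : (1 : A) ⊗ₜ[F] partialEval φ t ∈ I := by
    rw [← partialEval_eq_sandwich hxy]
    exact sum_mem fun i _ => I.mul_mem_right _ _ (I.mul_mem_left _ _ htI)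
  let J : TwoSidedIdeal B := TwoSidedIdeal.mk' {b | (1 : A) ⊗ₜ[F] b ∈ I} (by simp [I.zero_mem])
    (fun {p q} hp hq => by
      simp only [Set.mem_ofPred_eq] at hp hq ⊢
      rw [TensorProduct.tmul_add]; exact I.add_mem hp hq)
    (fun {p} hp => by
      simp only [Set.mem_ofPred_eq] at hp ⊢
      rw [TensorProduct.tmul_neg]; exact I.neg_mem hp)
    (fun {p q} hq => by
      simp only [Set.mem_ofPred_eq] at hq ⊢
      simpa using I.mul_mem_left (1 ⊗ₜ p) _ hq)
    (fun {p q} hq => by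
      simp only [Set.mem_ofPred_eq] at hq ⊢
      simpa using I.mul_mem_right _ (1 ⊗ₜ q) hq)
  have h1 : (1 : B) ∈ J := IsSimpleRing.one_mem_of_ne_zero_mem J hφ (by
    simpa [J, TwoSidedIdeal.mem_mk'] using! hmem)
  rw [← I.one_mem_iff]
  simpa [J, TwoSidedIdeal.mem_mk'] using! h1

/-- Elements of `A ⊗ B` commuting with `A ⊗ 1` lie in `1 ⊗ B`. -/
theorem exists_eq_one_tmul_of_commute {t : A ⊗[F] B}
    (h : ∀ a : A, (a ⊗ₜ[F] (1 : B)) * t = t * (a ⊗ₜ[F] 1)) : ∃ b : B, t = 1 ⊗ₜ b := by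
  obtain ⟨φ, hφ⟩ : ∃ φ : A →ₗ[F] F, φ 1 = 1 := by
    obtain ⟨φ, hφ⟩ := LinearMap.exists_leftInverse_of_injective (Algebra.linearMap F A)
      (LinearMap.ker_eq_bot.2 (FaithfulSMul.algebraMap_injective F A))
    exact ⟨φ, by simpa using LinearMap.congr_fun hφ 1⟩
  obtain ⟨n, x, y, hxy⟩ := exists_sandwich_eq φ
  refine ⟨partialEval φ t, ?_⟩
  rw [← partialEval_eq_sandwich hxy]
  simp only [h, mul_assoc]
  rw [← Finset.mul_sum]
  simp only [Algebra.TensorProduct.tmul_mul_tmul, mul_one, ← TensorProduct.sum_tmul]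
  have := hxy 1
  simp only [mul_one, hφ, map_one] at this
  rw [this, ← Algebra.TensorProduct.one_def, mul_one]

theorem isCentral_tensor [Algebra.IsCentral F B] : Algebra.IsCentral F (A ⊗[F] B) := by
  refine ⟨fun t ht => ?_⟩
  rw [Subalgebra.mem_center_iff] at ht
  obtain ⟨b, rfl⟩ := exists_eq_one_tmul_of_commute fun a => ht _
  have hb : b ∈ Subalgebra.center F B := by
    rw [Subalgebra.mem_center_iff]
    intro c
    have := ht (1 ⊗ₜ c)
    simp only [Algebra.TensorProduct.tmul_mul_tmul, mul_one] at this
    exact Algebra.TensorProduct.includeRight_injective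
      (FaithfulSMul.algebraMap_injective F A) this
  obtain ⟨k, rfl⟩ := Algebra.mem_bot.1 (Algebra.IsCentral.out hb)
  exact Algebra.mem_bot.2 ⟨k, by
    rw [Algebra.TensorProduct.algebraMap_apply, Algebra.algebraMap_eq_smul_one,
      Algebra.algebraMap_eq_smul_one, TensorProduct.smul_tmul]⟩

variable (E : Type) [Field E] [Algebra F E]

instance isSimpleRing_baseChange : IsSimpleRing (E ⊗[F] A) :=
  have := isSimpleRing_tensor_left (F := F) (A := A) (B := E)
  IsSimpleRing.of_ringEquiv (Algebra.TensorProduct.comm F A E).toRingEquiv inferInstance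

instance isCentral_baseChange : Algebra.IsCentral E (E ⊗[F] A) := by
  refine ⟨fun t ht => ?_⟩
  rw [Subalgebra.mem_center_iff] at ht
  obtain ⟨e, he⟩ := exists_eq_one_tmul_of_commute (A := A) (B := E)
    (t := Algebra.TensorProduct.comm F E A t) fun a => by
      have := congrArg (Algebra.TensorProduct.comm F E A) (ht (1 ⊗ₜ a))
      rw [map_mul, map_mul] at this
      simpa using this
  refine Algebra.mem_bot.2 ⟨e, ?_⟩
  apply (Algebra.TensorProduct.comm F E A).injective
  rw [he]
  simp

end TensorSimple

/-- `X` is split by the extension `M` of `F`. -/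
def SplitBy (F : Type) [Field F] (X : Type) [Ring X] [Algebra F X] (M : Type) [Field M]
    [Algebra F M] : Prop :=
  ∃ n : ℕ, n * n = finrank F X ∧ Nonempty (X →ₐ[F] Matrix (Fin n) (Fin n) M)

section Rep

variable {F : Type} [Field F] {A : Type} [Ring A] [Algebra F A]
variable {M : Type} [Field M] [Algebra F M]
variable {n : Type} [Fintype n] [DecidableEq n]

/-- The scalar extension of a matrix representation. -/
def repHom (ρ : A →ₐ[F] Matrix n n M) : M ⊗[F] A →ₐ[M] Matrix n n M :=
  Algebra.TensorProduct.lift (Algebra.ofId M _) ρ fun x y => by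
    rw [Algebra.ofId_apply]; exact Algebra.commutes x (ρ y)

@[simp] theorem repHom_tmul (ρ : A →ₐ[F] Matrix n n M) (x : M) (a : A) :
    repHom ρ (x ⊗ₜ a) = x • ρ a := by
  rw [repHom, Algebra.TensorProduct.lift_tmul, Algebra.smul_def, Algebra.ofId_apply]

theorem exists_rep_of_forall_mem {L : Type} [Field L] [Algebra F L] (i : L →ₐ[F] M)
    (ρ : A →ₐ[F] Matrix n n M) (h : ∀ a j k, ρ a j k ∈ Set.range i) :
    ∃ ρ' : A →ₐ[F] Matrix n n L, ∀ a, ρ a = (ρ' a).map i := by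
  have hinj : Function.Injective (i.mapMatrix (m := n)) := by
    intro X Y hXY
    ext j k
    exact i.injective (congrFun (congrFun hXY j) k)
  have hr : ∀ a, ρ a ∈ (i.mapMatrix (m := n)).range := by
    intro a
    choose X hX using h a
    exact ⟨Matrix.of X, by ext j k; simp [hX]⟩
  refine ⟨(AlgEquiv.ofInjective _ hinj).symm.toAlgHom.comp (ρ.codRestrict _ hr), fun a => ?_⟩
  have := (AlgEquiv.ofInjective _ hinj).apply_symm_apply (ρ.codRestrict _ hr a)
  exact (congrArg Subtype.val this).symm

theorem finrank_isSquare_index [Nontrivial A] [Module.Finite F A]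
    (h : Fintype.card n * Fintype.card n = finrank F A) : Nonempty n := by
  by_contra hn
  rw [not_nonempty_iff] at hn
  have : 0 < finrank F A := finrank_pos
  simp at h
  omega

variable [Algebra.IsCentral F A] [IsSimpleRing A] [Module.Finite F A]

theorem repHom_bijective (ρ : A →ₐ[F] Matrix n n M)
    (h : Fintype.card n * Fintype.card n = finrank F A) : Function.Bijective (repHom ρ) := by
  have := finrank_isSquare_index (n := n) h
  have hinj : Function.Injective (repHom ρ) := (repHom ρ).toRingHom.injective
  refine ⟨hinj, (LinearMap.injective_iff_surjective_of_finrank_eq_finrank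
    (f := (repHom ρ).toLinearMap) ?_).1 hinj⟩
  rw [Module.finrank_baseChange, Module.finrank_matrix, finrank_self, mul_one, h]

/-- The isomorphism with a matrix algebra given by a representation of the right degree. -/
def repEquiv (ρ : A →ₐ[F] Matrix n n M)
    (h : Fintype.card n * Fintype.card n = finrank F A) : M ⊗[F] A ≃ₐ[M] Matrix n n M :=
  AlgEquiv.ofBijective (repHom ρ) (repHom_bijective ρ h)

@[simp] theorem repEquiv_tmul (ρ : A →ₐ[F] Matrix n n M)
    (h : Fintype.card n * Fintype.card n = finrank F A) (x : M) (a : A) :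
    repEquiv ρ h (x ⊗ₜ a) = x • ρ a := repHom_tmul ρ x a

theorem matrix_skolemNoether {M : Type} [Field M] (f : Matrix n n M ≃ₐ[M] Matrix n n M) :
    ∃ P Q : Matrix n n M, P * Q = 1 ∧ Q * P = 1 ∧ ∀ X, f X = P * X * Q := by
  obtain ⟨T, hT⟩ := AlgEquiv.eq_linearEquivConjAlgEquiv
    ((Matrix.toLinAlgEquiv'.symm.trans f).trans Matrix.toLinAlgEquiv')
  refine ⟨LinearMap.toMatrix' T.toLinearMap, LinearMap.toMatrix' T.symm.toLinearMap, ?_, ?_, ?_⟩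
  · rw [← LinearMap.toMatrix'_comp]; simp
  · rw [← LinearMap.toMatrix'_comp]; simp
  · intro X
    have := congrArg (fun g => LinearMap.toMatrixAlgEquiv' (g (Matrix.toLinAlgEquiv' X))) hT
    simp only [AlgEquiv.trans_apply, AlgEquiv.symm_apply_apply,
      LinearMap.toMatrixAlgEquiv'_toLinAlgEquiv'] at this
    rw [this, LinearEquiv.conjAlgEquiv_apply]
    change LinearMap.toMatrix' (_ ∘ₗ (Matrix.toLin' X) ∘ₗ _) = _
    rw [LinearMap.toMatrix'_comp, LinearMap.toMatrix'_comp, LinearMap.toMatrix'_toLin', mul_assoc]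

theorem rep_conj (ρ ρ' : A →ₐ[F] Matrix n n M)
    (h : Fintype.card n * Fintype.card n = finrank F A) :
    ∃ P Q : Matrix n n M, P * Q = 1 ∧ Q * P = 1 ∧ ∀ a, ρ' a = P * ρ a * Q := by
  obtain ⟨P, Q, h1, h2, hP⟩ := matrix_skolemNoether ((repEquiv ρ h).symm.trans (repEquiv ρ' h))
  refine ⟨P, Q, h1, h2, fun a => ?_⟩
  have e : repEquiv ρ h (1 ⊗ₜ a) = ρ a := by simp
  rw [← hP, ← e, AlgEquiv.trans_apply, AlgEquiv.symm_apply_apply, repEquiv_tmul, one_smul]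

theorem rep_commutant {M' : Type} [Field M'] [Algebra M M'] (ρ : A →ₐ[F] Matrix n n M)
    (h : Fintype.card n * Fintype.card n = finrank F A) (X : Matrix n n M')
    (hX : ∀ a, (ρ a).map (algebraMap M M') * X = X * (ρ a).map (algebraMap M M')) :
    ∃ x : M', X = Matrix.scalar n x := by
  have key : ∀ Y : Matrix n n M, Y.map (algebraMap M M') * X = X * Y.map (algebraMap M M') := by
    intro Y
    obtain ⟨t, rfl⟩ := (repEquiv ρ h).surjective Y
    induction t using TensorProduct.induction_on with
    | zero => simp
    | tmul x a =>
      rw [repEquiv_tmul]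
      have : (x • ρ a).map (algebraMap M M') = algebraMap M M' x • (ρ a).map (algebraMap M M') := by
        ext; simp
      rw [this, Matrix.smul_mul, hX, Matrix.mul_smul]
    | add p q hp hq =>
      have : (repEquiv ρ h (p + q)).map (algebraMap M M') =
          (repEquiv ρ h p).map (algebraMap M M') + (repEquiv ρ h q).map (algebraMap M M') := by
        ext; simp
      rw [this, add_mul, mul_add, hp, hq]
  rcases isEmpty_or_nonempty n with hn | hn
  · exact ⟨0, Subsingleton.elim _ _⟩
  obtain ⟨i₀⟩ := hn
  refine ⟨X i₀ i₀, ?_⟩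
  ext i j
  have h2 := congrFun (congrFun (key (Matrix.single i₀ i 1)) i₀) j
  have hs : (Matrix.single i₀ i (1 : M)).map (algebraMap M M') = Matrix.single i₀ i (1 : M') := by
    ext a b; simp only [Matrix.map_apply, Matrix.single_apply]; split_ifs <;> simp
  rw [hs, Matrix.single_mul_apply_same, one_mul] at h2
  rw [h2]
  by_cases hij : i = j
  · subst hij
    rw [Matrix.mul_single_apply_same, mul_one]; simp
  · rw [Matrix.mul_single_apply_of_ne _ _ _ _ _ (Ne.symm hij)]; simp [hij]

end Rep

section Morita

variable {F : Type} [Field F] {Z : Type} [Ring Z] [Algebra F Z] {E : Type} [Field E] [Algebra F E]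

theorem splitBy_of_matrix_hom {l s : ℕ} (hl : 0 < l)
    (φ : Matrix (Fin l) (Fin l) Z →ₐ[F] Matrix (Fin s) (Fin s) E)
    (hs : s * s = l * l * finrank F Z) : SplitBy F Z E := by
  let i₀ : Fin l := ⟨0, hl⟩
  let Φ : Matrix (Fin l) (Fin l) Z →ₐ[F] Module.End E (Fin s → E) :=
    ((Matrix.toLinAlgEquiv' (R := E) (n := Fin s)).toAlgHom.restrictScalars F).comp φ
  let W : Submodule E (Fin s → E) := LinearMap.range (Φ (Matrix.single i₀ i₀ 1))
  have hmul : ∀ X Y v, Φ X (Φ Y v) = Φ (X * Y) v := fun X Y v => by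
    rw [map_mul]; rfl
  have hfix : ∀ w ∈ W, Φ (Matrix.single i₀ i₀ 1) w = w := by
    rintro _ ⟨v, rfl⟩
    rw [hmul, Matrix.single_mul_single_same, one_mul]
  have hmem : ∀ j z v, Φ (Matrix.single i₀ j z) v ∈ W := fun j z v =>
    ⟨Φ (Matrix.single i₀ j z) v, by rw [hmul, Matrix.single_mul_single_same, one_mul]⟩
  let e : (Fin s → E) ≃ₗ[E] (Fin l → W) :=
    { toFun := fun v j => ⟨Φ (Matrix.single i₀ j 1) v, hmem j 1 v⟩
      map_add' := fun v w => by ext; simp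
      map_smul' := fun c v => by ext; simp
      invFun := fun w => ∑ j, Φ (Matrix.single j i₀ 1) (w j)
      left_inv := fun v => by
        simp only [hmul, Matrix.single_mul_single_same, one_mul]
        rw [← LinearMap.sum_apply, ← map_sum, Matrix.sum_single_one, map_one]; rfl
      right_inv := fun w => by
        ext1 j
        apply Subtype.ext
        simp only [map_sum, hmul]
        rw [Finset.sum_eq_single j]
        · rw [Matrix.single_mul_single_same, one_mul, hfix _ (w j).2]
        · intro b _ hb
          rw [Matrix.single_mul_single_of_ne _ _ _ _ (Ne.symm hb), map_zero, LinearMap.zero_apply]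
        · simp }
  have hdim : s = l * finrank E W := by
    have := e.finrank_eq
    rw [finrank_pi_fintype, finrank_pi_fintype] at this
    simpa using this
  set r := finrank E W
  have hr : r * r = finrank F Z := by
    have : (l * l) * (r * r) = (l * l) * finrank F Z := by rw [← hs, hdim]; ring
    exact Nat.eq_of_mul_eq_mul_left (Nat.mul_pos hl hl) this
  let Ψ : Z →ₐ[F] Module.End E W := AlgHom.ofLinearMap
    { toFun := fun z => (Φ (Matrix.single i₀ i₀ z)).restrict (q := W) (p := W)
        (fun w _ => hmem i₀ z w)
      map_add' := fun y z => by
        ext1 w; apply Subtype.ext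
        simp [LinearMap.restrict_apply, Matrix.single_add]
      map_smul' := fun c z => by
        ext1 w; apply Subtype.ext
        simp only [LinearMap.restrict_apply, RingHom.id_apply, LinearMap.smul_apply]
        rw [← Matrix.smul_single, map_smul]; rfl }
    (by
      ext1 w; apply Subtype.ext
      exact hfix w w.2)
    (fun y z => by
      ext1 w; apply Subtype.ext
      simp only [LinearMap.coe_mk, AddHom.coe_mk, LinearMap.restrict_apply, Module.End.mul_apply]
      rw [hmul, Matrix.single_mul_single_same])
  let b : Basis (Fin r) E W := Module.finBasis E W
  exact ⟨r, hr, ⟨((LinearMap.toMatrixAlgEquiv b).toAlgHom.restrictScalars F).comp Ψ⟩⟩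

end Morita

theorem SplitBy.isSplit {F : Type} [Field F] {X : Type} [Ring X] [Algebra F X]
    [Algebra.IsCentral F X] [IsSimpleRing X] [Module.Finite F X] (h : SplitBy F X F) :
    IsSplit F X := by
  obtain ⟨n, hn, ⟨ρ⟩⟩ := h
  have hn' : Fintype.card (Fin n) * Fintype.card (Fin n) = finrank F X := by simpa using hn
  have := finrank_isSquare_index hn'
  refine ⟨n, Fin.pos_iff_nonempty.2 this, ⟨(Algebra.TensorProduct.lid F X).symm.trans
    (repEquiv ρ hn')⟩⟩

section Hilbert90

open scoped Matrix

variable {F : Type} [Field F] {L : Type} [Field L] [Algebra F L] {n : Type} [Fintype n]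
  [DecidableEq n]

theorem linearIndependent_algEquiv :
    LinearIndependent L (fun g : L ≃ₐ[F] L => (g : L → L)) := by
  have h := linearIndependent_monoidHom L L
  exact h.comp (fun g : L ≃ₐ[F] L => (g : L →* L)) (fun g g' hgg => by
    ext x; exact DFunLike.congr_fun hgg x)

variable [FiniteDimensional F L]

theorem exists_cocycle_trivialisation (Q : (L ≃ₐ[F] L) → Matrix n n L) (hQ1 : Q 1 = 1)
    (hQ : ∀ g h, Q g * (Q h).map g = Q (g * h)) :
    ∃ S S' : Matrix n n L, S * S' = 1 ∧ S' * S = 1 ∧ ∀ g, Q g * S.map g = S := by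
  classical
  let act (g : L ≃ₐ[F] L) (v : n → L) : n → L := Q g *ᵥ (fun i => g (v i))
  have hmapmul : ∀ (g : L ≃ₐ[F] L) (X : Matrix n n L) (v : n → L),
      (fun i => g ((X *ᵥ v) i)) = X.map g *ᵥ fun i => g (v i) := by
    intro g X v
    ext i
    simp [Matrix.mulVec, dotProduct]
  have hact : ∀ g h v, act g (act h v) = act (g * h) v := by
    intro g h v
    simp only [act, hmapmul, Matrix.mulVec_mulVec, hQ]
    rfl
  have hadd : ∀ g v w, act g (v + w) = act g v + act g w := by
    intro g v w
    simp only [act, ← Matrix.mulVec_add]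
    congr 1; ext i; simp
  let W : Set (n → L) := {v | ∀ g, act g v = v}
  have hsum : ∀ v, (∑ g, act g v) ∈ W := by
    intro v g
    have : act g (∑ h, act h v) = ∑ h, act g (act h v) :=
      map_sum (AddMonoidHom.mk' (act g) (hadd g)) _ _
    rw [this]
    simp only [hact]
    exact Fintype.sum_equiv (Equiv.mulLeft g) _ _ fun _ => rfl
  have hspan : Submodule.span L W = ⊤ := by
    by_contra hne
    obtain ⟨φ, hφ0, hφ⟩ := Submodule.exists_le_ker_of_lt_top _ (lt_top_iff_ne_top.2 hne)
    refine hφ0 (LinearMap.ext fun v => ?_)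
    have h1 : ∑ g : L ≃ₐ[F] L, φ (act g v) • (g : L → L) = 0 := by
      ext c
      have h2 : φ (∑ g, act g (c • v)) = 0 := hφ (Submodule.subset_span (hsum _))
      rw [map_sum] at h2
      rw [Finset.sum_apply, Pi.zero_apply, ← h2]
      refine Finset.sum_congr rfl fun g _ => ?_
      have : act g (c • v) = g c • act g v := by
        simp only [act, ← Matrix.mulVec_smul]
        congr 1; ext i; simp
      rw [this, map_smul, Pi.smul_apply, smul_eq_mul, smul_eq_mul, mul_comm]
    have := Fintype.linearIndependent_iff.1 (linearIndependent_algEquiv (F := F) (L := L))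
      (fun g => φ (act g v)) h1 1
    have hv : act 1 v = v := by simp [act, hQ1]
    rwa [hv] at this
  obtain ⟨κ, b, hbW⟩ : ∃ (κ : Type) (b : Basis κ L (n → L)), ∀ i, b i ∈ W :=
    ⟨_, Basis.ofSpan hspan.ge, fun i => Basis.ofSpan_subset hspan.ge ⟨i, rfl⟩⟩
  let c : Basis n L (n → L) := b.reindex (b.indexEquiv (Pi.basisFun L n))
  have hcW : ∀ j, c j ∈ W := fun j => by
    rw [Basis.reindex_apply]; exact hbW _
  refine ⟨(Pi.basisFun L n).toMatrix c, c.toMatrix (Pi.basisFun L n),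
    Basis.toMatrix_mul_toMatrix_flip _ _, Basis.toMatrix_mul_toMatrix_flip _ _, fun g => ?_⟩
  ext i j
  have := congrFun (hcW j g) i
  simpa [act, Matrix.mul_apply, Matrix.mulVec, dotProduct, Basis.toMatrix_apply] using this

theorem exists_rep_of_cocycle [IsGalois F L] {B : Type} [Ring B] [Algebra F B]
    (ρ : B →ₐ[F] Matrix n n L) (Q : (L ≃ₐ[F] L) → Matrix n n L) (hQ1 : Q 1 = 1)
    (hQ : ∀ g h, Q g * (Q h).map g = Q (g * h))
    (hρ : ∀ g b, Q g * (ρ b).map g = ρ b * Q g) :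
    Nonempty (B →ₐ[F] Matrix n n F) := by
  obtain ⟨S, S', hSS, hSS', hS⟩ := exists_cocycle_trivialisation Q hQ1 hQ
  have hmul : ∀ (g : L ≃ₐ[F] L) (X Y : Matrix n n L), (X * Y).map g = X.map g * Y.map g :=
    fun g X Y => Matrix.map_mul (f := (g : L →+* L))
  have hone : ∀ (g : L ≃ₐ[F] L), (1 : Matrix n n L).map g = 1 := fun g => by simp
  let τ : B →ₐ[F] Matrix n n L := AlgHom.ofLinearMap
    ((LinearMap.mulLeftRight F (S', S)).comp ρ.toLinearMap)
    (by simp [LinearMap.mulLeftRight_apply, hSS'])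
    (fun x y => by
      simp only [LinearMap.comp_apply, LinearMap.mulLeftRight_apply, AlgHom.toLinearMap_apply,
        map_mul]
      calc S' * (ρ x * ρ y) * S = S' * ρ x * 1 * ρ y * S := by simp only [mul_assoc, one_mul]
        _ = _ := by rw [← hSS]; simp only [mul_assoc])
  have hτ : ∀ b, τ b = S' * ρ b * S := fun b => rfl
  have hfix : ∀ (g : L ≃ₐ[F] L) b, (τ b).map g = τ b := by
    intro g b
    have h1 : S' * Q g = S'.map g := by
      calc S' * Q g = S' * Q g * (S * S').map g := by rw [hSS, hone, mul_one]
        _ = S' * (Q g * S.map g) * S'.map g := by rw [hmul]; simp only [mul_assoc]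
        _ = S'.map g := by rw [hS, hSS', one_mul]
    rw [hτ, hmul, hmul, ← h1, mul_assoc S', hρ, mul_assoc, mul_assoc, hS, mul_assoc]
  obtain ⟨ρ', -⟩ := exists_rep_of_forall_mem (Algebra.ofId F L) τ (fun b i j => by
    have : ∀ g : L ≃ₐ[F] L, g (τ b i j) = τ b i j := fun g => congrFun (congrFun (hfix g b) i) j
    obtain ⟨x, hx⟩ := (IsGalois.mem_range_algebraMap_iff_fixed (F := F) (τ b i j)).2 this
    exact ⟨x, hx⟩)
  exact ⟨ρ'⟩

end Hilbert90

section SplittingField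

theorem IsSepClosed.splitBy (M : Type) [Field M] [IsSepClosed M] (A : Type) [Ring A] [Algebra M A]
    [Algebra.IsCentral M A] [IsSimpleRing A] [Module.Finite M A] : SplitBy M A M := by
  have : IsArtinianRing A := IsArtinianRing.of_finite M A
  obtain ⟨n, hn, D, _, _, _, ⟨e⟩⟩ :=
    IsSimpleRing.exists_algEquiv_matrix_divisionRing_finite M A
  have hnpos : 0 < n := Nat.pos_of_ne_zero hn.out
  have : Nonempty (Fin n) := Fin.pos_iff_nonempty.1 hnpos
  have hc : Algebra.IsCentral M (Matrix (Fin n) (Fin n) D) := Algebra.IsCentral.of_algEquiv M _ _ e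
  have hD : Algebra.IsCentral M D := by
    refine ⟨fun x hx => ?_⟩
    have : Matrix.scalar (Fin n) x ∈ Subalgebra.center M (Matrix (Fin n) (Fin n) D) := by
      rw [Subalgebra.mem_center_iff] at hx ⊢
      intro X
      ext i j
      simp [hx]
    obtain ⟨k, hk⟩ := Algebra.mem_bot.1 (hc.out this)
    have i₀ : Fin n := ⟨0, hnpos⟩
    refine Algebra.mem_bot.2 ⟨k, ?_⟩
    have := congrFun (congrFun hk i₀) i₀
    simpa [Matrix.algebraMap_matrix_apply] using this
  have htop : (⊥ : Subalgebra M D) = ⊤ := by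
    by_contra hne
    obtain ⟨x, hx, hsep⟩ := JacobsonNoether.exists_separable_and_not_isCentral' hne
    have hx_int : IsIntegral M x := Algebra.IsIntegral.isIntegral x
    have hdeg := IsSepClosed.degree_eq_one_of_irreducible M (minpoly.irreducible hx_int) hsep
    exact hx (Algebra.mem_bot.2 (minpoly.mem_range_of_degree_eq_one M x hdeg))
  have hbij : Function.Bijective (Algebra.ofId M D) := by
    refine ⟨(algebraMap M D).injective, fun x => ?_⟩
    have : x ∈ (⊥ : Subalgebra M D) := htop ▸ Algebra.mem_top
    exact Algebra.mem_bot.1 this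
  let e' : A ≃ₐ[M] Matrix (Fin n) (Fin n) M :=
    e.trans (AlgEquiv.ofBijective (Algebra.ofId M D) hbij).symm.mapMatrix
  refine ⟨n, ?_, ⟨e'.toAlgHom⟩⟩
  rw [e'.toLinearEquiv.finrank_eq, Module.finrank_matrix]
  simp

variable (F : Type) [Field F]

theorem splitBy_separableClosure (A : Type) [Ring A] [Algebra F A] [Algebra.IsCentral F A]
    [IsSimpleRing A] [Module.Finite F A] : SplitBy F A (SeparableClosure F) := by
  obtain ⟨n, hn, ⟨ρ⟩⟩ := IsSepClosed.splitBy (SeparableClosure F) (SeparableClosure F ⊗[F] A)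
  exact ⟨n, by rw [hn, Module.finrank_baseChange], ⟨(ρ.restrictScalars F).comp
    Algebra.TensorProduct.includeRight⟩⟩

/-- Two central simple algebras are split by a common finite Galois extension. -/
theorem exists_galois_splitBy (A B : Type) [Ring A] [Algebra F A] [Algebra.IsCentral F A]
    [IsSimpleRing A] [Module.Finite F A] [Ring B] [Algebra F B] [Algebra.IsCentral F B]
    [IsSimpleRing B] [Module.Finite F B] :
    ∃ (L : Type) (_ : Field L) (_ : Algebra F L), FiniteDimensional F L ∧ IsGalois F L ∧
      SplitBy F A L ∧ SplitBy F B L := by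
  classical
  obtain ⟨n, hn, ⟨ρ⟩⟩ := splitBy_separableClosure F A
  obtain ⟨m, hm, ⟨β⟩⟩ := splitBy_separableClosure F B
  let bA := Module.finBasis F A
  let bB := Module.finBasis F B
  let s : Set (SeparableClosure F) :=
    Set.range (fun t : Fin _ × Fin n × Fin n => ρ (bA t.1) t.2.1 t.2.2) ∪
    Set.range (fun t : Fin _ × Fin m × Fin m => β (bB t.1) t.2.1 t.2.2)
  let L := FiniteGaloisIntermediateField.adjoin F s
  have hsL : s ⊆ (L : IntermediateField F (SeparableClosure F)) :=
    FiniteGaloisIntermediateField.subset_adjoin F s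
  have key : ∀ {k l : ℕ} {X : Type} [Ring X] [Algebra F X] (b : Basis (Fin k) F X)
      (τ : X →ₐ[F] Matrix (Fin l) (Fin l) (SeparableClosure F)),
      (∀ t i j, τ (b t) i j ∈ (L : IntermediateField F (SeparableClosure F))) →
      ∃ τ' : X →ₐ[F] Matrix (Fin l) (Fin l) L, True := by
    intro k l X _ _ b τ h
    obtain ⟨τ', -⟩ := exists_rep_of_forall_mem
      (L : IntermediateField F (SeparableClosure F)).val τ (fun x i j => by
        have : τ x i j ∈ (L : IntermediateField F (SeparableClosure F)) := by
          rw [← b.sum_repr x]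
          simp only [map_sum, map_smul, Matrix.sum_apply, Matrix.smul_apply]
          exact sum_mem fun t _ => IntermediateField.smul_mem _ (h t i j)
        exact ⟨⟨_, this⟩, rfl⟩)
    exact ⟨τ', trivial⟩
  obtain ⟨ρ', -⟩ := key bA ρ fun t i j => hsL (Or.inl ⟨(t, i, j), rfl⟩)
  obtain ⟨β', -⟩ := key bB β fun t i j => hsL (Or.inr ⟨(t, i, j), rfl⟩)
  exact ⟨L, inferInstance, inferInstance, inferInstance, inferInstance, ⟨n, hn, ⟨ρ'⟩⟩,
    ⟨m, hm, ⟨β'⟩⟩⟩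

end SplittingField

section Twist

open MvPolynomial

variable {L : Type} [Field L] {n : Type} [Fintype n]

/-- The semilinear endomorphism of a polynomial ring acting on the coefficients by `g` and on the
vector of variables through the matrix `P`. -/
def twist (g : L →+* L) (P : Matrix n n L) : MvPolynomial n L →+* MvPolynomial n L :=
  eval₂Hom (C.comp g) fun i => ∑ j, C (P i j) * X j

@[simp] theorem twist_C (g : L →+* L) (P : Matrix n n L) (c : L) :
    twist g P (C c) = C (g c) := by simp [twist]

@[simp] theorem twist_X (g : L →+* L) (P : Matrix n n L) (i : n) :
    twist g P (X i) = ∑ j, C (P i j) * X j := by simp [twist]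

theorem twist_comp (g h : L →+* L) (P Q : Matrix n n L) :
    (twist g P).comp (twist h Q) = twist (g.comp h) (Q.map g * P) := by
  apply MvPolynomial.ringHom_ext
  · intro c; simp
  · intro i
    simp only [RingHom.comp_apply, twist_X, map_sum, map_mul, twist_C, Matrix.mul_apply,
      Matrix.map_apply, Finset.sum_mul, Finset.mul_sum]
    rw [Finset.sum_comm]
    refine Finset.sum_congr rfl fun j _ => Finset.sum_congr rfl fun k _ => ?_
    ring

variable [DecidableEq n]

theorem twist_id_one : twist (RingHom.id L) (1 : Matrix n n L) = RingHom.id _ := by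
  apply MvPolynomial.ringHom_ext
  · intro c; simp
  · intro i
    simp [Matrix.one_apply]

theorem twist_scalar_monomial (t : L) (m : n →₀ ℕ) (c : L) :
    twist (RingHom.id L) (Matrix.scalar n t) (monomial m c) = monomial m (t ^ m.degree * c) := by
  have hX : ∀ i, twist (RingHom.id L) (Matrix.scalar n t) (X i) = C t * X i := by
    intro i
    rw [twist_X, Finset.sum_eq_single i]
    · simp
    · intro j _ hj; simp [Matrix.diagonal_apply_ne _ (Ne.symm hj)]
    · simp
  rw [monomial_eq, map_mul, twist_C, Finsupp.prod, map_prod]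
  simp only [map_pow, hX, mul_pow, Finset.prod_mul_distrib, Finset.prod_pow_eq_pow_sum]
  rw [monomial_eq, Finsupp.prod, Finsupp.degree_apply, RingHom.id_apply, map_mul, map_pow]
  ring

theorem coeff_twist_scalar (t : L) (p : MvPolynomial n L) (m : n →₀ ℕ) :
    coeff m (twist (RingHom.id L) (Matrix.scalar n t) p) = t ^ m.degree * coeff m p := by
  induction p using MvPolynomial.induction_on' with
  | monomial k c =>
    rw [twist_scalar_monomial, coeff_monomial, coeff_monomial]
    split_ifs with h
    · rw [h]
    · simp
  | add p q hp hq => rw [map_add, coeff_add, hp, hq, coeff_add, mul_add]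

theorem exists_zpow_of_twist_scalar {k : ℕ} (a b : MvPolynomial (Fin k) L) (ha : a ≠ 0)
    (hb : b ≠ 0) : ∃ N : ℤ, ∀ t κ : L, t ≠ 0 →
      twist (RingHom.id L) (Matrix.scalar _ t) a * b =
        C κ * (a * twist (RingHom.id L) (Matrix.scalar _ t) b) → κ = t ^ N := by
  let o : MonomialOrder (Fin k) := MonomialOrder.lex
  have hdeg : ∀ (t : L) (p : MvPolynomial (Fin k) L), t ≠ 0 →
      o.degree (twist (RingHom.id L) (Matrix.scalar _ t) p) = o.degree p := by
    intro t p ht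
    have : (twist (RingHom.id L) (Matrix.scalar _ t) p).support = p.support := by
      ext m
      simp only [MvPolynomial.mem_support_iff, coeff_twist_scalar, ne_eq, mul_eq_zero,
        pow_eq_zero_iff', ht, false_and, false_or]
    rw [MonomialOrder.degree, MonomialOrder.degree, this]
  have hlc : ∀ (t : L) (p : MvPolynomial (Fin k) L), t ≠ 0 →
      o.leadingCoeff (twist (RingHom.id L) (Matrix.scalar _ t) p) =
        t ^ (o.degree p).degree * o.leadingCoeff p := by
    intro t p ht
    rw [MonomialOrder.leadingCoeff, hdeg t p ht, coeff_twist_scalar]; rfl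
  refine ⟨((o.degree a).degree : ℤ) - (o.degree b).degree, fun t κ ht h => ?_⟩
  have h2 := congrArg o.leadingCoeff h
  have hla : o.leadingCoeff a ≠ 0 := by simpa using ha
  have hlb : o.leadingCoeff b ≠ 0 := by simpa using hb
  rw [MonomialOrder.leadingCoeff_mul, hlc _ _ ht, MonomialOrder.leadingCoeff_mul,
    MonomialOrder.leadingCoeff_mul, hlc _ _ ht, MonomialOrder.leadingCoeff_C] at h2
  rw [zpow_sub₀ ht, zpow_natCast, zpow_natCast, eq_div_iff (pow_ne_zero _ ht)]
  have : (o.leadingCoeff a * o.leadingCoeff b) * (κ * t ^ (o.degree b).degree) =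
      (o.leadingCoeff a * o.leadingCoeff b) * t ^ (o.degree a).degree := by
    linear_combination -h2
  exact mul_left_cancel₀ (mul_ne_zero hla hlb) this

end Twist

section Gcd

theorem associated_gcd_of_twist {R : Type} [CommRing R] [IsDomain R] [NormalizedGCDMonoid R]
    {G : Type} [Fintype G] (p : G → R) (u : R ≃+* R) (s q : R) (d : G → R) (hd : ∀ h, IsUnit (d h))
    (τ : G ≃ G) (h : ∀ h, s * u (p h) = d h * (q * p (τ h))) :
    Associated (s * u (Finset.univ.gcd p)) (q * Finset.univ.gcd p) := by
  classical
  set γ := Finset.univ.gcd p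
  have hγ : ∀ x, x ∣ γ ↔ ∀ h, x ∣ p h := fun x => by simp [γ, Finset.dvd_gcd_iff]
  have h1 : Associated (Finset.univ.gcd fun h => q * p h) (q * γ) :=
    Finset.gcd_mul_left' _ _ q
  have h2 : Associated (Finset.univ.gcd fun h => s * u (p h)) (s * u γ) := by
    have : Associated (Finset.univ.gcd fun h => u (p h)) (u γ) := by
      refine associated_of_dvd_dvd ?_ (Finset.dvd_gcd fun h _ => map_dvd u ((hγ γ).1 dvd_rfl h))
      rw [← map_dvd_iff u.symm, RingEquiv.symm_apply_apply, hγ]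
      intro h
      rw [← map_dvd_iff u, RingEquiv.apply_symm_apply]
      exact Finset.gcd_dvd (f := fun h => u (p h)) (Finset.mem_univ h)
    exact (Finset.gcd_mul_left' _ _ s).trans (this.mul_left s)
  refine h2.symm.trans (Associated.trans ?_ h1)
  refine associated_of_dvd_dvd (Finset.dvd_gcd fun k _ => ?_) (Finset.dvd_gcd fun k _ => ?_)
  · have := Finset.gcd_dvd (f := fun h => s * u (p h)) (Finset.mem_univ (τ.symm k))
    rw [h, τ.apply_symm_apply] at this
    exact ((hd _).dvd_mul_left).1 this
  · rw [h]
    exact Dvd.dvd.mul_left (Finset.gcd_dvd (f := fun h => q * p h) (Finset.mem_univ (τ k))) _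

end Gcd

theorem matrix_map_mul {R S 𝓕 l m n : Type} [NonAssocSemiring R] [NonAssocSemiring S] [Fintype m]
    [FunLike 𝓕 R S] [RingHomClass 𝓕 R S] (f : 𝓕) (X : Matrix l m R) (Y : Matrix m n R) :
    (X * Y).map f = X.map f * Y.map f := by
  ext i j
  simp [Matrix.mul_apply]

theorem matrix_map_one {R S 𝓕 n : Type} [NonAssocSemiring R] [NonAssocSemiring S] [DecidableEq n]
    [FunLike 𝓕 R S] [RingHomClass 𝓕 R S] (f : 𝓕) :
    (1 : Matrix n n R).map f = 1 := Matrix.map_one f (map_zero f) (map_one f)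

theorem exists_invertible_of_span {K : Type} [Field K] {n : Type} [Fintype n] [DecidableEq n]
    (s : Set (n → K)) (hs : Submodule.span K s = ⊤) :
    ∃ S S' : Matrix n n K, S * S' = 1 ∧ S' * S = 1 ∧ ∀ j, S.col j ∈ s := by
  obtain ⟨b, hbs, hb, hli⟩ := exists_linearIndependent K s
  let B : Basis b K (n → K) := Basis.mk hli (by rw [Subtype.range_coe, hb, hs])
  have : Fintype b := FiniteDimensional.fintypeBasisIndex B
  have hc : Fintype.card b = Fintype.card n := by
    rw [← Module.finrank_eq_card_basis B, Module.finrank_pi]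
  let e := Fintype.equivOfCardEq hc
  let B' := B.reindex e
  refine ⟨(Pi.basisFun K n).toMatrix B', B'.toMatrix (Pi.basisFun K n), ?_, ?_, fun j => ?_⟩
  · exact Basis.toMatrix_mul_toMatrix_flip _ _
  · exact Basis.toMatrix_mul_toMatrix_flip _ _
  · refine hbs ?_
    have : ((Pi.basisFun K n).toMatrix B').col j = (e.symm j : n → K) := by
      ext i
      simp [Basis.toMatrix, B', B]
    rw [this]
    exact (e.symm j).2

section Generic

open MvPolynomial

variable {F : Type} [Field F] {L : Type} [Field L] [Algebra F L] {A : Type} [Ring A] [Algebra F A]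
variable {n : ℕ}

/-- A semilinear change of the generic vector compatible with a representation of `A`. -/
structure Adm (ρ : A →ₐ[F] Matrix (Fin n) (Fin n) L) where
  g : L ≃ₐ[F] L
  P : Matrix (Fin n) (Fin n) L
  P' : Matrix (Fin n) (Fin n) L
  mul_inv : P * P' = 1
  inv_mul : P' * P = 1
  comm : ∀ a, P * (ρ a).map g = ρ a * P

variable {ρ : A →ₐ[F] Matrix (Fin n) (Fin n) L}

namespace Adm

theorem comm' (u : Adm ρ) (a : A) : (ρ a).map u.g * u.P' = u.P' * ρ a := by
  calc (ρ a).map u.g * u.P' = u.P' * (u.P * (ρ a).map u.g) * u.P' := by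
        rw [← mul_assoc u.P', u.inv_mul, one_mul]
    _ = u.P' * ρ a := by rw [u.comm, mul_assoc, mul_assoc, u.mul_inv, mul_one]

/-- Composition of semilinear changes. -/
def mul (u v : Adm ρ) : Adm ρ where
  g := u.g * v.g
  P := u.P * v.P.map u.g
  P' := v.P'.map u.g * u.P'
  mul_inv := by
    rw [mul_assoc, ← mul_assoc (v.P.map u.g), ← matrix_map_mul, v.mul_inv, matrix_map_one,
      one_mul, u.mul_inv]
  inv_mul := by
    rw [mul_assoc, ← mul_assoc u.P', u.inv_mul, one_mul, ← matrix_map_mul, v.inv_mul,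
      matrix_map_one]
  comm a := by
    have : (ρ a).map (u.g * v.g) = ((ρ a).map v.g).map u.g := by ext; simp
    rw [this, mul_assoc, ← matrix_map_mul, v.comm, matrix_map_mul, ← mul_assoc, u.comm, mul_assoc]

/-- Scaling of the generic vector. -/
def scal (ρ : A →ₐ[F] Matrix (Fin n) (Fin n) L) (t : L) (ht : t ≠ 0) : Adm ρ where
  g := 1
  P := Matrix.scalar _ t
  P' := Matrix.scalar _ t⁻¹
  mul_inv := by rw [← map_mul, mul_inv_cancel₀ ht, map_one]
  inv_mul := by rw [← map_mul, inv_mul_cancel₀ ht, map_one]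
  comm a := by
    have : (ρ a).map (1 : L ≃ₐ[F] L) = ρ a := by ext; simp
    rw [this]
    exact Matrix.scalar_commute t (fun _ => Commute.all _ _) _

/-- The induced automorphism of the polynomial ring. -/
def poly (u : Adm ρ) : MvPolynomial (Fin n) L ≃+* MvPolynomial (Fin n) L :=
  RingEquiv.ofRingHom (twist (u.g : L →+* L) u.P')
    (twist (u.g.symm : L →+* L) (u.P.map u.g.symm))
    (by
      rw [twist_comp, ← twist_id_one]
      congr 1
      · ext x; simp
      · have : (u.P.map u.g.symm).map (u.g : L →+* L) = u.P := by ext; simp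
        rw [this, u.mul_inv])
    (by
      rw [twist_comp, ← twist_id_one]
      congr 1
      · ext x; simp
      · have := matrix_map_mul u.g.symm u.P' u.P
        rw [u.inv_mul, matrix_map_one] at this
        exact this.symm)

theorem poly_apply (u : Adm ρ) (p) : u.poly p = twist (u.g : L →+* L) u.P' p := rfl

/-- The induced automorphism of the field of rational functions. -/
def frac (u : Adm ρ) :
    FractionRing (MvPolynomial (Fin n) L) →+* FractionRing (MvPolynomial (Fin n) L) :=
  (IsFractionRing.ringEquivOfRingEquiv u.poly :
    FractionRing (MvPolynomial (Fin n) L) ≃+* FractionRing (MvPolynomial (Fin n) L))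

@[simp] theorem frac_algebraMap (u : Adm ρ) (p : MvPolynomial (Fin n) L) :
    u.frac (algebraMap _ _ p) = algebraMap _ _ (u.poly p) :=
  IsFractionRing.ringEquivOfRingEquiv_algebraMap _ _

theorem algebraMap_eq (l : L) : algebraMap L (FractionRing (MvPolynomial (Fin n) L)) l =
    algebraMap (MvPolynomial (Fin n) L) _ (C l) :=
  IsScalarTower.algebraMap_apply L (MvPolynomial (Fin n) L) _ l

@[simp] theorem frac_base (u : Adm ρ) (l : L) :
    u.frac (algebraMap L _ l) = algebraMap L _ (u.g l) := by
  rw [algebraMap_eq, frac_algebraMap, poly_apply, twist_C, ← algebraMap_eq]; rfl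

theorem frac_mul (u v : Adm ρ) : (u.mul v).frac = u.frac.comp v.frac := by
  apply IsFractionRing.ringHom_ext (A := MvPolynomial (Fin n) L)
  intro p
  simp only [frac_algebraMap, RingHom.comp_apply, poly_apply]
  rw [← RingHom.comp_apply (twist _ _), twist_comp]
  rfl

theorem frac_congr (u v : Adm ρ) (hg : u.g = v.g) (hP : u.P' = v.P') : u.frac = v.frac := by
  apply IsFractionRing.ringHom_ext (A := MvPolynomial (Fin n) L)
  intro p
  simp only [frac_algebraMap, poly_apply, hg, hP]

theorem frac_map_base (u : Adm ρ) {m l : Type} (X : Matrix m l L) :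
    (X.map (algebraMap L (FractionRing (MvPolynomial (Fin n) L)))).map u.frac =
      (X.map u.g).map (algebraMap L _) := by
  ext i j; simp

end Adm

/-- The elements of the rational function field fixed by a family of semilinear changes. -/
def fixedField (ρ : A →ₐ[F] Matrix (Fin n) (Fin n) L) (S : Set (Adm ρ)) :
    IntermediateField F (FractionRing (MvPolynomial (Fin n) L)) where
  carrier := {x | ∀ u ∈ S, u.frac x = x}
  mul_mem' hx hy u hu := by rw [map_mul, hx u hu, hy u hu]
  add_mem' hx hy u hu := by rw [map_add, hx u hu, hy u hu]
  algebraMap_mem' r u _ := by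
    rw [IsScalarTower.algebraMap_apply F L, Adm.frac_base, AlgEquiv.commutes]
  inv_mem' x hx u hu := by rw [map_inv₀, hx u hu]

/-- The function field of the generic splitting variety of `A`. -/
abbrev genField (ρ : A →ₐ[F] Matrix (Fin n) (Fin n) L) := fixedField ρ Set.univ

variable [Algebra.IsCentral F A] [IsSimpleRing A] [Module.Finite F A]

theorem exists_adm (hn : n * n = finrank F A) (g : L ≃ₐ[F] L) : ∃ u : Adm ρ, u.g = g := by
  obtain ⟨P, Q, h1, h2, h⟩ := rep_conj ((g : L →ₐ[F] L).mapMatrix.comp ρ) ρ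
    (by simpa using hn)
  refine ⟨⟨g, P, Q, h1, h2, fun a => ?_⟩, rfl⟩
  conv_rhs => rw [h a, mul_assoc, h2, mul_one]
  rfl

section
open scoped Matrix

theorem splitBy_genField (hn : n * n = finrank F A) : SplitBy F A (genField ρ) := by
  have hn' : Fintype.card (Fin n) * Fintype.card (Fin n) = finrank F A := by simpa using hn
  let 𝔽 := FractionRing (MvPolynomial (Fin n) L)
  let i : L →ₐ[F] 𝔽 := IsScalarTower.toAlgHom F L 𝔽
  let ρ' : A →ₐ[F] Matrix (Fin n) (Fin n) 𝔽 := i.mapMatrix.comp ρ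
  let v : Fin n → 𝔽 := fun i => algebraMap _ _ (X i : MvPolynomial (Fin n) L)
  have hv : ∀ u : Adm ρ, (fun i => u.frac (v i)) = u.P'.map (algebraMap L 𝔽) *ᵥ v := by
    intro u
    ext i
    simp only [v, Adm.frac_algebraMap, Adm.poly_apply, twist_X, map_sum, map_mul,
      Matrix.mulVec, dotProduct, Matrix.map_apply, Adm.algebraMap_eq, 𝔽]
  have := finrank_isSquare_index hn'
  obtain ⟨i₀⟩ := this
  have hspan : Submodule.span 𝔽 (Set.range fun a => ρ' a *ᵥ v) = ⊤ := by
    rw [eq_top_iff]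
    intro y _
    have hv0 : v i₀ ≠ 0 := by
      simp only [v, ne_eq, FaithfulSMul.algebraMap_eq_zero_iff]
      exact X_ne_zero _
    have hM : ∃ M : Matrix (Fin n) (Fin n) 𝔽, M *ᵥ v = y := by
      refine ⟨Matrix.of fun j k => if k = i₀ then y j * (v i₀)⁻¹ else 0, ?_⟩
      ext j
      simpa [Matrix.mulVec, dotProduct] using inv_mul_cancel_right₀ hv0 (y j)
    obtain ⟨M, rfl⟩ := hM
    obtain ⟨t, rfl⟩ := (repHom_bijective ρ' hn').surjective M
    induction t using TensorProduct.induction_on with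
    | zero => simp
    | tmul c a =>
      rw [repHom_tmul, Matrix.smul_mulVec]
      exact Submodule.smul_mem _ _ (Submodule.subset_span ⟨a, rfl⟩)
    | add s t hs ht =>
      rw [map_add, Matrix.add_mulVec]
      exact Submodule.add_mem _ (hs trivial) (ht trivial)
  obtain ⟨S, S', h1, h2, hS⟩ := exists_invertible_of_span _ hspan
  have hSu : ∀ u : Adm ρ, S.map u.frac = u.P'.map (algebraMap L 𝔽) * S := by
    intro u
    ext k j
    obtain ⟨a, ha⟩ := hS j
    have hSk : ∀ k, S k j = (ρ' a *ᵥ v) k := fun k => (congrFun ha k).symm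
    have e1 : (fun k => u.frac ((ρ' a *ᵥ v) k)) =
        (u.P'.map (algebraMap L 𝔽)) *ᵥ (ρ' a *ᵥ v) := by
      have : (fun k => u.frac ((ρ' a *ᵥ v) k)) =
          ((ρ' a).map u.frac) *ᵥ (fun k => u.frac (v k)) := by
        ext k; simp [Matrix.mulVec, dotProduct]
      rw [this, hv, Matrix.mulVec_mulVec, Matrix.mulVec_mulVec]
      congr 1
      have e2 : (ρ' a).map u.frac = ((ρ a).map u.g).map (algebraMap L 𝔽) :=
        Adm.frac_map_base u (ρ a)
      rw [e2, ← matrix_map_mul, u.comm', matrix_map_mul]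
      rfl
    have e3 := congrFun e1 k
    rw [Matrix.map_apply, hSk, e3]
    simp only [Matrix.mul_apply, hSk]
    rfl
  have hSu' : ∀ u : Adm ρ, S'.map u.frac = S' * u.P.map (algebraMap L 𝔽) := by
    intro u
    have e1 : S'.map u.frac * S.map u.frac = 1 := by rw [← matrix_map_mul, h2, matrix_map_one]
    have e2 : S.map u.frac * (S' * u.P.map (algebraMap L 𝔽)) = 1 := by
      rw [hSu, mul_assoc, ← mul_assoc S, h1, one_mul, ← matrix_map_mul, u.inv_mul, matrix_map_one]
    exact left_inv_eq_right_inv e1 e2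
  let τ : A →ₐ[F] Matrix (Fin n) (Fin n) 𝔽 :=
    { toFun := fun a => S' * ρ' a * S
      map_one' := by rw [map_one, mul_one, h2]
      map_mul' := fun a b => by
        rw [map_mul]
        simp only [mul_assoc]
        rw [← mul_assoc S S', h1, one_mul]
      map_zero' := by simp
      map_add' := fun a b => by rw [map_add, mul_add, add_mul]
      commutes' := fun r => by
        rw [AlgHom.commutes, ← Algebra.commutes, mul_assoc, h2, mul_one] }
  obtain ⟨τ', -⟩ := exists_rep_of_forall_mem (genField ρ).val τ (by
    intro a j k
    refine ⟨⟨τ a j k, fun u _ => ?_⟩, rfl⟩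
    have : (τ a).map u.frac = τ a := by
      change (S' * ρ' a * S).map u.frac = S' * ρ' a * S
      rw [matrix_map_mul, matrix_map_mul, hSu, hSu']
      have e2 : (ρ' a).map u.frac = ((ρ a).map u.g).map (algebraMap L 𝔽) :=
        Adm.frac_map_base u (ρ a)
      have e3 : (ρ' a) = (ρ a).map (algebraMap L 𝔽) := rfl
      have e4 : u.P.map (algebraMap L 𝔽) * ((ρ a).map u.g).map (algebraMap L 𝔽) *
          u.P'.map (algebraMap L 𝔽) = (ρ a).map (algebraMap L 𝔽) := by
        rw [← matrix_map_mul, ← matrix_map_mul, u.comm, mul_assoc, u.mul_inv, mul_one]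
      rw [e2, e3, ← e4]
      simp only [mul_assoc]
    exact congrFun (congrFun this j) k)
  exact ⟨n, hn, ⟨τ'⟩⟩

end

theorem mem_base_of_mem_genField [FiniteDimensional F L] [IsGalois F L] (hn : n * n = finrank F A)
    (x : genField ρ) (c : F) (hx : x * x - x = algebraMap F _ c) :
    x ∈ Set.range (algebraMap F (genField ρ)) := by
  let R := MvPolynomial (Fin n) L
  let 𝔽 := FractionRing R
  have hx' : (x : 𝔽) * x - x = algebraMap F 𝔽 c := congrArg Subtype.val hx
  have hc : algebraMap F 𝔽 c = algebraMap R 𝔽 (C (algebraMap F L c)) := by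
    rw [IsScalarTower.algebraMap_apply F L 𝔽, Adm.algebraMap_eq]
  have hx_int : IsIntegral R (x : 𝔽) := by
    refine ⟨Polynomial.X ^ 2 - Polynomial.X - Polynomial.C (C (algebraMap F L c)), ?_, ?_⟩
    · rw [sub_sub]
      apply Polynomial.monic_X_pow_sub
      compute_degree
      norm_num
    · simp only [Polynomial.eval₂_sub, Polynomial.eval₂_pow, Polynomial.eval₂_X,
        Polynomial.eval₂_C]
      rw [← hc, ← hx', pow_two, sub_self]
  obtain ⟨p, hp⟩ := IsIntegrallyClosed.algebraMap_eq_of_integral hx_int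
  have hpp : p * p = p + C (algebraMap F L c) := by
    apply IsFractionRing.injective R 𝔽
    rw [map_mul, map_add, hp, ← hc, ← hx']
    ring
  have hdeg : p.totalDegree = 0 := by
    by_cases hp0 : p = 0
    · simp [hp0]
    have h1 := congrArg totalDegree hpp
    rw [totalDegree_mul_of_isDomain hp0 hp0] at h1
    have h2 := totalDegree_add p (C (algebraMap F L c))
    rw [totalDegree_C] at h2
    omega
  rw [totalDegree_eq_zero_iff_eq_C] at hdeg
  set l := p.coeff 0
  have hxl : (x : 𝔽) = algebraMap L 𝔽 l := by rw [← hp, hdeg, Adm.algebraMap_eq]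
  have hl : ∀ g : L ≃ₐ[F] L, g l = l := by
    intro g
    obtain ⟨u, rfl⟩ := exists_adm (ρ := ρ) hn g
    have := x.2 u trivial
    rw [hxl, Adm.frac_base] at this
    exact (algebraMap L 𝔽).injective this
  obtain ⟨r, hr⟩ := (IsGalois.mem_range_algebraMap_iff_fixed (F := F) l).2 hl
  refine ⟨r, Subtype.ext ?_⟩
  rw [hxl, ← hr, ← IsScalarTower.algebraMap_apply F L 𝔽]
  rfl

end Generic

section Cocycle

open MvPolynomial

variable {F : Type} [Field F] {L : Type} [Field L] [Algebra F L] {A : Type} [Ring A] [Algebra F A]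
variable {n : ℕ} {ρ : A →ₐ[F] Matrix (Fin n) (Fin n) L}

theorem scalar_mul_eq_smul {K m l : Type} [Field K] [Fintype m] [DecidableEq m] (x : K)
    (X : Matrix m l K) : Matrix.scalar m x * X = x • X := by
  ext i j; simp

theorem Adm.frac_scal_scal_comm (u : Adm ρ) (t : L) (ht : t ≠ 0) :
    (Adm.scal ρ t ht).frac.comp u.frac =
      u.frac.comp (Adm.scal ρ (u.g.symm t) (by simpa using ht)).frac := by
  rw [← Adm.frac_mul, ← Adm.frac_mul]
  apply Adm.frac_congr
  · ext x; simp [Adm.mul, Adm.scal]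
  · ext i j
    simp [Adm.mul, Adm.scal, Matrix.diagonal_apply, Matrix.mul_apply, mul_comm]

theorem Adm.frac_comp_of_mul (u v w : Adm ρ) (hg : u.g * v.g = w.g) (c : L) (hc : c ≠ 0)
    (h : u.P * v.P.map u.g = c • w.P) :
    u.frac.comp v.frac = (Adm.scal ρ c hc).frac.comp w.frac := by
  rw [← Adm.frac_mul, ← Adm.frac_mul]
  apply Adm.frac_congr
  · change u.g * v.g = 1 * w.g
    rw [hg, one_mul]
  · have h1 := (u.mul v).inv_mul
    have h2 : ((Adm.scal ρ c hc).mul w).P = (u.mul v).P := by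
      simp only [Adm.mul, h, Adm.scal]
      rw [scalar_mul_eq_smul]
      ext i j; simp
    have h3 := ((Adm.scal ρ c hc).mul w).mul_inv
    rw [h2] at h3
    exact left_inv_eq_right_inv h1 h3

variable [Algebra.IsCentral F A] [IsSimpleRing A] [Module.Finite F A]

theorem cocycle_of_intertwiner {m : Type} [Fintype m] [DecidableEq m] {B : Type} [Ring B]
    [Algebra F B] [Algebra.IsCentral F B] [IsSimpleRing B] [Module.Finite F B]
    (β : B →ₐ[F] Matrix m m L) (hm : Fintype.card m * Fintype.card m = finrank F B)
    (Q Q' : (L ≃ₐ[F] L) → Matrix m m L) (h1 : ∀ g, Q g * Q' g = 1) (h2 : ∀ g, Q' g * Q g = 1)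
    (hQ : ∀ g b, Q g * (β b).map g = β b * Q g) (g h : L ≃ₐ[F] L) :
    ∃ d : L, d ≠ 0 ∧ Q g * (Q h).map g = d • Q (g * h) := by
  have hQ' : ∀ (g : L ≃ₐ[F] L) b, (β b).map g * Q' g = Q' g * β b := by
    intro g b
    calc (β b).map g * Q' g = Q' g * (Q g * (β b).map g) * Q' g := by
          rw [← mul_assoc (Q' g), h2, one_mul]
      _ = Q' g * β b := by rw [hQ, mul_assoc, mul_assoc, h1, mul_one]
  obtain ⟨d, hd⟩ := rep_commutant (M' := L) β hm (Q g * (Q h).map g * Q' (g * h)) (by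
    intro b
    have e : (β b).map (algebraMap L L) = β b := by ext; simp
    have e1 : (β b).map (g * h) = ((β b).map h).map g := by ext; simp
    rw [e]
    calc β b * (Q g * (Q h).map g * Q' (g * h)) = (β b * Q g) * ((Q h).map g * Q' (g * h)) := by
          simp only [mul_assoc]
      _ = Q g * (((β b).map g * (Q h).map g) * Q' (g * h)) := by
          rw [← hQ]; simp only [mul_assoc]
      _ = Q g * ((Q h).map g * (((β b).map h).map g * Q' (g * h))) := by
          rw [← matrix_map_mul, ← hQ, matrix_map_mul]; simp only [mul_assoc]
      _ = Q g * (Q h).map g * Q' (g * h) * β b := by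
          rw [← e1, hQ']; simp only [mul_assoc]
    )
  have hd' : Q g * (Q h).map g = d • Q (g * h) := by
    rw [← scalar_mul_eq_smul, ← hd, mul_assoc, h2, mul_one]
  refine ⟨d, ?_, hd'⟩
  rintro rfl
  rw [zero_smul] at hd'
  have : Nonempty m := finrank_isSquare_index hm
  have h3 : (1 : Matrix m m L) = 0 := by
    calc (1 : Matrix m m L) = (Q' h * Q h).map g := by rw [h2, matrix_map_one]
      _ = (Q' h).map g * (Q' g * (Q g * (Q h).map g)) := by
        rw [← mul_assoc (Q' g), h2 g, matrix_map_mul, one_mul]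
      _ = 0 := by rw [hd', mul_zero, mul_zero]
  exact one_ne_zero h3

variable [FiniteDimensional F L]

set_option maxHeartbeats 1600000 in
theorem exists_cocycle_relation {r : ℕ} {B : Type} [Ring B] [Algebra F B]
    [Algebra.IsCentral F B] [IsSimpleRing B] [Module.Finite F B]
    (β : B →ₐ[F] Matrix (Fin r) (Fin r) L) (hr : r * r = finrank F B)
    (γ : B →ₐ[F] Matrix (Fin r) (Fin r) (genField ρ))
    (Q Q' : (L ≃ₐ[F] L) → Matrix (Fin r) (Fin r) L) (h1 : ∀ g, Q g * Q' g = 1)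
    (h2 : ∀ g, Q' g * Q g = 1)
    (hQ : ∀ g b, Q g * (β b).map g = β b * Q g)
    (u : (L ≃ₐ[F] L) → Adm ρ) (hu : ∀ g, (u g).g = g) (c d : (L ≃ₐ[F] L) → (L ≃ₐ[F] L) → L)
    (hc0 : ∀ g h, c g h ≠ 0)
    (hc : ∀ g h, (u g).P * (u h).P.map g = c g h • (u (g * h)).P)
    (hd0 : ∀ g h, d g h ≠ 0) (hd : ∀ g h, Q g * (Q h).map g = d g h • Q (g * h)) :
    ∃ (N : ℤ) (l : (L ≃ₐ[F] L) → L), (∀ g, l g ≠ 0) ∧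
      ∀ g h, l g * g (l h) = d g h * l (g * h) * c g h ^ N := by
  classical
  let _ : StrongNormalizationMonoid (MvPolynomial (Fin n) L) := UniqueFactorizationMonoid.strongNormalizationMonoid
  let _ : NormalizedGCDMonoid (MvPolynomial (Fin n) L) := UniqueFactorizationMonoid.toNormalizedGCDMonoid _
  have hr' : Fintype.card (Fin r) * Fintype.card (Fin r) = finrank F B := by simpa using hr
  have : Nonempty (Fin r) := finrank_isSquare_index hr'
  let 𝔽s := fixedField ρ {v | ∃ t ht, v = Adm.scal ρ t ht}
  have hL : ∀ l : L, algebraMap L (FractionRing (MvPolynomial (Fin n) L)) l ∈ 𝔽s := by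
    rintro l v ⟨t, ht, rfl⟩
    rw [Adm.frac_base]; rfl
  let iL : L →ₐ[F] 𝔽s := (IsScalarTower.toAlgHom F L (FractionRing (MvPolynomial (Fin n) L))).codRestrict 𝔽s.toSubalgebra hL
  let iE : genField ρ →ₐ[F] 𝔽s := IntermediateField.inclusion (fun x hx v _ => hx v trivial)
  obtain ⟨S₀, S₀', hS1, hS2, hS⟩ := rep_conj (iE.mapMatrix.comp γ) (iL.mapMatrix.comp β) hr'
  let S : Matrix (Fin r) (Fin r) (FractionRing (MvPolynomial (Fin n) L)) := S₀.map 𝔽s.val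
  let S' : Matrix (Fin r) (Fin r) (FractionRing (MvPolynomial (Fin n) L)) := S₀'.map 𝔽s.val
  have hSS' : S * S' = 1 := by rw [← matrix_map_mul, hS1, matrix_map_one]
  have hS'S : S' * S = 1 := by rw [← matrix_map_mul, hS2, matrix_map_one]
  have hSscal : ∀ t ht, S.map (Adm.scal ρ t ht).frac = S := by
    intro t ht
    ext i j
    exact (S₀ i j).2 _ ⟨t, ht, rfl⟩
  let γ' : B → Matrix (Fin r) (Fin r) (FractionRing (MvPolynomial (Fin n) L)) := fun b => (γ b).map (algebraMap (genField ρ) (FractionRing (MvPolynomial (Fin n) L)))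
  let up (X : Matrix (Fin r) (Fin r) L) : Matrix (Fin r) (Fin r) (FractionRing (MvPolynomial (Fin n) L)) := X.map (algebraMap L (FractionRing (MvPolynomial (Fin n) L)))
  have hup : ∀ X Y, up (X * Y) = up X * up Y := fun X Y => matrix_map_mul _ _ _
  have hγfix : ∀ (v : Adm ρ) b, (γ' b).map v.frac = γ' b := by
    intro v b
    ext i j
    exact (γ b i j).2 v trivial
  have hβS : ∀ b, up (β b) * S = S * γ' b := by
    intro b
    have e1 : up (β b) = ((iL.mapMatrix.comp β) b).map 𝔽s.val := rfl
    have e2 : γ' b = ((iE.mapMatrix.comp γ) b).map 𝔽s.val := rfl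
    rw [e1, e2, ← matrix_map_mul, ← matrix_map_mul, hS b, mul_assoc, hS2, mul_one]
  have hf : ∀ g, ∃ f : (FractionRing (MvPolynomial (Fin n) L)), up (Q g) * S.map (u g).frac = f • S := by
    intro g
    obtain ⟨f, hf⟩ := rep_commutant (M' := (FractionRing (MvPolynomial (Fin n) L))) γ hr' (S' * up (Q g) * S.map (u g).frac) (by
      intro b
      change γ' b * _ = _ * γ' b
      have e1 : γ' b * S' = S' * up (β b) := by
        calc γ' b * S' = S' * (S * γ' b) * S' := by rw [← mul_assoc S', hS'S, one_mul]
          _ = _ := by rw [← hβS, mul_assoc, mul_assoc, hSS', mul_one]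
      have e2 : (up (β b)).map (u g).frac * S.map (u g).frac = S.map (u g).frac * γ' b := by
        rw [← matrix_map_mul, hβS, matrix_map_mul, hγfix]
      have e3 : (up (β b)).map (u g).frac = up ((β b).map g) := by
        rw [Adm.frac_map_base, hu]
      rw [mul_assoc (S' * up (Q g)), ← e2, e3, ← mul_assoc, ← mul_assoc, e1, mul_assoc S',
        mul_assoc S', mul_assoc S', ← mul_assoc (up (Q g)), ← hup, ← hup, ← hQ, hup]
      )
    refine ⟨f, ?_⟩
    rw [← scalar_mul_eq_smul, (Matrix.scalar_commute f (fun _ => Commute.all _ _) S).eq, ← hf,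
      ← mul_assoc, ← mul_assoc, hSS', one_mul]
  choose f hf using hf
  have hSne : ∀ x y : (FractionRing (MvPolynomial (Fin n) L)), x • S = y • S → x = y := by
    intro x y hxy
    have h3 : Matrix.scalar (Fin r) x = Matrix.scalar (Fin r) y := by
      calc Matrix.scalar (Fin r) x = (x • S) * S' := by
            rw [← scalar_mul_eq_smul, mul_assoc, hSS', mul_one]
        _ = _ := by rw [hxy, ← scalar_mul_eq_smul, mul_assoc, hSS', mul_one]
    exact Matrix.scalar_inj.1 h3
  have hmapsmul : ∀ (φ : (FractionRing (MvPolynomial (Fin n) L)) →+* (FractionRing (MvPolynomial (Fin n) L))) (x : (FractionRing (MvPolynomial (Fin n) L))) (X : Matrix (Fin r) (Fin r) (FractionRing (MvPolynomial (Fin n) L))),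
      (x • X).map φ = φ x • X.map φ := by
    intro φ x X; ext; simp
  have hmapcomp : ∀ (φ ψ : (FractionRing (MvPolynomial (Fin n) L)) →+* (FractionRing (MvPolynomial (Fin n) L))) (X : Matrix (Fin r) (Fin r) (FractionRing (MvPolynomial (Fin n) L))),
      X.map (φ.comp ψ) = (X.map ψ).map φ := fun _ _ _ => rfl
  have hfr : ∀ (v : Adm ρ) (x : (MvPolynomial (Fin n) L)), algebraMap (MvPolynomial (Fin n) L) (FractionRing (MvPolynomial (Fin n) L)) (v.poly x) = v.frac (algebraMap (MvPolynomial (Fin n) L) (FractionRing (MvPolynomial (Fin n) L)) x) :=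
    fun v x => (Adm.frac_algebraMap v x).symm
  have hCL : ∀ x : L, algebraMap (MvPolynomial (Fin n) L) (FractionRing (MvPolynomial (Fin n) L)) (C x) = algebraMap L (FractionRing (MvPolynomial (Fin n) L)) x :=
    fun x => (Adm.algebraMap_eq x).symm
  have hf0 : ∀ g, f g ≠ 0 := by
    intro g hg
    have h3 := hf g
    rw [hg, zero_smul] at h3
    have h4 : S.map (u g).frac = 0 := by
      calc S.map (u g).frac = up (Q' g * Q g) * S.map (u g).frac := by
            rw [h2]; simp only [up]; rw [matrix_map_one, one_mul]
        _ = 0 := by rw [hup, mul_assoc, h3, mul_zero]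
    have h5 : (1 : Matrix (Fin r) (Fin r) (FractionRing (MvPolynomial (Fin n) L))) = 0 := by
      calc (1 : Matrix (Fin r) (Fin r) (FractionRing (MvPolynomial (Fin n) L))) = (S * S').map (u g).frac := by
            rw [hSS', matrix_map_one]
        _ = 0 := by rw [matrix_map_mul, h4, zero_mul]
    exact one_ne_zero h5
  have hfscal : ∀ t ht g, (Adm.scal ρ t ht).frac (f g) = f g := by
    intro t ht g
    apply hSne
    calc (Adm.scal ρ t ht).frac (f g) • S = (f g • S).map (Adm.scal ρ t ht).frac := by
          rw [hmapsmul, hSscal]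
      _ = up (Q g) * (S.map (u g).frac).map (Adm.scal ρ t ht).frac := by
          rw [← hf, matrix_map_mul, Adm.frac_map_base]
          congr 2
      _ = up (Q g) * S.map (u g).frac := by
          congr 1
          rw [← hmapcomp, Adm.frac_scal_scal_comm, hmapcomp, hSscal]
      _ = f g • S := hf g
  have hcomp : ∀ g h, (u g).frac.comp (u h).frac =
      (Adm.scal ρ (c g h) (hc0 g h)).frac.comp (u (g * h)).frac := by
    intro g h
    apply Adm.frac_comp_of_mul
    · rw [hu, hu, hu]
    · rw [hu]; exact hc g h
  have hff : ∀ g h, f g * (u g).frac (f h) = algebraMap L (FractionRing (MvPolynomial (Fin n) L)) (d g h) * f (g * h) := by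
    intro g h
    apply hSne
    have e1 : (up (Q h)).map (u g).frac = up ((Q h).map g) := by
      rw [Adm.frac_map_base, hu]
    have e4 : S.map ((u g).frac.comp (u h).frac) =
        (S.map (u (g * h)).frac).map (Adm.scal ρ (c g h) (hc0 g h)).frac := by
      rw [hcomp, hmapcomp]
    have e5 : S.map (u (g * h)).frac = f (g * h) • (up (Q' (g * h)) * S) := by
      rw [← Matrix.mul_smul, ← hf, ← mul_assoc, ← hup, h2]
      simp only [up]; rw [matrix_map_one, one_mul]
    calc (f g * (u g).frac (f h)) • S = (u g).frac (f h) • (f g • S) := by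
          rw [smul_smul, mul_comm]
      _ = up (Q g) * (f h • S).map (u g).frac := by
          rw [← hf, hmapsmul, Matrix.mul_smul]
      _ = up (Q g * (Q h).map g) * S.map ((u g).frac.comp (u h).frac) := by
          rw [← hf, matrix_map_mul, e1, hup, hmapcomp, mul_assoc]
      _ = algebraMap L (FractionRing (MvPolynomial (Fin n) L)) (d g h) • (up (Q (g * h)) * S.map (u (g * h)).frac) := by
          rw [hd, e4, e5, hmapsmul, hfscal, matrix_map_mul, hSscal, Adm.frac_map_base]
          have e6 : (Q' (g * h)).map (Adm.scal ρ (c g h) (hc0 g h)).g = Q' (g * h) := by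
            ext; simp [Adm.scal]
          rw [e6]
          have e7 : up (d g h • Q (g * h)) = algebraMap L (FractionRing (MvPolynomial (Fin n) L)) (d g h) • up (Q (g * h)) := by
            ext; simp [up]
          rw [e7, Matrix.smul_mul]
      _ = _ := by rw [hf, smul_smul]
  -- clear denominators
  obtain ⟨⟨q, hq⟩, hp⟩ := IsLocalization.exist_integer_multiples_of_finite (nonZeroDivisors (MvPolynomial (Fin n) L)) f
  choose p hp using hp
  have hq0 : q ≠ 0 := nonZeroDivisors.ne_zero hq
  have hp : ∀ g, algebraMap (MvPolynomial (Fin n) L) (FractionRing (MvPolynomial (Fin n) L)) (p g) = algebraMap (MvPolynomial (Fin n) L) (FractionRing (MvPolynomial (Fin n) L)) q * f g := by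
    intro g; rw [hp g, Algebra.smul_def]
  have hp0 : ∀ g, p g ≠ 0 := by
    intro g hg
    have h3 := hp g
    rw [hg, map_zero] at h3
    refine (mul_ne_zero ?_ (hf0 g)) h3.symm
    simpa using hq0
  have inj : Function.Injective (algebraMap (MvPolynomial (Fin n) L) (FractionRing (MvPolynomial (Fin n) L))) := IsFractionRing.injective (MvPolynomial (Fin n) L) (FractionRing (MvPolynomial (Fin n) L))
  let G := Finset.univ.gcd p
  have hG0 : G ≠ 0 := by
    intro h
    exact hp0 1 ((Finset.gcd_eq_zero_iff.1 h) 1 (Finset.mem_univ _))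
  have hunit : ∀ x y : (MvPolynomial (Fin n) L), Associated x y → ∃ l : L, l ≠ 0 ∧ x = C l * y := by
    rintro x y hxy
    obtain ⟨v, hv⟩ := hxy.symm
    obtain ⟨l, hl, hvl⟩ := isUnit_iff_eq_C_of_isReduced.1 v.isUnit
    exact ⟨l, hl.ne_zero, by rw [← hv, hvl, mul_comm]⟩
  have hl : ∀ g, ∃ l : L, l ≠ 0 ∧ p g * (u g).poly G = C l * ((u g).poly q * G) := by
    intro g
    refine hunit _ _ (associated_gcd_of_twist p (u g).poly (p g) ((u g).poly q)
      (fun h => C (d g h)) (fun h => (hd0 g h).isUnit.map C) (Equiv.mulLeft g) fun h => ?_)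
    apply inj
    have h3 := hff g h
    simp only [map_mul, hfr, hp, Equiv.coe_mulLeft, hCL]
    linear_combination (algebraMap (MvPolynomial (Fin n) L) (FractionRing (MvPolynomial (Fin n) L)) q * (u g).frac (algebraMap (MvPolynomial (Fin n) L) (FractionRing (MvPolynomial (Fin n) L)) q)) * h3
  choose l hl0 hl using hl
  obtain ⟨N, hN⟩ := exists_zpow_of_twist_scalar G q hG0 hq0
  have hscalG : ∀ t ht, (Adm.scal ρ t ht).poly G * q =
      C (t⁻¹ ^ N) * (G * (Adm.scal ρ t ht).poly q) := by
    intro t ht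
    obtain ⟨κ, hκ0, hκ⟩ := hunit _ _ (associated_gcd_of_twist p (Adm.scal ρ t ht).poly q
      ((Adm.scal ρ t ht).poly q) (fun h => 1) (fun h => isUnit_one) (Equiv.refl _) fun h => by
        apply inj
        simp only [map_mul, hfr, hp, Equiv.refl_apply, hfscal, one_mul]
        ring)
    have hκ' : (Adm.scal ρ t ht).poly G * q = C κ * (G * (Adm.scal ρ t ht).poly q) := by
      linear_combination hκ
    rw [hκ', hN t⁻¹ κ (inv_ne_zero ht) hκ']
  let φ : (FractionRing (MvPolynomial (Fin n) L)) := algebraMap (MvPolynomial (Fin n) L) (FractionRing (MvPolynomial (Fin n) L)) G / algebraMap (MvPolynomial (Fin n) L) (FractionRing (MvPolynomial (Fin n) L)) q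
  have hqne : algebraMap (MvPolynomial (Fin n) L) (FractionRing (MvPolynomial (Fin n) L)) q ≠ 0 := by simpa using hq0
  have hφ0 : φ ≠ 0 := div_ne_zero (by simpa using hG0) hqne
  have hφu : ∀ g, f g * (u g).frac φ = algebraMap L (FractionRing (MvPolynomial (Fin n) L)) (l g) * φ := by
    intro g
    have h3 := congrArg (algebraMap (MvPolynomial (Fin n) L) (FractionRing (MvPolynomial (Fin n) L))) (hl g)
    simp only [map_mul, hp, hfr, hCL] at h3
    have h4 : (u g).frac (algebraMap (MvPolynomial (Fin n) L) (FractionRing (MvPolynomial (Fin n) L)) q) ≠ 0 := (map_ne_zero _).2 hqne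
    simp only [φ, map_div₀]
    rw [mul_div_assoc', mul_div_assoc', div_eq_div_iff h4 hqne]
    linear_combination h3
  have hφs : ∀ t ht, (Adm.scal ρ t ht).frac φ = algebraMap L (FractionRing (MvPolynomial (Fin n) L)) (t⁻¹ ^ N) * φ := by
    intro t ht
    have h3 := congrArg (algebraMap (MvPolynomial (Fin n) L) (FractionRing (MvPolynomial (Fin n) L))) (hscalG t ht)
    rw [map_mul, map_mul, map_mul, hfr, hfr, hCL] at h3
    have h4 : (Adm.scal ρ t ht).frac (algebraMap (MvPolynomial (Fin n) L) (FractionRing (MvPolynomial (Fin n) L)) q) ≠ 0 := (map_ne_zero _).2 hqne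
    simp only [φ, map_div₀]
    rw [mul_div_assoc', div_eq_div_iff h4 hqne]
    linear_combination h3
  refine ⟨-N, l, hl0, fun g h => ?_⟩
  apply (algebraMap L (FractionRing (MvPolynomial (Fin n) L))).injective
  apply mul_right_cancel₀ hφ0
  have h3 := DFunLike.congr_fun (hcomp g h) φ
  simp only [RingHom.comp_apply] at h3
  have h4 := congrArg (u g).frac (hφu h)
  have h5 := congrArg (Adm.scal ρ (c g h) (hc0 g h)).frac (hφu (g * h))
  rw [map_mul, map_mul, Adm.frac_base, hu] at h4
  rw [map_mul, map_mul, Adm.frac_base, hφs, hfscal] at h5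
  have h6 : (Adm.scal ρ (c g h) (hc0 g h)).g (l (g * h)) = l (g * h) := rfl
  rw [h6, inv_zpow'] at h5
  simp only [map_mul]
  have h7 := hff g h
  have h8 := hφu g
  linear_combination (-(algebraMap L (FractionRing (MvPolynomial (Fin n) L)) (g (l h)))) * h8 - f g * h4
    + (f g * (u g).frac (f h)) * h3 + (algebraMap L (FractionRing (MvPolynomial (Fin n) L)) (d g h)) * h5
    + (Adm.scal ρ (c g h) (hc0 g h)).frac ((u (g * h)).frac φ) * h7

end Cocycle

theorem IsInvolution.map_one {F A : Type} [CommRing F] [Ring A] [Algebra F A] {σ : A →ₗ[F] A}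
    (hσ : IsInvolution F σ) : σ 1 = 1 := by
  have h := hσ.1 1 (σ 1)
  rw [one_mul, hσ.2, one_mul] at h
  exact h.symm

section Twisted

variable {F : Type} [Field F] {L : Type} [Field L] [Algebra F L]

theorem exists_rep_of_coboundary [FiniteDimensional F L] [IsGalois F L] {m B : Type} [Fintype m]
    [DecidableEq m] [Ring B] [Algebra F B] (β : B →ₐ[F] Matrix m m L)
    (Q Q' : (L ≃ₐ[F] L) → Matrix m m L)
    (h2 : ∀ g, Q' g * Q g = 1) (hQ : ∀ g b, Q g * (β b).map g = β b * Q g)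
    (d : (L ≃ₐ[F] L) → (L ≃ₐ[F] L) → L) (hd : ∀ g h, Q g * (Q h).map g = d g h • Q (g * h))
    (ν : (L ≃ₐ[F] L) → L) (hν0 : ∀ g, ν g ≠ 0)
    (hν : ∀ g h, ν g * g (ν h) = d g h * ν (g * h)) :
    Nonempty (B →ₐ[F] Matrix m m F) := by
  have hmap : ∀ (g : L ≃ₐ[F] L) (x : L) (X : Matrix m m L), (x • X).map g = g x • X.map g := by
    intro g x X; ext; simp
  have hc : ∀ g h, ((ν g)⁻¹ • Q g) * ((ν h)⁻¹ • Q h).map g = (ν (g * h))⁻¹ • Q (g * h) := by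
    intro g h
    have h0 : g (ν h) ≠ 0 := by simpa using hν0 h
    have h3 : (ν g)⁻¹ * (g (ν h))⁻¹ * d g h = (ν (g * h))⁻¹ := by
      have := hν g h
      have := hν0 g
      have := hν0 (g * h)
      field_simp
      rw [hν g h]
    rw [hmap, smul_mul_smul_comm, hd, smul_smul, map_inv₀, h3]
  refine exists_rep_of_cocycle β (fun g => (ν g)⁻¹ • Q g) ?_ hc ?_
  · have h4 := hc 1 1
    have h5 : ((ν 1)⁻¹ • Q 1).map (1 : L ≃ₐ[F] L) = (ν 1)⁻¹ • Q 1 := by ext; simp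
    rw [mul_one, h5] at h4
    calc (ν 1)⁻¹ • Q 1 = (ν 1 • Q' 1) * (((ν 1)⁻¹ • Q 1) * ((ν 1)⁻¹ • Q 1)) := by
          rw [← mul_assoc, smul_mul_smul_comm (ν 1), h2, mul_inv_cancel₀ (hν0 1), one_smul, one_mul]
      _ = 1 := by
          rw [h4, smul_mul_smul_comm, h2, mul_inv_cancel₀ (hν0 1), one_smul]
  · intro g b
    rw [smul_mul_assoc, hQ, mul_smul_comm]

/-- The transpose of the representation `ρ` composed with an involution. -/
def transposeRep {A : Type} [Ring A] [Algebra F A] {σ : A →ₗ[F] A} (hσ : IsInvolution F σ)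
    {m : Type} [Fintype m] [DecidableEq m] (ρ : A →ₐ[F] Matrix m m L) : A →ₐ[F] Matrix m m L where
  toFun a := (ρ (σ a)).transpose
  map_one' := by rw [hσ.map_one, map_one, Matrix.transpose_one]
  map_mul' a b := by rw [hσ.1, map_mul, Matrix.transpose_mul]
  map_zero' := by simp
  map_add' a b := by simp
  commutes' r := by
    rw [Algebra.algebraMap_eq_smul_one, map_smul, hσ.map_one, map_smul, map_one,
      Matrix.transpose_smul, Matrix.transpose_one, ← Algebra.algebraMap_eq_smul_one]

theorem exists_similitude_multiplier {A : Type} [Ring A] [Algebra F A] [Algebra.IsCentral F A]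
    [IsSimpleRing A] [Module.Finite F A] {σ : A →ₗ[F] A} (hσ : IsInvolution F σ)
    {m : Type} [Fintype m] [DecidableEq m] (ρ : A →ₐ[F] Matrix m m L)
    (hm : Fintype.card m * Fintype.card m = finrank F A)
    (P P' : (L ≃ₐ[F] L) → Matrix m m L) (h2 : ∀ g, P' g * P g = 1)
    (hP : ∀ g a, P g * (ρ a).map g = ρ a * P g)
    (c : (L ≃ₐ[F] L) → (L ≃ₐ[F] L) → L) (hc : ∀ g h, P g * (P h).map g = c g h • P (g * h)) :
    ∃ μ : (L ≃ₐ[F] L) → L, (∀ g, μ g ≠ 0) ∧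
      ∀ g h, μ g * g (μ h) = c g h ^ 2 * μ (g * h) := by
  have : Nonempty m := finrank_isSquare_index hm
  obtain ⟨H, H', hH1, hH2, hH⟩ := rep_conj ρ (transposeRep hσ ρ) hm
  have hH3 : ∀ a, H' * (ρ (σ a)).transpose = ρ a * H' := by
    intro a
    have : (ρ (σ a)).transpose = H * ρ a * H' := hH a
    rw [this, mul_assoc, ← mul_assoc, hH2, one_mul]
  have hM : ∀ g, ∃ x : L, P g * H'.map g * (P g).transpose = x • H' := by
    intro g
    obtain ⟨x, hx⟩ := rep_commutant (M' := L) ρ hm (P g * H'.map g * (P g).transpose * H) (by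
      intro a
      have e : (ρ a).map (algebraMap L L) = ρ a := by ext; simp
      rw [e]
      have e2 : ((ρ (σ a)).transpose).map g * (P g).transpose =
          (P g).transpose * (ρ (σ a)).transpose := by
        rw [← Matrix.transpose_mul, ← hP, Matrix.transpose_mul, Matrix.transpose_map]
      calc ρ a * (P g * H'.map g * (P g).transpose * H)
          = (ρ a * P g) * H'.map g * (P g).transpose * H := by simp only [mul_assoc]
        _ = P g * ((ρ a).map g * H'.map g) * (P g).transpose * H := by
          rw [← hP]; simp only [mul_assoc]
        _ = P g * H'.map g * (((ρ (σ a)).transpose).map g * (P g).transpose) * H := by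
          rw [← matrix_map_mul, ← hH3, matrix_map_mul]; simp only [mul_assoc]
        _ = P g * H'.map g * (P g).transpose * ((ρ (σ a)).transpose * H) := by
          rw [e2]; simp only [mul_assoc]
        _ = P g * H'.map g * (P g).transpose * H * ρ a := by
          have : (ρ (σ a)).transpose = H * ρ a * H' := hH a
          rw [this, mul_assoc (H * ρ a), hH2, mul_one]; simp only [mul_assoc])
    refine ⟨x, ?_⟩
    rw [← scalar_mul_eq_smul, ← hx, mul_assoc _ H, hH1, mul_one]
  choose μ hμ using hM
  have hmap : ∀ (g : L ≃ₐ[F] L) (x : L) (X : Matrix m m L), (x • X).map g = g x • X.map g := by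
    intro g x X; ext; simp
  have hH'0 : H' ≠ 0 := by
    rintro rfl
    rw [mul_zero] at hH1
    exact zero_ne_one hH1
  refine ⟨μ, ?_, ?_⟩
  · intro g hg
    have h3 := hμ g
    rw [hg, zero_smul] at h3
    apply hH'0
    have h4 : H'.map g = 0 := by
      calc H'.map g = P' g * (P g * H'.map g * (P g).transpose) * (P' g).transpose := by
            rw [mul_assoc, mul_assoc _ (P g).transpose, ← Matrix.transpose_mul, h2,
              Matrix.transpose_one, mul_one, ← mul_assoc, h2, one_mul]
        _ = 0 := by rw [h3, mul_zero, zero_mul]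
    ext i j
    have := congrFun₂ h4 i j
    simpa using this
  · intro g h
    have e : (H'.map h).map g = H'.map (g * h) := by ext; simp
    have h3 : (c g h ^ 2 * μ (g * h)) • H' = (μ g * g (μ h)) • H' := by
      calc (c g h ^ 2 * μ (g * h)) • H'
          = (c g h • P (g * h)) * H'.map (g * h) * (c g h • P (g * h)).transpose := by
            rw [Matrix.transpose_smul, smul_mul_assoc, smul_mul_assoc, mul_smul_comm, hμ,
              smul_smul, smul_smul, sq]
        _ = P g * ((P h * H'.map h * (P h).transpose).map g) * (P g).transpose := by
            rw [← hc, Matrix.transpose_mul, ← e, matrix_map_mul, matrix_map_mul,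
              Matrix.transpose_map]
            simp only [mul_assoc]
        _ = _ := by
            rw [hμ, hmap, mul_smul_comm, smul_mul_assoc, hμ, smul_smul, mul_comm]
    have h4 := smul_left_injective _ hH'0 h3
    exact h4.symm

/-- The tensor product of two matrix representations. -/
def tensorRep {A B : Type} [Ring A] [Algebra F A] [Ring B] [Algebra F B] {m n : Type} [Fintype m]
    [DecidableEq m] [Fintype n] [DecidableEq n] (β : B →ₐ[F] Matrix m m L)
    (ρ : A →ₐ[F] Matrix n n L) : B ⊗[F] A →ₐ[F] Matrix (m × n) (m × n) L :=
  Algebra.TensorProduct.algHomOfLinearMapTensorProduct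
    (TensorProduct.lift (LinearMap.mk₂ F (fun b a => Matrix.kronecker (β b) (ρ a))
      (fun b b' a => by simp [Matrix.add_kronecker])
      (fun c b a => by simp [Matrix.smul_kronecker])
      (fun b a a' => by simp [Matrix.kronecker_add])
      (fun c b a => by simp [Matrix.kronecker_smul])))
    (fun b b' a a' => by simp [Matrix.mul_kronecker_mul])
    (by simp)

@[simp] theorem tensorRep_tmul {A B : Type} [Ring A] [Algebra F A] [Ring B] [Algebra F B]
    {m n : Type} [Fintype m] [DecidableEq m] [Fintype n] [DecidableEq n]
    (β : B →ₐ[F] Matrix m m L) (ρ : A →ₐ[F] Matrix n n L) (b : B) (a : A) :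
    tensorRep β ρ (b ⊗ₜ a) = Matrix.kronecker (β b) (ρ a) := rfl

theorem kronecker_map_ringHom {K K' 𝓕 m n : Type} [CommRing K] [CommRing K'] [FunLike 𝓕 K K']
    [RingHomClass 𝓕 K K'] (f : 𝓕) (X : Matrix m m K) (Y : Matrix n n K) :
    (Matrix.kronecker X Y).map f = Matrix.kronecker (X.map f) (Y.map f) := by
  ext; simp

end Twisted

/-- Amitsur's theorem: the class of a central simple algebra `A` with involution (of the first
kind) generates the kernel of scalar extension to a generic splitting field of `A`. -/
theorem exists_generic_splitting {F : Type} [Field F] {A B : Type} [Ring A] [Algebra F A]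
    [Algebra.IsCentral F A] [IsSimpleRing A] [Module.Finite F A] [Ring B] [Algebra F B]
    [Algebra.IsCentral F B] [IsSimpleRing B] [Module.Finite F B] {σ : A →ₗ[F] A}
    (hσ : IsInvolution F σ) :
    ∃ (E : Type) (_ : Field E) (_ : Algebra F E), SplitBy F A E ∧
      (∀ (x : E) (c : F), x * x - x = algebraMap F E c → x ∈ Set.range (algebraMap F E)) ∧
      (SplitBy F B E → SplitBy F B F ∨ SplitBy F (B ⊗[F] A) F) := by
  obtain ⟨L, _, _, _, _, ⟨n, hn, ⟨ρ⟩⟩, ⟨r, hr, ⟨β⟩⟩⟩ := exists_galois_splitBy (F := F) A B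
  refine ⟨genField ρ, inferInstance, inferInstance, splitBy_genField hn,
    mem_base_of_mem_genField hn, ?_⟩
  rintro ⟨r', hr', ⟨γ⟩⟩
  obtain rfl : r' = r := Nat.mul_self_inj.1 (hr'.trans hr.symm)
  have hnc : Fintype.card (Fin n) * Fintype.card (Fin n) = finrank F A := by simpa using hn
  have hrc : Fintype.card (Fin r') * Fintype.card (Fin r') = finrank F B := by simpa using hr
  choose u hu using exists_adm (ρ := ρ) hn
  have hQ : ∀ g : L ≃ₐ[F] L, ∃ Q Q' : Matrix (Fin r') (Fin r') L, Q * Q' = 1 ∧ Q' * Q = 1 ∧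
      ∀ b, Q * (β b).map g = β b * Q := by
    intro g
    obtain ⟨P, Q, h1, h2, h⟩ := rep_conj ((g : L →ₐ[F] L).mapMatrix.comp β) β hrc
    refine ⟨P, Q, h1, h2, fun a => ?_⟩
    conv_rhs => rw [h a, mul_assoc, h2, mul_one]
    rfl
  choose Q Q' h1 h2 hQ using hQ
  choose d hd0 hd using cocycle_of_intertwiner β hrc Q Q' h1 h2 hQ
  have hP : ∀ g a, (u g).P * (ρ a).map g = ρ a * (u g).P := by
    intro g a
    have := (u g).comm a
    rwa [hu] at this
  choose c hc0 hc using cocycle_of_intertwiner ρ hnc (fun g => (u g).P) (fun g => (u g).P')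
    (fun g => (u g).mul_inv) (fun g => (u g).inv_mul) hP
  obtain ⟨N, l, hl0, hl⟩ := exists_cocycle_relation β hr γ Q Q' h1 h2 hQ u hu c d hc0 hc hd0 hd
  obtain ⟨μ, hμ0, hμ⟩ := exists_similitude_multiplier hσ ρ hnc (fun g => (u g).P)
    (fun g => (u g).P') (fun g => (u g).inv_mul) hP c hc
  have key : ∀ (k : ℤ) g h, l g * (μ g ^ k)⁻¹ * g (l h * (μ h ^ k)⁻¹) =
      d g h * c g h ^ (N - 2 * k) * (l (g * h) * (μ (g * h) ^ k)⁻¹) := by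
    intro k g h
    have e1 : (μ g * g (μ h)) ^ k = c g h ^ (2 * k) * μ (g * h) ^ k := by
      rw [hμ, mul_zpow, zpow_mul]; norm_cast
    calc l g * (μ g ^ k)⁻¹ * g (l h * (μ h ^ k)⁻¹)
        = (l g * g (l h)) * ((μ g * g (μ h)) ^ k)⁻¹ := by
          rw [mul_zpow, mul_inv, map_mul, map_inv₀, map_zpow₀]; ring
      _ = _ := by
          rw [hl, e1, zpow_sub₀ (hc0 g h), mul_inv]; ring
  have hν0 : ∀ (k : ℤ) g, l g * (μ g ^ k)⁻¹ ≠ 0 := fun k g =>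
    mul_ne_zero (hl0 g) (inv_ne_zero (zpow_ne_zero _ (hμ0 g)))
  obtain ⟨k, rfl | rfl⟩ := Int.even_or_odd' N
  · left
    obtain ⟨τ⟩ := exists_rep_of_coboundary β Q Q' h2 hQ d hd (fun g => l g * (μ g ^ k)⁻¹) (hν0 k)
      (fun g h => by rw [key, sub_self, zpow_zero, mul_one])
    exact ⟨r', hr, ⟨τ⟩⟩
  · right
    have hkr : ∀ (X Y : Matrix (Fin r') (Fin r') L) (Z W : Matrix (Fin n) (Fin n) L),
      Matrix.kronecker (X * Y) (Z * W) = Matrix.kronecker X Z * Matrix.kronecker Y W :=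
        fun X Y Z W => Matrix.mul_kronecker_mul X Y Z W
    obtain ⟨τ⟩ := exists_rep_of_coboundary (tensorRep β ρ)
      (fun g => Matrix.kronecker (Q g) (u g).P) (fun g => Matrix.kronecker (Q' g) (u g).P')
      (fun g => by rw [← hkr, h2, (u g).inv_mul]; simp)
      (fun g b => by
        induction b with
        | zero => simp
        | add x y hx hy =>
          rw [map_add, add_mul, ← hx, ← hy, ← mul_add]
          congr 1
          ext; simp
        | tmul b a => rw [tensorRep_tmul, kronecker_map_ringHom, ← hkr, ← hkr, hQ, hP])
      (fun g h => d g h * c g h)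
      (fun g h => by
        rw [kronecker_map_ringHom, ← hkr, hd, hc]
        simp [Matrix.smul_kronecker, Matrix.kronecker_smul, smul_smul, mul_comm])
      (fun g => l g * (μ g ^ k)⁻¹) (hν0 k)
      (fun g h => by rw [key, add_sub_cancel_left, zpow_one])
    refine ⟨r' * n, ?_, ⟨(Matrix.reindexAlgEquiv F F finProdFinEquiv).toAlgHom.comp τ⟩⟩
    rw [finrank_tensorProduct, ← hr, ← hn]; ring

section ReducedTrace

variable {F : Type} [Field F]

theorem exists_common_extension (E E' : Type) [Field E] [Algebra F E] [Field E'] [Algebra F E'] :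
    ∃ (M : Type) (_ : Field M) (_ : Algebra F M), Nonempty (E →ₐ[F] M) ∧ Nonempty (E' →ₐ[F] M) := by
  obtain ⟨I, hI⟩ := Ideal.exists_maximal (E ⊗[F] E')
  let _ : Field ((E ⊗[F] E') ⧸ I) := Ideal.Quotient.field I
  exact ⟨(E ⊗[F] E') ⧸ I, inferInstance, inferInstance,
    ⟨(Ideal.Quotient.mkₐ F I).comp Algebra.TensorProduct.includeLeft⟩,
    ⟨(Ideal.Quotient.mkₐ F I).comp Algebra.TensorProduct.includeRight⟩⟩

variable {A : Type} [Ring A] [Algebra F A]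

theorem IsReducedTrace.mul_comm {T : A →ₗ[F] F} (hT : IsReducedTrace F A T) (x y : A) :
    T (x * y) = T (y * x) := by
  obtain ⟨E, _, _, n, e, he⟩ := hT
  apply (algebraMap F E).injective
  have h : ∀ x y : A, (1 : E) ⊗ₜ[F] (x * y) = (1 ⊗ₜ x) * (1 ⊗ₜ y) := by simp
  rw [he, he, h, h, map_mul, map_mul, Matrix.trace_mul_comm]

variable [Algebra.IsCentral F A] [IsSimpleRing A] [Module.Finite F A]

theorem trace_rep_conj {M m : Type} [Field M] [Algebra F M] [Fintype m] [DecidableEq m]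
    (ρ ρ' : A →ₐ[F] Matrix m m M) (h : Fintype.card m * Fintype.card m = finrank F A) (a : A) :
    Matrix.trace (ρ a) = Matrix.trace (ρ' a) := by
  obtain ⟨P, Q, -, h2, hPQ⟩ := rep_conj ρ ρ' h
  rw [hPQ, Matrix.trace_mul_comm, ← mul_assoc, h2, one_mul]

theorem IsReducedTrace.eq_trace_rep {T : A →ₗ[F] F} (hT : IsReducedTrace F A T) {E : Type}
    [Field E] [Algebra F E] {n : ℕ} (ρ : A →ₐ[F] Matrix (Fin n) (Fin n) E)
    (hn : n * n = finrank F A) (a : A) : algebraMap F E (T a) = Matrix.trace (ρ a) := by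
  obtain ⟨E', _, _, n', e, he⟩ := hT
  have hn' : n' * n' = finrank F A := by
    have := e.toLinearEquiv.finrank_eq
    rw [Module.finrank_baseChange, Module.finrank_matrix] at this
    simpa using this.symm
  obtain rfl : n' = n := Nat.mul_self_inj.1 (hn'.trans hn.symm)
  obtain ⟨M, _, _, ⟨i⟩, ⟨i'⟩⟩ := exists_common_extension (F := F) E E'
  have h1 := trace_rep_conj (i.mapMatrix.comp ρ) (i'.mapMatrix.comp
    ((e.toAlgHom.restrictScalars F).comp Algebra.TensorProduct.includeRight)) (by simpa using hn) a
  have h2 : ∀ {K : Type} [Field K] [Algebra F K] (i : K →ₐ[F] M)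
      (X : Matrix (Fin n') (Fin n') K), Matrix.trace (i.mapMatrix X) = i (Matrix.trace X) := by
    intro K _ _ i X
    simp [Matrix.trace]
  simp only [AlgHom.comp_apply, h2] at h1
  have h3 : i' (algebraMap F E' (T a)) = i' (Matrix.trace (e ((1 : E') ⊗ₜ[F] a))) := by rw [he]
  apply i.injective
  change i _ = i _
  rw [h1, AlgHom.commutes, ← AlgHom.commutes i', h3]
  rfl

theorem IsReducedTrace.map_involution {T : A →ₗ[F] F} (hT : IsReducedTrace F A T) {σ : A →ₗ[F] A}
    (hσ : IsInvolution F σ) (a : A) : T (σ a) = T a := by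
  obtain ⟨L, _, _, _, _, ⟨n, hn, ⟨ρ⟩⟩, -⟩ := exists_galois_splitBy (F := F) A A
  apply (algebraMap F L).injective
  rw [hT.eq_trace_rep ρ hn, hT.eq_trace_rep ρ hn, ← Matrix.trace_transpose]
  exact trace_rep_conj (transposeRep hσ ρ) ρ (by simpa using hn) a

theorem IsReducedTrace.nondegenerate {T : A →ₗ[F] F} (hT : IsReducedTrace F A T) (x : A)
    (hx : ∀ y, T (x * y) = 0) : x = 0 := by
  obtain ⟨L, _, _, _, _, ⟨n, hn, ⟨ρ⟩⟩, -⟩ := exists_galois_splitBy (F := F) A A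
  have hn' : Fintype.card (Fin n) * Fintype.card (Fin n) = finrank F A := by simpa using hn
  have : Nonempty (Fin n) := finrank_isSquare_index hn'
  have h1 : ∀ z : L ⊗[F] A, Matrix.trace (ρ x * repHom ρ z) = 0 := by
    intro z
    induction z with
    | zero => simp
    | add z w hz hw => rw [map_add, mul_add, Matrix.trace_add, hz, hw, add_zero]
    | tmul l a =>
      rw [repHom_tmul, mul_smul_comm, Matrix.trace_smul, ← map_mul, ← hT.eq_trace_rep ρ hn, hx]
      simp
  have h2 : ρ x = 0 := by
    apply Matrix.ext_iff_trace_mul_right.2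
    intro Y
    obtain ⟨z, rfl⟩ := (repHom_bijective ρ hn').2 Y
    rw [h1, zero_mul, Matrix.trace_zero]
  exact (map_eq_zero_iff ρ ρ.toRingHom.injective).1 h2

theorem exists_eq_sub_involution {T : A →ₗ[F] F} (hT : IsReducedTrace F A T) {σ : A →ₗ[F] A}
    (hσ : IsInvolution F σ) (x : A) (hx : ∀ s, σ s = s → T (x * s) = 0) :
    ∃ z, x = z - σ z := by
  let B : LinearMap.BilinForm F A := (LinearMap.mul F A).compr₂ T
  have hB : ∀ x y, B x y = T (x * y) := fun _ _ => rfl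
  have hrefl : B.IsRefl := fun x y h => by rw [hB] at h ⊢; rw [hT.mul_comm, h]
  have hnd : B.Nondegenerate :=
    (hrefl.nondegenerate_iff_separatingLeft).2 fun x h => hT.nondegenerate x h
  have hSymker : ∀ s, s ∈ symSet F σ ↔ σ s = s := fun s => by
    simp [symSet, sub_eq_zero]
  let alt : A →ₗ[F] A := LinearMap.id - σ
  have hle : LinearMap.range alt ≤ B.orthogonal (symSet F σ) := by
    rintro _ ⟨z, rfl⟩ s hs
    rw [hSymker] at hs
    change T (s * (z - σ z)) = 0
    rw [mul_sub, map_sub, ← hT.map_involution hσ (s * z), hσ.1, hs, hT.mul_comm s, sub_self]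
  have hker : LinearMap.ker alt = symSet F σ := by
    ext s
    rw [hSymker, LinearMap.mem_ker]
    change s - σ s = 0 ↔ σ s = s
    rw [sub_eq_zero, eq_comm]
  have hdim : finrank F (LinearMap.range alt) = finrank F (B.orthogonal (symSet F σ)) := by
    have h1 := LinearMap.finrank_range_add_finrank_ker alt
    rw [hker] at h1
    rw [LinearMap.BilinForm.finrank_orthogonal hnd]
    omega
  have hxmem : x ∈ B.orthogonal (symSet F σ) := by
    intro s hs
    change T (s * x) = 0
    rw [hT.mul_comm, hx s ((hSymker s).1 hs)]
  rw [← Submodule.eq_of_le_of_finrank_eq hle hdim] at hxmem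
  obtain ⟨z, hz⟩ := hxmem
  exact ⟨z, hz.symm⟩

end ReducedTrace

section QuadraticGenerator

variable {F : Type} [Field F] {A : Type} [Ring A] [Algebra F A] [Algebra.IsCentral F A]
  [IsSimpleRing A] [Module.Finite F A]

/-- The semi-trace of a quadratic extension is given by the canonical generator `κ`. -/
theorem semitrace_eq_of_adjoin {T : A →ₗ[F] F} (hT : IsReducedTrace F A T) {σ : A →ₗ[F] A}
    (hσ : IsInvolution F σ) {a : F} (ha : 1 + 4 * a ≠ 0) {κ : A}
    (hκ : κ * κ = κ + algebraMap F A a) (hκσ : σ κ = 1 - κ) {ℓK : A}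
    (hmem : ℓK ∈ Algebra.adjoin F {κ}) (hℓ : ℓK ∉ Set.range (algebraMap F A))
    (hℓ2 : ℓK * ℓK - ℓK ∈ Set.range (algebraMap F A)) (s : A) (hs : σ s = s) :
    T (ℓK * s) = T (κ * s) := by
  have hform : ∀ z ∈ Algebra.adjoin F {κ}, ∃ x y : F, z = algebraMap F A x + y • κ := by
    intro z hz
    induction hz using Algebra.adjoin_induction with
    | mem z hz => exact ⟨0, 1, by simp [Set.mem_singleton_iff.1 hz]⟩
    | algebraMap r => exact ⟨r, 0, by simp⟩
    | add _ _ _ _ h1 h2 =>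
      obtain ⟨x, y, rfl⟩ := h1
      obtain ⟨x', y', rfl⟩ := h2
      exact ⟨x + x', y + y', by rw [map_add, add_smul]; abel⟩
    | mul _ _ _ _ h1 h2 =>
      obtain ⟨x, y, rfl⟩ := h1
      obtain ⟨x', y', rfl⟩ := h2
      refine ⟨x * x' + y * y' * a, x * y' + y * x' + y * y', ?_⟩
      simp only [Algebra.algebraMap_eq_smul_one] at hκ ⊢
      simp only [add_mul, mul_add, smul_mul_smul_comm, one_mul, mul_one, hκ]
      module
  obtain ⟨x, y, rfl⟩ := hform _ hmem
  have hy : y ≠ 0 := by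
    rintro rfl
    exact hℓ ⟨x, by simp⟩
  have hκF : ∀ c, κ ≠ algebraMap F A c := by
    rintro c rfl
    have h1 : σ (algebraMap F A c) = algebraMap F A c := by
      rw [Algebra.algebraMap_eq_smul_one, map_smul, hσ.map_one]
    rw [h1, ← map_one (algebraMap F A), ← map_sub] at hκσ
    rw [← map_mul, ← map_add] at hκ
    have h2 := (algebraMap F A).injective hκσ
    have h3 := (algebraMap F A).injective hκ
    exact ha (by linear_combination (2 * c - 1) * h2 - 4 * h3)
  obtain ⟨c, hc⟩ := hℓ2
  have hxy : 2 * x + y = 1 := by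
    by_contra hne
    have h0 : y * (2 * x + y - 1) ≠ 0 := mul_ne_zero hy (sub_ne_zero.2 hne)
    have h1 : (y * (2 * x + y - 1)) • κ = (c - x * x + x - y * y * a) • (1 : A) := by
      simp only [Algebra.algebraMap_eq_smul_one] at hκ hc
      simp only [add_mul, mul_add, smul_mul_smul_comm, one_mul, mul_one, hκ] at hc
      rw [sub_smul, add_smul, sub_smul, hc]
      module
    apply hκF ((y * (2 * x + y - 1))⁻¹ * (c - x * x + x - y * y * a))
    rw [Algebra.algebraMap_eq_smul_one, mul_smul, ← h1, inv_smul_smul₀ h0]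
  have h2 : T s = 2 * T (κ * s) := by
    have h1 : T (κ * s) = T s - T (κ * s) := by
      conv_lhs => rw [← hT.map_involution hσ, hσ.1, hs, hκσ, mul_sub, mul_one, map_sub,
        hT.mul_comm s]
    linear_combination -h1
  rw [add_mul, map_add, Algebra.algebraMap_eq_smul_one, smul_mul_assoc, smul_mul_assoc, one_mul,
    map_smul, map_smul, h2, smul_eq_mul, smul_eq_mul]
  linear_combination T (κ * s) * hxy

end QuadraticGenerator

section HermitianDiagonal

variable {E : Type} [Field E] {a : E}

/-- The trace of the diagonal hermitian form `⟨α₁, …, αₘ⟩`. -/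
def hermTrace {m : ℕ} (α : Fin m → E) (f g : Fin m → QuadraticAlgebra E a 1) : E :=
  ∑ i, α i * QuadraticAlgebra.trace (star (f i) * g i)

theorem hermTrace_nondegenerate (ha : 1 + 4 * a ≠ 0) {m : ℕ} {α : Fin m → E} (hα : ∀ i, α i ≠ 0)
    (f : Fin m → QuadraticAlgebra E a 1) (hf : ∀ g, hermTrace α f g = 0) : f = 0 := by
  classical
  ext i : 1
  have key : ∀ z : QuadraticAlgebra E a 1, QuadraticAlgebra.trace (star (f i) * z) = 0 := by
    intro z
    have h := hf (Pi.single i z)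
    rw [hermTrace, Finset.sum_eq_single i] at h
    · simpa [hα i] using h
    · intro j _ hj; simp [Pi.single_eq_of_ne hj]
    · simp
  have h1 := key 1
  have h2 := key QuadraticAlgebra.omega
  simp [QuadraticAlgebra.trace_def] at h1 h2
  have h3 : (1 + 4 * a) * (f i).im = 0 := by linear_combination h1 - 2 * h2
  have h4 : (f i).im = 0 := by simpa [ha] using h3
  rw [h4] at h1 h2
  ext
  · simp; linear_combination h2
  · simpa using h4

variable {V : Type} [AddCommGroup V] [Module E V]

theorem exists_longer_diagonal (ha : 1 + 4 * a ≠ 0) (b : LinearMap.BilinForm E V)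
    (hsymm : ∀ v w, b v w = b w v) (hnd : ∀ v, (∀ w, b v w = 0) → v = 0) (κ : V →ₗ[E] V)
    (hκ : ∀ v, κ (κ v) = κ v + a • v) (hbκ : ∀ v w, b (κ v) w = b v w - b v (κ w))
    {k : ℕ} {α : Fin k → E} (hα : ∀ i, α i ≠ 0)
    (Θ : (Fin k → QuadraticAlgebra E a 1) →ₗ[E] V)
    (hΘκ : ∀ f, Θ (fun i => QuadraticAlgebra.omega * f i) = κ (Θ f))
    (hΘb : ∀ f g, b (Θ f) (Θ g) = hermTrace α f g) (hns : ¬ Function.Surjective Θ) :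
    ∃ α' : Fin (k + 1) → E, (∀ i, α' i ≠ 0) ∧
      ∃ Θ' : (Fin (k + 1) → QuadraticAlgebra E a 1) →ₗ[E] V,
        (∀ f, Θ' (fun i => QuadraticAlgebra.omega * f i) = κ (Θ' f)) ∧
        ∀ f g, b (Θ' f) (Θ' g) = hermTrace α' f g := by
  have hproj : ∀ v, ∃ f, ∀ g, b (v - Θ f) (Θ g) = 0 := by
    intro v
    let Bf : (Fin k → QuadraticAlgebra E a 1) →ₗ[E] Dual E (Fin k → QuadraticAlgebra E a 1) :=
      LinearMap.compl₁₂ b Θ Θ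
    have hinj : Function.Injective Bf := by
      rw [← LinearMap.ker_eq_bot, LinearMap.ker_eq_bot']
      intro f hf
      apply hermTrace_nondegenerate ha hα
      intro g
      rw [← hΘb]
      exact LinearMap.congr_fun hf g
    obtain ⟨f, hf⟩ := (LinearMap.injective_iff_surjective_of_finrank_eq_finrank
      (Subspace.dual_finrank_eq).symm).1 hinj ((b v).comp Θ)
    refine ⟨f, fun g => ?_⟩
    have h1 : b (Θ f) (Θ g) = b v (Θ g) := LinearMap.congr_fun hf g
    rw [map_sub, LinearMap.sub_apply, h1, sub_self]
  have hw : ∃ w, (∀ g, b w (Θ g) = 0) ∧ b w (κ w) ≠ 0 := by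
    by_contra hcon
    push Not at hcon
    apply hns
    intro v
    obtain ⟨f, hf⟩ := hproj v
    refine ⟨f, (sub_eq_zero.1 (hnd _ fun y => ?_)).symm⟩
    obtain ⟨f', hf'⟩ := hproj y
    have h1 := hcon _ hf
    have h2 := hcon _ hf'
    have h3 := hcon (v - Θ f + (y - Θ f')) (fun g => by
      rw [map_add, LinearMap.add_apply, hf, hf', add_zero])
    have h4 : b (v - Θ f) (y - Θ f') = 0 := by
      rw [map_add κ, map_add b, LinearMap.add_apply, map_add, map_add, h1, h2,
        hsymm (y - Θ f') (κ _), hbκ] at h3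
      linear_combination h3
    rw [map_sub, hf, sub_zero] at h4
    exact h4
  obtain ⟨w, hw, hwq⟩ := hw
  have hκw : ∀ g, b (κ w) (Θ g) = 0 := fun g => by rw [hbκ, hw, ← hΘκ, hw, sub_self]
  have hww : b w w = 2 * b w (κ w) := by
    have h1 := hbκ w w
    rw [hsymm (κ w) w] at h1
    linear_combination -h1
  have hκκ : b (κ w) (κ w) = -2 * a * b w (κ w) := by
    rw [hbκ, hκ, map_add, map_smul, hww, smul_eq_mul]; ring
  have hκw1 : b (κ w) w = b w (κ w) := hsymm _ _
  let Θ' : (Fin (k + 1) → QuadraticAlgebra E a 1) →ₗ[E] V :=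
    { toFun := fun f => (f 0).re • w + (f 0).im • κ w + Θ (fun i => f i.succ)
      map_add' := fun f g => by
        have : (fun i : Fin k => (f + g) i.succ) = (fun i => f i.succ) + fun i => g i.succ := rfl
        rw [this, map_add]
        simp only [Pi.add_apply, QuadraticAlgebra.re_add, QuadraticAlgebra.im_add]
        module
      map_smul' := fun c f => by
        have : (fun i : Fin k => (c • f) i.succ) = c • (fun i => f i.succ) := rfl
        rw [this, map_smul]
        simp only [Pi.smul_apply, QuadraticAlgebra.re_smul, QuadraticAlgebra.im_smul,
          RingHom.id_apply, smul_eq_mul]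
        module }
  have hΘ' : ∀ f, Θ' f = (f 0).re • w + (f 0).im • κ w + Θ (fun i => f i.succ) := fun _ => rfl
  refine ⟨Fin.cons (b w (κ w)) α, ?_, Θ', ?_, ?_⟩
  · intro i
    induction i using Fin.cases with
    | zero => simpa using hwq
    | succ i => simpa using hα i
  · intro f
    rw [hΘ', hΘ', hΘκ fun i => f i.succ]
    simp only [map_add, map_smul, hκ]
    simp only [QuadraticAlgebra.re_mul, QuadraticAlgebra.im_mul, QuadraticAlgebra.omega_re,
      QuadraticAlgebra.omega_im]
    module
  · intro f g
    rw [hΘ', hΘ', hermTrace, Fin.sum_univ_succ]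
    simp only [Fin.cons_zero, Fin.cons_succ]
    rw [← hermTrace, ← hΘb]
    simp only [map_add, map_smul, LinearMap.add_apply, LinearMap.smul_apply, hw, hκw,
      hsymm (Θ _) w, hsymm (Θ _) (κ w), hww, hκκ, hκw1, smul_eq_mul,
      QuadraticAlgebra.trace_def, QuadraticAlgebra.re_mul, QuadraticAlgebra.im_mul,
      QuadraticAlgebra.re_star, QuadraticAlgebra.im_star]
    ring

theorem exists_hermitian_diagonalisation [FiniteDimensional E V] (ha : 1 + 4 * a ≠ 0)
    (b : LinearMap.BilinForm E V) (hsymm : ∀ v w, b v w = b w v)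
    (hnd : ∀ v, (∀ w, b v w = 0) → v = 0) (κ : V →ₗ[E] V)
    (hκ : ∀ v, κ (κ v) = κ v + a • v) (hbκ : ∀ v w, b (κ v) w = b v w - b v (κ w)) :
    ∃ (m : ℕ) (α : Fin m → E), (∀ i, α i ≠ 0) ∧
      ∃ Θ : (Fin m → QuadraticAlgebra E a 1) ≃ₗ[E] V,
        (∀ f, Θ (fun i => QuadraticAlgebra.omega * f i) = κ (Θ f)) ∧
        ∀ f g, b (Θ f) (Θ g) = hermTrace α f g := by
  have hinj : ∀ {k : ℕ} {α : Fin k → E} (_ : ∀ i, α i ≠ 0)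
      (Θ : (Fin k → QuadraticAlgebra E a 1) →ₗ[E] V)
      (_ : ∀ f g, b (Θ f) (Θ g) = hermTrace α f g), Function.Injective Θ := by
    intro k α hα Θ hΘ
    rw [← LinearMap.ker_eq_bot, LinearMap.ker_eq_bot']
    intro f hf
    exact hermTrace_nondegenerate ha hα f fun g => by rw [← hΘ, hf]; simp
  by_contra hcon
  have hall : ∀ k : ℕ, ∃ α : Fin k → E, (∀ i, α i ≠ 0) ∧
      ∃ Θ : (Fin k → QuadraticAlgebra E a 1) →ₗ[E] V,
        (∀ f, Θ (fun i => QuadraticAlgebra.omega * f i) = κ (Θ f)) ∧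
        ∀ f g, b (Θ f) (Θ g) = hermTrace α f g := by
    intro k
    induction k with
    | zero => exact ⟨0, fun i => i.elim0, 0, by simp, by simp [hermTrace]⟩
    | succ k ih =>
      obtain ⟨α, hα, Θ, h1, h2⟩ := ih
      refine exists_longer_diagonal ha b hsymm hnd κ hκ hbκ hα Θ h1 h2 fun hs => hcon ?_
      exact ⟨k, α, hα, LinearEquiv.ofBijective Θ ⟨hinj hα Θ h2, hs⟩, h1, h2⟩
  obtain ⟨α, hα, Θ, -, h2⟩ := hall (finrank E V + 1)
  have h3 := LinearMap.finrank_le_finrank_of_injective (hinj hα Θ h2)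
  rw [finrank_pi_fintype] at h3
  simp [QuadraticAlgebra.finrank_eq_two] at h3
  omega

end HermitianDiagonal

section SymmetricModel

variable {F : Type} [Field F] {A : Type} [Ring A] [Algebra F A] [Algebra.IsCentral F A]
  [IsSimpleRing A] [Module.Finite F A] {E : Type} [Field E] [Algebra F E]

theorem mem_symSet {A : Type} [Ring A] [Algebra F A] {σ : A →ₗ[F] A} {s : A} :
    s ∈ symSet F σ ↔ σ s = s := by
  simp [symSet, sub_eq_zero]

/-- An involution with enough symmetric elements is adjoint, over a splitting field, to a
symmetric bilinear form. -/
theorem exists_symmetric_gram {σ : A →ₗ[F] A} (hσ : IsInvolution F σ)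
    (hdim : 2 * finrank F (symSet F σ) = deg F A * (deg F A + 1)) {n : ℕ}
    (ρ : A →ₐ[F] Matrix (Fin n) (Fin n) E) (hn : n * n = finrank F A) :
    ∃ H H' : Matrix (Fin n) (Fin n) E, H * H' = 1 ∧ H' * H = 1 ∧ H.transpose = H ∧
      ∀ x, (ρ x).transpose * H = H * ρ (σ x) := by
  have hn' : Fintype.card (Fin n) * Fintype.card (Fin n) = finrank F A := by simpa using hn
  have hne : Nonempty (Fin n) := finrank_isSquare_index hn'
  have hdeg : deg F A = n := by rw [deg, ← hn, Nat.sqrt_eq]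
  obtain ⟨H, H', h1, h2, h3⟩ := rep_conj ρ (transposeRep hσ ρ) hn'
  have h4 : ∀ x, (ρ (σ x)).transpose * H = H * ρ x := by
    intro x
    have : (ρ (σ x)).transpose = H * ρ x * H' := h3 x
    rw [this, mul_assoc, h2, mul_one]
  have h5 : ∀ x, (ρ x).transpose * H = H * ρ (σ x) := fun x => by
    have := h4 (σ x); rwa [hσ.2] at this
  have h6 : ∀ x, H.transpose * ρ x = (ρ (σ x)).transpose * H.transpose := fun x => by
    have := congrArg Matrix.transpose (h5 x)
    simpa [Matrix.transpose_mul] using this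
  obtain ⟨ε, hε⟩ := rep_commutant (M' := E) ρ hn' (H' * H.transpose) (by
    intro x
    have e : (ρ x).map (algebraMap E E) = ρ x := by ext; simp
    rw [e, mul_assoc, h6, ← mul_assoc, ← mul_assoc]
    congr 1
    calc ρ x * H' = H' * (H * ρ x) * H' := by rw [← mul_assoc, h2, one_mul]
      _ = H' * ((ρ (σ x)).transpose * (H * H')) := by rw [← h4]; simp only [mul_assoc]
      _ = _ := by rw [h1, mul_one])
  have hHt : H.transpose = ε • H := by
    have : H * (H' * H.transpose) = H * Matrix.scalar (Fin n) ε := by rw [hε]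
    rw [← mul_assoc, h1, one_mul] at this
    rw [this, Matrix.scalar_apply, ← Matrix.smul_eq_mul_diagonal]
  have hε2 : ε * ε = 1 := by
    have e1 : H = (ε * ε) • H := by
      have := congrArg Matrix.transpose hHt
      rw [Matrix.transpose_transpose, Matrix.transpose_smul, hHt, smul_smul] at this
      exact this
    have e2 : (1 : Matrix (Fin n) (Fin n) E) = (ε * ε) • 1 := by
      conv_lhs => rw [← h1, e1]
      rw [smul_mul_assoc, h1]
    have := congrFun (congrFun e2 hne.some) hne.some
    simpa using this.symm
  refine ⟨H, H', h1, h2, ?_, h5⟩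
  rcases mul_self_eq_one_iff.1 hε2 with rfl | rfl
  · simpa using hHt
  by_cases h20 : (2 : E) = 0
  · have : (-1 : E) = 1 := by linear_combination -h20
    rw [hHt, this, one_smul]
  exfalso
  have hskew : ∀ t : E ⊗[F] symSet F σ,
      (H * repHom ρ ((symSet F σ).subtype.baseChange E t)).transpose =
        - (H * repHom ρ ((symSet F σ).subtype.baseChange E t)) := by
    intro t
    induction t using TensorProduct.induction_on with
    | zero => simp
    | add t t' ht ht' => rw [map_add, map_add, mul_add, Matrix.transpose_add, ht, ht', neg_add]
    | tmul x s =>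
      have hs := mem_symSet.1 s.2
      simp only [LinearMap.baseChange_tmul, Submodule.subtype_apply, repHom_tmul, mul_smul_comm,
        Matrix.transpose_smul, Matrix.transpose_mul, hHt]
      simp only [neg_smul, one_smul, smul_neg, h5, hs]
  let up : E ⊗[F] symSet F σ →ₗ[E] ((Σ i : Fin n, Fin i) → E) :=
    { toFun := fun t p =>
        (H * repHom ρ ((symSet F σ).subtype.baseChange E t)) p.1 ⟨p.2, p.2.2.trans p.1.2⟩
      map_add' := fun t t' => by ext p; simp [mul_add]
      map_smul' := fun c t => by ext p; simp }
  have hinj : Function.Injective up := by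
    rw [← LinearMap.ker_eq_bot, LinearMap.ker_eq_bot']
    intro t ht
    have hX : H * repHom ρ ((symSet F σ).subtype.baseChange E t) = 0 := by
      have hlt : ∀ i j : Fin n, j < i →
          (H * repHom ρ ((symSet F σ).subtype.baseChange E t)) i j = 0 := fun i j hij =>
        congrFun ht ⟨i, ⟨j, hij⟩⟩
      have hsk : ∀ i j, (H * repHom ρ ((symSet F σ).subtype.baseChange E t)) j i =
          - (H * repHom ρ ((symSet F σ).subtype.baseChange E t)) i j := fun i j =>
        congrFun (congrFun (hskew t) i) j
      ext i j
      rcases lt_trichotomy j i with h | rfl | h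
      · exact hlt i j h
      · have := hsk j j
        have : 2 * (H * repHom ρ ((symSet F σ).subtype.baseChange E t)) j j = 0 := by
          linear_combination this
        simpa [h20] using this
      · rw [hsk, hlt j i h, neg_zero]; rfl
    have h7 : repHom ρ ((symSet F σ).subtype.baseChange E t) = 0 := by
      rw [← one_mul (repHom ρ _), ← h2, mul_assoc, hX, mul_zero]
    have h8 : (symSet F σ).subtype.baseChange E t = 0 :=
      (repHom_bijective ρ hn').1 (by rw [h7, map_zero])
    exact (Module.Flat.lTensor_preserves_injective_linearMap (M := E) (symSet F σ).subtype
      (symSet F σ).subtype_injective) (by rw [map_zero]; exact h8)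
  have h9 := LinearMap.finrank_le_finrank_of_injective hinj
  rw [Module.finrank_baseChange, finrank_pi, Fintype.card_sigma] at h9
  have h10 : ∑ i : Fin n, Fintype.card (Fin i) = ∑ i ∈ Finset.range n, i := by
    simp [Finset.sum_range]
  have h11 := Finset.sum_range_id_mul_two n
  rw [h10] at h9
  rw [hdeg] at hdim
  have hn0 : 0 < n := Fin.pos hne.some
  obtain ⟨k, rfl⟩ : ∃ k, n = k + 1 := ⟨n - 1, by omega⟩
  rw [Nat.add_sub_cancel] at h11
  nlinarith

/-- A quadratic extension of a unitary involution becomes, over a splitting field, adjoint to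
the trace form of a diagonal hermitian form. -/
theorem exists_hermitian_model {T : A →ₗ[F] F} (hT : IsReducedTrace F A T) {σ : A →ₗ[F] A}
    (hσ : IsInvolution F σ) (hdim : 2 * finrank F (symSet F σ) = deg F A * (deg F A + 1))
    (hE : SplitBy F A E) {a : F} (ha : 1 + 4 * a ≠ 0) {κ : A}
    (hκ : κ * κ = κ + algebraMap F A a) (hκσ : σ κ = 1 - κ) :
    ∃ (m : ℕ) (α : Fin m → E), (∀ i, α i ≠ 0) ∧ 4 * (m * m) = finrank F A ∧
      ∃ ρ : A →ₐ[F] Module.End E (Fin m → QuadraticAlgebra E (algebraMap F E a) 1),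
        (∀ f, ρ κ f = fun i => QuadraticAlgebra.omega * f i) ∧
        (∀ x f g, hermTrace α (ρ x f) g = hermTrace α f (ρ (σ x) g)) ∧
        ∀ x, algebraMap F E (T x) = LinearMap.trace E _ (ρ x) := by
  obtain ⟨n, hn, ⟨ρ⟩⟩ := hE
  obtain ⟨H, H', h1, h2, h3, h4⟩ := exists_symmetric_gram hσ hdim ρ hn
  have hb : ∀ v w, Matrix.toBilin' H v w = v ⬝ᵥ H.mulVec w := Matrix.toBilin'_apply' H
  have hadj : ∀ x v w, Matrix.toBilin' H ((ρ x).mulVec v) w =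
      Matrix.toBilin' H v ((ρ (σ x)).mulVec w) := by
    intro x v w
    rw [hb, hb, Matrix.mulVec_mulVec, ← h4, ← Matrix.mulVec_mulVec, Matrix.dotProduct_mulVec v,
      Matrix.vecMul_transpose]
  obtain ⟨m, α, hα, Θ, hΘκ, hΘb⟩ := exists_hermitian_diagonalisation
    (a := algebraMap F E a) (E := E) (V := Fin n → E)
    (by have := (map_ne_zero (algebraMap F E)).2 ha
        rwa [map_add, map_mul, map_one, map_ofNat] at this) (Matrix.toBilin' H)
    (by intro v w
        rw [hb, hb, Matrix.dotProduct_mulVec, ← Matrix.mulVec_transpose, h3, dotProduct_comm])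
    (by intro v hv
        have h5 : H.mulVec v = 0 := by
          apply dotProduct_eq_zero_iff.1
          intro w
          have := hv w
          rw [hb, Matrix.dotProduct_mulVec, ← Matrix.mulVec_transpose, h3] at this
          exact this
        rw [← Matrix.one_mulVec v, ← h2, ← Matrix.mulVec_mulVec, h5, Matrix.mulVec_zero])
    (Matrix.toLin' (ρ κ))
    (by intro v
        simp only [Matrix.toLin'_apply, Matrix.mulVec_mulVec]
        rw [← map_mul, hκ, map_add, Matrix.add_mulVec, AlgHom.commutes, Matrix.algebraMap_eq_diagonal]
        congr 1
        ext i
        simp [Matrix.mulVec_diagonal])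
    (by intro v w
        simp only [Matrix.toLin'_apply]
        rw [hadj, hκσ, map_sub, map_one, Matrix.sub_mulVec, Matrix.one_mulVec, map_sub])
  let c := (Θ.symm.conjAlgEquiv E : Module.End E (Fin n → E) ≃ₐ[E] _)
  let ρ' : A →ₐ[F] Module.End E (Fin m → QuadraticAlgebra E (algebraMap F E a) 1) :=
    ((c.toAlgHom.comp (Matrix.toLinAlgEquiv' (R := E) (n := Fin n)).toAlgHom).restrictScalars
      F).comp ρ
  have hρ' : ∀ x f, Θ (ρ' x f) = (ρ x).mulVec (Θ f) := by
    intro x f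
    change Θ (Θ.symm _) = _
    rw [LinearEquiv.apply_symm_apply]
    rfl
  refine ⟨m, α, hα, ?_, ρ', ?_, ?_, ?_⟩
  · have := Θ.finrank_eq
    rw [finrank_pi_fintype] at this
    simp [QuadraticAlgebra.finrank_eq_two] at this
    rw [← hn, ← this]; ring
  · intro f
    apply Θ.injective
    rw [hρ', hΘκ]; rfl
  · intro x f g
    rw [← hΘb, ← hΘb, hρ', hρ', hadj]
  · intro x
    rw [hT.eq_trace_rep ρ hn, ← Matrix.trace_toLin'_eq]
    exact (LinearMap.trace_conj' _ Θ.symm).symm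

end SymmetricModel

section Brauer

variable {F : Type} [Field F] {X Y Z : Type} [Ring X] [Algebra F X] [Ring Y] [Algebra F Y]
  [Ring Z] [Algebra F Z]

theorem BrauerEquiv.of_algEquiv (e : X ≃ₐ[F] Y) : BrauerEquiv F X Y :=
  ⟨1, 1, one_pos, one_pos, ⟨e.mapMatrix⟩⟩

theorem BrauerEquiv.symm (h : BrauerEquiv F X Y) : BrauerEquiv F Y X := by
  obtain ⟨n, m, hn, hm, ⟨e⟩⟩ := h
  exact ⟨m, n, hm, hn, ⟨e.symm⟩⟩

/-- Matrices over matrices are matrices. -/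
def matrixMatrix (F : Type) [Field F] (X : Type) [Ring X] [Algebra F X] (m n : ℕ) :
    Matrix (Fin m) (Fin m) (Matrix (Fin n) (Fin n) X) ≃ₐ[F]
      Matrix (Fin (m * n)) (Fin (m * n)) X :=
  (Matrix.compAlgEquiv (Fin m) (Fin n) X F).trans (Matrix.reindexAlgEquiv F X finProdFinEquiv)

theorem BrauerEquiv.trans (h : BrauerEquiv F X Y) (h' : BrauerEquiv F Y Z) :
    BrauerEquiv F X Z := by
  obtain ⟨n, m, hn, hm, ⟨e⟩⟩ := h
  obtain ⟨n', m', hn', hm', ⟨e'⟩⟩ := h'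
  refine ⟨n' * n, m * m', Nat.mul_pos hn' hn, Nat.mul_pos hm hm', ⟨?_⟩⟩
  exact (matrixMatrix F X n' n).symm.trans <| e.mapMatrix.trans <| (matrixMatrix F Y n' m).trans <|
    (Matrix.reindexAlgEquiv F Y (finCongr (Nat.mul_comm n' m))).trans <|
    (matrixMatrix F Y m n').symm.trans <| e'.mapMatrix.trans <| matrixMatrix F Z m m'

theorem BrauerEquiv.matrix {n : ℕ} (hn : 0 < n) : BrauerEquiv F (Matrix (Fin n) (Fin n) X) X :=
  ⟨1, 1 * n, one_pos, by omega, ⟨matrixMatrix F X 1 n⟩⟩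

/-- Matrix algebras commute with tensor products. -/
def tensorMatrix (F : Type) [Field F] (X Y : Type) [Ring X] [Algebra F X] [Ring Y] [Algebra F Y]
    (n : ℕ) : X ⊗[F] Matrix (Fin n) (Fin n) Y ≃ₐ[F] Matrix (Fin n) (Fin n) (X ⊗[F] Y) :=
  (Algebra.TensorProduct.congr AlgEquiv.refl (matrixEquivTensor (Fin n) F Y)).trans <|
    (Algebra.TensorProduct.assoc F F F X Y (Matrix (Fin n) (Fin n) F)).symm.trans
      (matrixEquivTensor (Fin n) F (X ⊗[F] Y)).symm

theorem BrauerEquiv.tensor_left (h : BrauerEquiv F Y Z) :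
    BrauerEquiv F (X ⊗[F] Y) (X ⊗[F] Z) := by
  obtain ⟨n, m, hn, hm, ⟨e⟩⟩ := h
  exact ⟨n, m, hn, hm, ⟨(tensorMatrix F X Y n).symm.trans <|
    (Algebra.TensorProduct.congr AlgEquiv.refl e).trans (tensorMatrix F X Z m)⟩⟩

theorem IsCSA.of_algEquiv (e : X ≃ₐ[F] Y) (h : IsCSA F X) : IsCSA F Y := by
  obtain ⟨_, _, _⟩ := h
  exact ⟨Algebra.IsCentral.of_algEquiv F X Y e, IsSimpleRing.of_ringEquiv e.toRingEquiv inferInstance,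
    Module.Finite.equiv e.toLinearEquiv⟩

theorem IsCSA.tensor (h : IsCSA F X) (h' : IsCSA F Y) : IsCSA F (X ⊗[F] Y) := by
  obtain ⟨_, _, _⟩ := h
  obtain ⟨_, _, _⟩ := h'
  exact ⟨isCentral_tensor, isSimpleRing_tensor_left, inferInstance⟩

theorem IsCSA.matrix (h : IsCSA F X) {n : ℕ} (hn : 0 < n) :
    IsCSA F (Matrix (Fin n) (Fin n) X) := by
  obtain ⟨_, _, _⟩ := h
  have : Nonempty (Fin n) := ⟨⟨0, hn⟩⟩
  exact ⟨inferInstance, inferInstance, inferInstance⟩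

theorem algHom_bijective_of_finrank_eq [IsSimpleRing X] [Nontrivial Y] [Module.Finite F X]
    [Module.Finite F Y] (f : X →ₐ[F] Y) (h : finrank F X = finrank F Y) :
    Function.Bijective f :=
  have hinj : Function.Injective f := f.toRingHom.injective
  ⟨hinj, (LinearMap.injective_iff_surjective_of_finrank_eq_finrank
    (f := f.toLinearMap) h).1 hinj⟩

end Brauer

section Quaternion

variable {E : Type} [Field E] {a b c : E}

theorem quaternion_trace_identity (x : QuaternionAlgebra E a 1 b) :
    let i : QuaternionAlgebra E a 1 b := ⟨0, 1, 0, 0⟩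
    let j : QuaternionAlgebra E a 1 b := ⟨0, 0, 1, 0⟩
    let y := (2 * i - 1) * (i * x - x * (1 - i))
    (algebraMap E _ b) * y + j * y * j =
      algebraMap E _ ((1 + 4 * a) * b * (2 * x.re + x.imI)) := by
  intro i j y
  have h2 : (2 * i - 1 : QuaternionAlgebra E a 1 b) = ⟨-1, 2, 0, 0⟩ := by
    rw [two_mul]; ext <;> simp [i]; norm_num
  have h3 : (1 - i : QuaternionAlgebra E a 1 b) = ⟨1, -1, 0, 0⟩ := by ext <;> simp [i]
  simp only [y, h2, h3]
  ext <;> simp [i, j, QuaternionAlgebra.algebraMap_eq] <;> ring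

theorem quaternion_isCSA (ha : 1 + 4 * a ≠ 0) (hb : b ≠ 0) :
    IsCSA E (QuaternionAlgebra E a 1 b) := by
  refine ⟨⟨fun x hx => ?_⟩, ?_, inferInstance⟩
  · rw [Subalgebra.mem_center_iff] at hx
    have h1 := hx ⟨0, 1, 0, 0⟩
    have h2 := hx ⟨0, 0, 1, 0⟩
    simp [QuaternionAlgebra.ext_iff, hb] at h1 h2
    obtain ⟨h3, -, h4, -⟩ := h2
    have h5 : x.imJ = 0 := by linear_combination -h1.1 + 2 * a * h3
    refine ⟨x.re, ?_⟩
    ext <;> simp [QuaternionAlgebra.algebraMap_eq, h3, h4, h5]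
  · refine IsSimpleRing.of_eq_bot_or_eq_top fun I => or_iff_not_imp_left.2 fun hI => ?_
    obtain ⟨x, hxI, hx0⟩ : ∃ x ∈ I, x ≠ 0 := by
      by_contra! h
      refine hI (le_antisymm (fun x hx => ?_) bot_le)
      rw [h x hx]; exact zero_mem _
    have key : ∀ x ∈ I, (2 * x.re + x.imI) ≠ 0 → I = ⊤ := by
      intro x hx hne
      have h1 := quaternion_trace_identity (b := b) x
      have h3 : algebraMap E _ ((1 + 4 * a) * b * (2 * x.re + x.imI)) ∈ I := by
        rw [← h1]
        have h4 := I.mul_mem_left (2 * ⟨0, 1, 0, 0⟩ - 1) _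
          (I.sub_mem (I.mul_mem_left ⟨0, 1, 0, 0⟩ _ hx) (I.mul_mem_right _ (1 - ⟨0, 1, 0, 0⟩) hx))
        exact I.add_mem (I.mul_mem_left _ _ h4) (I.mul_mem_right _ _ (I.mul_mem_left _ _ h4))
      have h5 := I.mul_mem_left (algebraMap E _ ((1 + 4 * a) * b * (2 * x.re + x.imI))⁻¹) _ h3
      rw [← map_mul, inv_mul_cancel₀ (mul_ne_zero (mul_ne_zero ha hb) hne), map_one] at h5
      exact (TwoSidedIdeal.one_mem_iff I).1 h5
    by_contra hne
    have h0 : ∀ y : QuaternionAlgebra E a 1 b, 2 * (x * y).re + (x * y).imI = 0 := fun y =>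
      by_contra fun h => hne (key _ (I.mul_mem_right x y hxI) h)
    have h1 := h0 1
    have h2 := h0 ⟨0, 1, 0, 0⟩
    have h3 := h0 ⟨0, 0, 1, 0⟩
    have h4 := h0 ⟨0, 0, 0, 1⟩
    simp at h1 h2 h3 h4
    have h5 : (1 + 4 * a) * x.imI = 0 := by linear_combination 2 * h2 - h1
    have h6 : (1 + 4 * a) * (b * x.imK) = 0 := by linear_combination h3 - 2 * h4
    have h7 : x.imI = 0 := by simpa [ha] using h5
    have h8 : x.imK = 0 := by simpa [ha, hb] using h6
    have h9 : b * x.imJ = 0 := by linear_combination h4 + 2 * a * b * h8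
    have h10 : x.imJ = 0 := by simpa [hb] using h9
    have h11 : x.re = 0 := by linear_combination h2 - (2 * a + 1) * h7
    apply hx0
    ext <;> simp [h7, h8, h10, h11]

theorem quaternion_commute {Y : Type} [Ring Y] [Algebra E Y] (B : QuaternionAlgebra.Basis Y a 1 b)
    {z : Y} (hi : Commute B.i z) (hj : Commute B.j z) (x : QuaternionAlgebra E a 1 b) :
    Commute (B.liftHom x) z := by
  change Commute (algebraMap E Y x.re + x.imI • B.i + x.imJ • B.j + x.imK • B.k) z
  rw [← B.i_mul_j]
  exact (((Algebra.commute_algebraMap_left _ _).add_left (hi.smul_left _)).add_left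
    (hj.smul_left _)).add_left ((hi.mul_left hj).smul_left _)

/-- A quaternion basis from the two defining elements. -/
@[reducible] def quaternionBasis {Y : Type} [Ring Y] [Algebra E Y] (i j : Y)
    (hi : i * i = i + algebraMap E Y a) (hj : j * j = algebraMap E Y b)
    (hji : j * i = (1 - i) * j) : QuaternionAlgebra.Basis Y a 1 b where
  i := i
  j := j
  k := i * j
  i_mul_i := by rw [hi, Algebra.algebraMap_eq_smul_one, one_smul, add_comm]
  j_mul_j := by rw [hj, Algebra.algebraMap_eq_smul_one]
  i_mul_j := rfl
  j_mul_i := by rw [hji, one_smul, sub_mul, one_mul]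

theorem quaternion_relations {Y : Type} [Ring Y] [Algebra E Y]
    (B : QuaternionAlgebra.Basis Y a 1 b) :
    B.i * B.i = B.i + algebraMap E Y a ∧ B.j * B.j = algebraMap E Y b ∧
      B.j * B.i = (1 - B.i) * B.j := by
  refine ⟨?_, ?_, ?_⟩
  · rw [B.i_mul_i, one_smul, Algebra.algebraMap_eq_smul_one, add_comm]
  · rw [B.j_mul_j, Algebra.algebraMap_eq_smul_one]
  · rw [B.j_mul_i, one_smul, sub_mul, one_mul, B.i_mul_j]

/-- The homomorphism realising the product of two quaternion algebras with a common
quadratic subalgebra. -/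
theorem exists_quaternion_tensor_hom {Y : Type} [Ring Y] [Algebra E Y] (hc : c ≠ 0)
    (B : QuaternionAlgebra.Basis Y a 1 (b * c)) :
    Nonempty (QuaternionAlgebra E a 1 b ⊗[E] QuaternionAlgebra E a 1 c →ₐ[E]
      Matrix (Fin 2) (Fin 2) Y) := by
  obtain ⟨hii, hjj, hji⟩ := quaternion_relations B
  generalize B.i = κ at hii hji
  generalize B.j = z at hjj hji
  have hji' : κ * z = z * (1 - κ) := by rw [mul_sub, hji]; noncomm_ring
  rw [Algebra.algebraMap_eq_smul_one] at hii hjj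
  have hm : ∀ r : E, algebraMap E (Matrix (Fin 2) (Fin 2) Y) r = !![r • 1, 0; 0, r • 1] := by
    intro r
    rw [Algebra.algebraMap_eq_smul_one, Matrix.one_fin_two]
    simp
  let B₁ : QuaternionAlgebra.Basis (Matrix (Fin 2) (Fin 2) Y) a 1 b :=
    quaternionBasis !![κ, 0; 0, κ] !![0, z; c⁻¹ • z, 0]
      (by rw [hm]; simp [hii])
      (by rw [hm]; simp [hjj, smul_smul, hc, mul_comm])
      (by rw [Matrix.one_fin_two]; simp [hji])
  let B₂ : QuaternionAlgebra.Basis (Matrix (Fin 2) (Fin 2) Y) a 1 c :=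
    quaternionBasis !![κ, 0; 0, 1 - κ] !![0, c • 1; 1, 0]
      (by rw [hm]; simp [hii, mul_sub, sub_mul])
      (by rw [hm]; simp)
      (by rw [Matrix.one_fin_two]; simp)
  refine ⟨Algebra.TensorProduct.lift B₁.liftHom B₂.liftHom fun x y => ?_⟩
  apply quaternion_commute
  · refine (quaternion_commute _ ?_ ?_ y).symm
    · change _ * _ = _ * _
      simp [B₁, B₂, mul_sub, sub_mul]
    · change _ * _ = _ * _
      simp [B₁, B₂]
  · refine (quaternion_commute _ ?_ ?_ y).symm
    · change _ * _ = _ * _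
      simp [B₁, B₂, hji, hji']
    · change _ * _ = _ * _
      simp [B₁, B₂, smul_smul, hc]

theorem quaternion_tensor (ha : 1 + 4 * a ≠ 0) (hb : b ≠ 0) (hc : c ≠ 0) :
    BrauerEquiv E (QuaternionAlgebra E a 1 b ⊗[E] QuaternionAlgebra E a 1 c)
      (QuaternionAlgebra E a 1 (b * c)) := by
  obtain ⟨f⟩ := exists_quaternion_tensor_hom (a := a) (b := b) hc (QuaternionAlgebra.Basis.self E)
  obtain ⟨_, _, _⟩ := (quaternion_isCSA ha hb).tensor (quaternion_isCSA ha hc)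
  have := (quaternion_isCSA ha (mul_ne_zero hb hc)).2.1
  have hbij := algHom_bijective_of_finrank_eq f (by
    rw [finrank_tensorProduct, finrank_matrix, QuaternionAlgebra.finrank_eq_four,
      QuaternionAlgebra.finrank_eq_four, QuaternionAlgebra.finrank_eq_four]; simp)
  exact (BrauerEquiv.of_algEquiv (AlgEquiv.ofBijective f hbij)).trans (BrauerEquiv.matrix two_pos)

theorem quaternion_norm_twist (ha : 1 + 4 * a ≠ 0) (hb : b ≠ 0) (x y : E)
    (hN : x * x + x * y - a * y * y ≠ 0) :
    BrauerEquiv E (QuaternionAlgebra E a 1 ((x * x + x * y - a * y * y) * b))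
      (QuaternionAlgebra E a 1 b) := by
  have h := quaternion_isCSA ha (mul_ne_zero hN hb)
  have h' := quaternion_isCSA ha hb
  obtain ⟨_, _, _⟩ := h
  have := h'.2.1
  let B : QuaternionAlgebra.Basis (QuaternionAlgebra E a 1 b) a 1
      ((x * x + x * y - a * y * y) * b) :=
    quaternionBasis ⟨0, 1, 0, 0⟩ ⟨0, 0, x, y⟩
      (by ext <;> simp [QuaternionAlgebra.algebraMap_eq])
      (by ext <;> simp [QuaternionAlgebra.algebraMap_eq] <;> ring)
      (by ext <;> simp [sub_eq_add_neg])
  exact BrauerEquiv.of_algEquiv (AlgEquiv.ofBijective B.liftHom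
    (algHom_bijective_of_finrank_eq _ (by simp [QuaternionAlgebra.finrank_eq_four])))

end Quaternion

section CliffordStep

variable {E : Type} [Field E] {a : E}

theorem quaternion_equiv_adjoin (ha : 1 + 4 * a ≠ 0) {d : E} (hd : d ≠ 0) {R : Type} [CommRing R]
    [Algebra E R] [Nontrivial R] (τ : R →ₐ[E] R) {w : R} (hw : w * w = w + algebraMap E R a)
    (hτ : τ w = 1 - w) (hgen : ∀ x : R, ∃ r s : E, x = algebraMap E R r + s • w) :
    BrauerEquiv E (QuaternionAlgebra E a 1 d)
      (Algebra.adjoin E ((Set.range fun x : R => (Matrix.diagonal ![x, τ x] :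
        Matrix (Fin 2) (Fin 2) R)) ∪ {!![0, algebraMap E R d; 1, 0]})) := by
  have hm : ∀ r : E, algebraMap E (Matrix (Fin 2) (Fin 2) R) r = !![r • 1, 0; 0, r • 1] := by
    intro r
    rw [Algebra.algebraMap_eq_smul_one, Matrix.one_fin_two]
    simp
  have hdiag : ∀ x y : R, (Matrix.diagonal ![x, y] : Matrix (Fin 2) (Fin 2) R) = !![x, 0; 0, y] := by
    intro x y; ext i j; fin_cases i <;> fin_cases j <;> rfl
  rw [Algebra.algebraMap_eq_smul_one] at hw
  let B : QuaternionAlgebra.Basis (Matrix (Fin 2) (Fin 2) R) a 1 d :=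
    quaternionBasis !![w, 0; 0, 1 - w] !![0, algebraMap E R d; 1, 0]
      (by rw [hm]; simp [hw, mul_sub, sub_mul])
      (by rw [hm]; simp [Algebra.algebraMap_eq_smul_one])
      (by rw [Matrix.one_fin_two]; simp [Algebra.algebraMap_eq_smul_one])
  have := (quaternion_isCSA ha hd).2.1
  have hinj : Function.Injective B.liftHom := B.liftHom.toRingHom.injective
  have hrange : B.liftHom.range = Algebra.adjoin E ((Set.range fun x : R =>
      (Matrix.diagonal ![x, τ x] : Matrix (Fin 2) (Fin 2) R)) ∪
        {!![0, algebraMap E R d; 1, 0]}) := by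
    have hi : B.liftHom ⟨0, 1, 0, 0⟩ = !![w, 0; 0, 1 - w] := by
      change algebraMap E _ 0 + (1 : E) • B.i + (0 : E) • B.j + (0 : E) • B.k = _
      simp [B]
    have hj : B.liftHom ⟨0, 0, 1, 0⟩ = !![0, algebraMap E R d; 1, 0] := by
      change algebraMap E _ 0 + (0 : E) • B.i + (1 : E) • B.j + (0 : E) • B.k = _
      simp [B]
    apply le_antisymm
    · rintro _ ⟨x, rfl⟩
      have h1 : B.i ∈ Algebra.adjoin E ((Set.range fun x : R =>
          (Matrix.diagonal ![x, τ x] : Matrix (Fin 2) (Fin 2) R)) ∪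
            {!![0, algebraMap E R d; 1, 0]}) :=
        Algebra.subset_adjoin (Or.inl ⟨w, by simp only [hτ, hdiag]; rfl⟩)
      have h2 : B.j ∈ Algebra.adjoin E ((Set.range fun x : R =>
          (Matrix.diagonal ![x, τ x] : Matrix (Fin 2) (Fin 2) R)) ∪
            {!![0, algebraMap E R d; 1, 0]}) :=
        Algebra.subset_adjoin (Or.inr rfl)
      change algebraMap E _ x.re + x.imI • B.i + x.imJ • B.j + x.imK • B.k ∈ _
      rw [← B.i_mul_j]
      exact add_mem (add_mem (add_mem (Subalgebra.algebraMap_mem _ _) (Subalgebra.smul_mem _ h1 _))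
        (Subalgebra.smul_mem _ h2 _)) (Subalgebra.smul_mem _ (mul_mem h1 h2) _)
    · refine Algebra.adjoin_le ?_
      rintro _ (⟨x, rfl⟩ | rfl)
      · obtain ⟨r, s, rfl⟩ := hgen x
        have : (Matrix.diagonal ![algebraMap E R r + s • w, τ (algebraMap E R r + s • w)] :
            Matrix (Fin 2) (Fin 2) R) = algebraMap E _ r + s • !![w, 0; 0, 1 - w] := by
          rw [hdiag, hm]
          simp [hτ, Algebra.algebraMap_eq_smul_one]
        simp only [SetLike.mem_coe, this]
        exact add_mem (Subalgebra.algebraMap_mem _ _) (Subalgebra.smul_mem _ ((AlgHom.mem_range _).2 ⟨_, hi⟩) _)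
      · exact (AlgHom.mem_range _).2 ⟨_, hj⟩
  exact BrauerEquiv.of_algEquiv
    ((AlgEquiv.ofInjective _ hinj).trans (Subalgebra.equivOfEq _ _ hrange))

theorem hermTrace_add_left {m : ℕ} (α : Fin m → E) (f f' g : Fin m → QuadraticAlgebra E a 1) :
    hermTrace α (f + f') g = hermTrace α f g + hermTrace α f' g := by
  simp only [hermTrace, ← Finset.sum_add_distrib]
  exact Finset.sum_congr rfl fun i _ => by
    rw [Pi.add_apply, star_add, add_mul, map_add, mul_add]

theorem hermTrace_smul_left {m : ℕ} (α : Fin m → E) (c : E)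
    (f g : Fin m → QuadraticAlgebra E a 1) :
    hermTrace α (c • f) g = c * hermTrace α f g := by
  simp only [hermTrace, Finset.mul_sum]
  exact Finset.sum_congr rfl fun i _ => by
    have : star ((c • f) i) = c • star (f i) := by ext <;> simp [mul_add]
    rw [this, smul_mul_assoc, map_smul, smul_eq_mul]; ring

theorem hermTrace_comm {m : ℕ} (α : Fin m → E) (f g : Fin m → QuadraticAlgebra E a 1) :
    hermTrace α f g = hermTrace α g f :=
  Finset.sum_congr rfl fun i _ => by
    congr 1
    simp [QuadraticAlgebra.trace_def]; ring

/-- The symmetric bilinear form underlying the diagonal hermitian form `⟨α₁, …, αₘ⟩`. -/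
def hermBilin {m : ℕ} (α : Fin m → E) : LinearMap.BilinForm E (Fin m → QuadraticAlgebra E a 1) :=
  LinearMap.mk₂ E (hermTrace α) (hermTrace_add_left α) (hermTrace_smul_left α)
    (fun f g g' => by
      rw [hermTrace_comm, hermTrace_add_left, hermTrace_comm α g, hermTrace_comm α g'])
    (fun c f g => by rw [hermTrace_comm, hermTrace_smul_left, hermTrace_comm α g]; rfl)

/-- The quadratic form `v ↦ h(v, v)` of the diagonal hermitian form `h = ⟨α₁, …, αₘ⟩`. -/
def hermForm {m : ℕ} (α : Fin m → E) : QuadraticForm E (Fin m → QuadraticAlgebra E a 1) :=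
  LinearMap.BilinMap.toQuadraticMap
    ((hermBilin α).compl₂ (LinearMap.mulLeft E fun _ => QuadraticAlgebra.omega))

theorem hermForm_eq {m : ℕ} (α : Fin m → E) (f : Fin m → QuadraticAlgebra E a 1) :
    hermForm α f = hermTrace α f fun i => QuadraticAlgebra.omega * f i := rfl

theorem hermForm_apply {m : ℕ} (α : Fin m → E) (f : Fin m → QuadraticAlgebra E a 1) :
    hermForm α f = ∑ i, α i * QuadraticAlgebra.norm (f i) := by
  rw [hermForm_eq]
  exact Finset.sum_congr rfl fun i _ => by
    congr 1
    simp [QuadraticAlgebra.trace_def, QuadraticAlgebra.norm_def]; ring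

theorem polar_hermForm {m : ℕ} (α : Fin m → E) (f g : Fin m → QuadraticAlgebra E a 1) :
    QuadraticMap.polar (hermForm α) f g = hermTrace α f g := by
  simp only [QuadraticMap.polar, hermForm_apply, hermTrace, ← Finset.sum_sub_distrib]
  exact Finset.sum_congr rfl fun i _ => by
    simp [QuadraticAlgebra.trace_def, QuadraticAlgebra.norm_def]; ring

theorem hermForm_cons {m : ℕ} (α : Fin (m + 1) → E) (r : QuadraticAlgebra E a 1)
    (g : Fin m → QuadraticAlgebra E a 1) :
    hermForm α (Fin.cons r g) = α 0 * QuadraticAlgebra.norm r +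
      hermForm (fun i => α i.succ) g := by
  simp [hermForm_apply, Fin.sum_univ_succ]

theorem hermForm_smul {m : ℕ} (c : E) (α : Fin m → E) (g : Fin m → QuadraticAlgebra E a 1) :
    hermForm (fun i => c * α i) g = c * hermForm α g := by
  simp [hermForm_apply, Finset.mul_sum, mul_assoc]

end CliffordStep

section CliffordHermitian

variable {E : Type} [Field E] {a : E}

instance nontrivial_clifford_hermForm {m : ℕ} (α : Fin m → E) :
    Nontrivial (CliffordAlgebra (hermForm (a := a) α)) := by
  refine ⟨⟨0, 1, fun h => ?_⟩⟩
  let B : LinearMap.BilinForm E (Fin m → QuadraticAlgebra E a 1) :=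
    -((hermBilin α).compl₂ (LinearMap.mulLeft E fun _ => QuadraticAlgebra.omega))
  have hB : B.toQuadraticMap = 0 - hermForm α := by
    ext f
    rw [zero_sub]
    rfl
  have h1 := CliffordAlgebra.changeForm_one hB
  rw [← h, map_zero] at h1
  exact zero_ne_one (α := ExteriorAlgebra E (Fin m → QuadraticAlgebra E a 1)) h1

theorem clifford_hermForm_step {m : ℕ} (ha : 1 + 4 * a ≠ 0) (α : Fin (m + 1) → E)
    (hα : ∀ i, α i ≠ 0)
    (hC : IsCSA E (CliffordAlgebra (hermForm (a := a) fun i => (1 + 4 * a)⁻¹ * α i.succ))) :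
    Nonempty (QuaternionAlgebra E a 1 (α 0) ⊗[E]
      CliffordAlgebra (hermForm (a := a) fun i => (1 + 4 * a)⁻¹ * α i.succ) ≃ₐ[E]
        CliffordAlgebra (hermForm (a := a) α)) := by
  obtain ⟨_, _, _⟩ := (quaternion_isCSA ha (hα 0)).tensor hC
  let ι := CliffordAlgebra.ι (hermForm (a := a) α)
  let tail : (Fin m → QuadraticAlgebra E a 1) →ₗ[E] (Fin (m + 1) → QuadraticAlgebra E a 1) :=
    { toFun := fun g => Fin.cons 0 g
      map_add' := fun g g' => by ext i : 1; refine Fin.cases ?_ (fun _ => ?_) i <;> simp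
      map_smul' := fun c g => by ext i : 1; refine Fin.cases ?_ (fun _ => ?_) i <;> simp }
  let head : QuadraticAlgebra E a 1 → (Fin (m + 1) → QuadraticAlgebra E a 1) :=
    fun r => Fin.cons r 0
  have hdec : ∀ f : Fin (m + 1) → QuadraticAlgebra E a 1,
      f = (f 0).re • head 1 + (f 0).im • head QuadraticAlgebra.omega +
        tail (fun i => f i.succ) := by
    intro f
    ext i : 1
    refine Fin.cases ?_ (fun _ => ?_) i
    · ext <;> simp [tail, head, QuadraticAlgebra.re_one, QuadraticAlgebra.im_one]
    · simp [tail, head]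
  obtain ⟨v, hv⟩ : ∃ v, v = ι (head 1) := ⟨_, rfl⟩
  obtain ⟨v', hv'⟩ : ∃ v, v = ι (head QuadraticAlgebra.omega) := ⟨_, rfl⟩
  have hvv : v * v = algebraMap E _ (α 0) := by
    rw [hv, CliffordAlgebra.ι_sq_scalar, hermForm_cons]
    simp
  have hvv' : v' * v' = algebraMap E _ (-(α 0 * a)) := by
    rw [hv', CliffordAlgebra.ι_sq_scalar, hermForm_cons]
    simp [QuadraticAlgebra.norm_def]
  have hswap : v * v' + v' * v = algebraMap E _ (α 0) := by
    rw [hv, hv', CliffordAlgebra.ι_mul_ι_add_swap, polar_hermForm]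
    simp [hermTrace, Fin.sum_univ_succ, head, QuadraticAlgebra.trace_def,
      QuadraticAlgebra.re_one, QuadraticAlgebra.im_one]
  let y : (Fin m → QuadraticAlgebra E a 1) →ₗ[E] CliffordAlgebra (hermForm (a := a) α) := ι ∘ₗ tail
  have hy : ∀ g, y g * y g = algebraMap E _ (hermForm (fun i => α i.succ) g) := by
    intro g
    change ι (Fin.cons 0 g) * ι (Fin.cons 0 g) = _
    rw [CliffordAlgebra.ι_sq_scalar, hermForm_cons]
    simp
  have hvy : ∀ g, v * y g = - (y g * v) := by
    intro g
    rw [eq_neg_iff_add_eq_zero, hv]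
    change ι _ * ι (Fin.cons 0 g) + ι (Fin.cons 0 g) * ι _ = _
    rw [CliffordAlgebra.ι_mul_ι_add_swap, polar_hermForm]
    simp [hermTrace, Fin.sum_univ_succ, head, QuadraticAlgebra.trace_def]
  have hvy' : ∀ g, v' * y g = - (y g * v') := by
    intro g
    rw [eq_neg_iff_add_eq_zero, hv']
    change ι _ * ι (Fin.cons 0 g) + ι (Fin.cons 0 g) * ι _ = _
    rw [CliffordAlgebra.ι_mul_ι_add_swap, polar_hermForm]
    simp [hermTrace, Fin.sum_univ_succ, head, QuadraticAlgebra.trace_def]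
  have hgens : ∀ S : Subalgebra E (CliffordAlgebra (hermForm (a := a) α)),
      v ∈ S → v' ∈ S → (∀ g, y g ∈ S) → S = ⊤ := by
    intro S h1 h2 h3
    rw [eq_top_iff, ← CliffordAlgebra.adjoin_range_ι]
    refine Algebra.adjoin_le ?_
    rintro _ ⟨f, rfl⟩
    rw [hdec f, map_add, map_add, map_smul, map_smul]
    refine add_mem (add_mem (Subalgebra.smul_mem _ ?_ _) (Subalgebra.smul_mem _ ?_ _)) (h3 _)
    · rw [hv] at h1; exact h1
    · rw [hv'] at h2; exact h2
  clear_value y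
  obtain ⟨i, hi⟩ : ∃ i, i = (α 0)⁻¹ • (v * v') := ⟨_, rfl⟩
  rw [Algebra.algebraMap_eq_smul_one] at hvv hvv' hswap
  have h0 := hα 0
  have hswap' : v' * v = α 0 • 1 - v * v' := by rw [← hswap]; abel
  have hii : i * i = i + algebraMap E _ a := by
    rw [hi, smul_mul_smul_comm, show v * v' * (v * v') = v * (v' * v) * v' by noncomm_ring, hswap',
      Algebra.algebraMap_eq_smul_one, mul_sub, sub_mul, mul_smul_comm, smul_mul_assoc, mul_one,
      ← mul_assoc, hvv, smul_mul_assoc, one_mul, smul_mul_assoc, hvv', smul_smul, smul_sub,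
      smul_smul, smul_smul, sub_eq_add_neg, ← neg_smul]
    congr 2 <;> field_simp
  have hvi : v * i = v' := by
    rw [hi, mul_smul_comm, ← mul_assoc, hvv, smul_mul_assoc, one_mul, smul_smul,
      inv_mul_cancel₀ h0, one_smul]
  have hji : v * i = (1 - i) * v := by
    rw [hvi, hi, sub_mul, smul_mul_assoc, mul_assoc, hswap', mul_sub, ← mul_assoc, hvv]
    simp [smul_sub, smul_smul, h0]
  let B : QuaternionAlgebra.Basis (CliffordAlgebra (hermForm (a := a) α)) a 1 (α 0) :=
    quaternionBasis i v hii (by rw [hvv, Algebra.algebraMap_eq_smul_one]) hji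
  have hiy : ∀ g, Commute i (y g) := by
    intro g
    rw [commute_iff_eq, hi, smul_mul_assoc, mul_assoc, hvy', mul_neg, ← mul_assoc, hvy, neg_mul,
      neg_neg, mul_smul_comm, mul_assoc]
  obtain ⟨δ, hδ⟩ : ∃ δ, δ = 2 * i - 1 := ⟨_, rfl⟩
  have hδδ : δ * δ = (1 + 4 * a) • 1 := by
    have : δ * δ = 4 * (i * i - i) + 1 := by rw [hδ]; noncomm_ring
    rw [this, hii, add_sub_cancel_left, ← Algebra.algebraMap_eq_smul_one, map_add, map_mul, map_one]
    rw [map_ofNat]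
    exact add_comm _ _
  have hδi : Commute i δ := by
    rw [hδ]; exact ((Commute.ofNat_right i 2).mul_right (Commute.refl i)).sub_right (Commute.one_right i)
  have hδy : ∀ g, Commute δ (y g) := by
    intro g
    rw [hδ]
    exact ((Commute.ofNat_left 2 _).mul_left (hiy g)).sub_left (Commute.one_left _)
  have hvδ : v * δ = - (δ * v) := by
    have : v * δ = 2 * (v * i) - v := by rw [hδ]; noncomm_ring
    rw [this, hji, hδ]; noncomm_ring
  let η : (Fin m → QuadraticAlgebra E a 1) →ₗ[E] CliffordAlgebra (hermForm (a := a) α) :=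
    (1 + 4 * a)⁻¹ • (LinearMap.mulLeft E δ ∘ₗ y)
  have hη : ∀ g, η g = (1 + 4 * a)⁻¹ • (δ * y g) := fun g => rfl
  have hη2 : ∀ g, η g * η g =
      algebraMap E _ (hermForm (fun i => (1 + 4 * a)⁻¹ * α i.succ) g) := by
    intro g
    rw [hη, smul_mul_smul_comm, (hδy g).symm.mul_mul_mul_comm, hδδ, hy, hermForm_smul,
      Algebra.algebraMap_eq_smul_one, Algebra.algebraMap_eq_smul_one, smul_mul_smul_comm, one_mul,
      smul_smul]
    congr 1
    field_simp
  let Λ := CliffordAlgebra.lift (hermForm (a := a) fun i => (1 + 4 * a)⁻¹ * α i.succ) ⟨η, hη2⟩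
  have hΛ : ∀ g, Λ (CliffordAlgebra.ι _ g) = η g := fun g => CliffordAlgebra.lift_ι_apply _ _ _
  have hcomm : ∀ x z, Commute (B.liftHom x) (Λ z) := by
    intro x z
    induction z using CliffordAlgebra.induction with
    | algebraMap r => rw [AlgHom.commutes]; exact Algebra.commute_algebraMap_right _ _
    | ι g =>
      refine quaternion_commute B ?_ ?_ x
      · rw [hΛ, hη]
        exact (hδi.mul_right (hiy g)).smul_right _
      · rw [hΛ, hη]
        refine Commute.smul_right ?_ _
        change v * (δ * y g) = δ * y g * v
        rw [← mul_assoc, hvδ, neg_mul, mul_assoc, hvy, mul_neg, neg_neg, mul_assoc]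
    | mul z z' h h' => rw [map_mul]; exact h.mul_right h'
    | add z z' h h' => rw [map_add]; exact h.add_right h'
  let Φ := Algebra.TensorProduct.lift B.liftHom Λ hcomm
  have hΦ : ∀ x z, Φ (x ⊗ₜ z) = B.liftHom x * Λ z := fun x z =>
    Algebra.TensorProduct.lift_tmul _ _ _ _ _
  have hBi : B.liftHom ⟨0, 1, 0, 0⟩ = i := by
    change algebraMap E _ 0 + (1 : E) • B.i + (0 : E) • B.j + (0 : E) • B.k = _
    simp [B]
  have hBj : B.liftHom ⟨0, 0, 1, 0⟩ = v := by
    change algebraMap E _ 0 + (0 : E) • B.i + (1 : E) • B.j + (0 : E) • B.k = _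
    simp [B]
  have hiΦ : i ∈ Φ.range := (AlgHom.mem_range _).2 ⟨⟨0, 1, 0, 0⟩ ⊗ₜ 1, by rw [hΦ, hBi, map_one, mul_one]⟩
  have hvΦ : v ∈ Φ.range := (AlgHom.mem_range _).2 ⟨⟨0, 0, 1, 0⟩ ⊗ₜ 1, by rw [hΦ, hBj, map_one, mul_one]⟩
  have hδΦ : δ ∈ Φ.range := by
    rw [hδ]
    exact sub_mem (mul_mem (ofNat_mem _ 2) hiΦ) (one_mem _)
  have htop := hgens Φ.range hvΦ (hvi ▸ mul_mem hvΦ hiΦ) (fun g => by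
    have h1 : η g ∈ Φ.range := (AlgHom.mem_range _).2 ⟨1 ⊗ₜ CliffordAlgebra.ι _ g, by
      rw [hΦ, map_one, one_mul, hΛ]⟩
    have h2 : y g = δ * η g := by
      rw [hη, mul_smul_comm, ← mul_assoc, hδδ, smul_mul_assoc, one_mul, smul_smul,
        inv_mul_cancel₀ ha, one_smul]
    rw [h2]
    exact mul_mem hδΦ h1)
  exact ⟨AlgEquiv.ofBijective Φ ⟨Φ.toRingHom.injective, AlgHom.range_eq_top _ |>.1 htop⟩⟩

end CliffordHermitian

section CliffordClass

variable {E : Type} [Field E] {a : E}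

theorem quaternion_one (ha : 1 + 4 * a ≠ 0) : BrauerEquiv E E (QuaternionAlgebra E a 1 1) := by
  have hm : ∀ r : E, algebraMap E (Matrix (Fin 2) (Fin 2) E) r = !![r, 0; 0, r] := by
    intro r
    rw [Algebra.algebraMap_eq_smul_one, Matrix.one_fin_two]
    simp
  let B : QuaternionAlgebra.Basis (Matrix (Fin 2) (Fin 2) E) a 1 1 :=
    quaternionBasis !![0, a; 1, 1] !![1, 1; 0, -1]
      (by rw [hm]; simp [add_comm])
      (by rw [hm]; simp)
      (by rw [Matrix.one_fin_two]; simp [add_comm])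
  have := (quaternion_isCSA ha (one_ne_zero (α := E))).2.1
  have h := algHom_bijective_of_finrank_eq B.liftHom (by
    rw [finrank_matrix, QuaternionAlgebra.finrank_eq_four]; simp)
  exact ((BrauerEquiv.of_algEquiv (AlgEquiv.ofBijective _ h)).trans
    (BrauerEquiv.matrix two_pos)).symm

theorem quaternion_pow_twist (ha : 1 + 4 * a ≠ 0) {b : E} (hb : b ≠ 0) (k : ℕ) :
    BrauerEquiv E (QuaternionAlgebra E a 1 ((-(1 + 4 * a)) ^ k * b))
      (QuaternionAlgebra E a 1 b) := by
  induction k with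
  | zero => rw [pow_zero, one_mul]; exact BrauerEquiv.of_algEquiv AlgEquiv.refl
  | succ k ih =>
    have h := quaternion_norm_twist ha (mul_ne_zero (pow_ne_zero k (neg_ne_zero.2 ha)) hb) (-1) 2
      (by convert neg_ne_zero.2 ha using 1; ring)
    rw [show (-1 : E) * -1 + -1 * 2 - a * 2 * 2 = -(1 + 4 * a) by ring, ← mul_assoc,
      ← pow_succ'] at h
    exact h.trans ih

theorem clifford_hermForm_class (ha : 1 + 4 * a ≠ 0) (m : ℕ) (α : Fin m → E)
    (hα : ∀ i, α i ≠ 0) :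
    IsCSA E (CliffordAlgebra (hermForm (a := a) α)) ∧
      BrauerEquiv E (CliffordAlgebra (hermForm (a := a) α))
        (QuaternionAlgebra E a 1 ((-1) ^ (m * (m - 1) / 2) * ∏ i, α i)) := by
  induction m with
  | zero =>
    have hbij : Function.Bijective (Algebra.ofId E (CliffordAlgebra (hermForm (a := a) α))) := by
      refine ⟨(Algebra.ofId E _).toRingHom.injective, (AlgHom.range_eq_top _).1 ?_⟩
      rw [eq_top_iff, ← CliffordAlgebra.adjoin_range_ι]
      refine Algebra.adjoin_le ?_
      rintro _ ⟨f, rfl⟩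
      rw [Subsingleton.elim f 0, map_zero]
      exact zero_mem _
    let e := AlgEquiv.ofBijective _ hbij
    refine ⟨IsCSA.of_algEquiv e ⟨inferInstance, inferInstance, inferInstance⟩, ?_⟩
    have h := (BrauerEquiv.of_algEquiv e).symm.trans (quaternion_one ha)
    have h1 : (-1 : E) ^ (0 * (0 - 1) / 2) * ∏ i, α i = 1 := by simp
    rw [h1]
    exact h
  | succ m ih =>
    have hβ : ∀ i : Fin m, (1 + 4 * a)⁻¹ * α i.succ ≠ 0 := fun i =>
      mul_ne_zero (inv_ne_zero ha) (hα _)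
    obtain ⟨h1, h2⟩ := ih _ hβ
    obtain ⟨e⟩ := clifford_hermForm_step ha α hα h1
    have h0 := quaternion_isCSA ha (hα 0)
    refine ⟨IsCSA.of_algEquiv e (h0.tensor h1), ?_⟩
    have hd : (-1 : E) ^ (m * (m - 1) / 2) * ∏ i : Fin m, ((1 + 4 * a)⁻¹ * α i.succ) ≠ 0 :=
      mul_ne_zero (pow_ne_zero _ (neg_ne_zero.2 one_ne_zero))
        (Finset.prod_ne_zero_iff.2 fun i _ => hβ i)
    have h3 := ((BrauerEquiv.of_algEquiv e).symm.trans (h2.tensor_left)).trans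
      (quaternion_tensor ha (hα 0) hd)
    have h4 := quaternion_pow_twist ha (mul_ne_zero (hα 0) hd) m
    suffices hs : (-1 : E) ^ ((m + 1) * (m + 1 - 1) / 2) * ∏ i, α i = (-(1 + 4 * a)) ^ m *
        (α 0 * ((-1) ^ (m * (m - 1) / 2) * ∏ i : Fin m, (1 + 4 * a)⁻¹ * α i.succ)) by
      rw [hs]
      exact h3.trans h4.symm
    rw [Finset.prod_mul_distrib, Finset.prod_const, Finset.card_univ, Fintype.card_fin,
      Fin.prod_univ_succ, Nat.add_sub_cancel, neg_pow (1 + 4 * a)]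
    have : (m + 1) * m / 2 = m * (m - 1) / 2 + m := by
      rw [← Nat.choose_two_right, ← Nat.add_sub_cancel (n := m) (m := 1), Nat.add_sub_cancel,
        mul_comm (m + 1) m]
      have := Nat.choose_two_right (m + 1)
      rw [Nat.add_sub_cancel, mul_comm] at this
      rw [← this, Nat.choose_succ_succ' m 1, Nat.choose_one_right, add_comm]
    rw [this, pow_add, inv_pow]
    field_simp

end CliffordClass

section Flip

variable {E : Type} [Field E] {a : E}

theorem ι_mul_ι_mem_even {V : Type} [AddCommGroup V] [Module E V] (q : QuadraticForm E V)
    (v w : V) : CliffordAlgebra.ι q v * CliffordAlgebra.ι q w ∈ CliffordAlgebra.even q :=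
  CliffordAlgebra.ι_mul_ι_mem_evenOdd_zero q v w

theorem flip_relations {Y : Type} [Ring Y] [Algebra E Y] {b : E} (hb : b ≠ 0) {v v' : Y}
    (h : v * v = b • 1) (h' : v' * v' = (-(b * a)) • 1) (hs : v * v' + v' * v = b • 1) :
    (b⁻¹ • (v * v')) * (b⁻¹ • (v * v')) = b⁻¹ • (v * v') + a • 1 ∧
      (b⁻¹ • (v * v')) * v = v * (1 - b⁻¹ • (v * v')) ∧
      (b⁻¹ • (v * v')) * v' = v' * (1 - b⁻¹ • (v * v')) := by
  have hs' : v' * v = b • 1 - v * v' := by rw [← hs]; abel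
  refine ⟨?_, ?_, ?_⟩
  · rw [smul_mul_smul_comm, show v * v' * (v * v') = v * (v' * v) * v' by noncomm_ring, hs',
      mul_sub, sub_mul, mul_smul_comm, smul_mul_assoc, mul_one,
      ← mul_assoc, h, smul_mul_assoc, one_mul, smul_mul_assoc, h', smul_smul, smul_sub,
      smul_smul, smul_smul, sub_eq_add_neg, ← neg_smul]
    congr 2 <;> field_simp
  · rw [smul_mul_assoc, mul_assoc, hs', mul_sub, ← mul_assoc v v v', h, mul_sub, mul_one,
      mul_smul_comm b⁻¹ v, ← mul_assoc v v v', h]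
    simp [smul_sub, smul_smul, hb]
  · rw [smul_mul_assoc, mul_assoc, h', mul_sub, mul_one, mul_smul_comm b⁻¹ v', ← mul_assoc v' v v', hs',
      sub_mul, mul_assoc v v' v', h']
    simp [smul_sub, smul_smul, hb]

theorem exists_coordinate_flip {m : ℕ} (α : Fin m → E) (i : Fin m) (hα : α i ≠ 0) :
    ∃ κ ∈ CliffordAlgebra.even (hermForm (a := a) α), κ * κ = κ + a • 1 ∧
      (∀ r, κ * CliffordAlgebra.ι _ (Pi.single i r) =
        CliffordAlgebra.ι _ (Pi.single i r) * (1 - κ)) ∧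
      (∀ j ≠ i, ∀ r, Commute κ (CliffordAlgebra.ι _ (Pi.single j r))) ∧
      ∀ z, (∀ r, Commute z (CliffordAlgebra.ι _ (Pi.single i r))) → Commute z κ := by
  obtain ⟨ι, hι⟩ : ∃ ι, ι = CliffordAlgebra.ι (hermForm (a := a) α) := ⟨_, rfl⟩
  have hsq : ∀ r, ι (Pi.single i r) * ι (Pi.single i r) =
      (α i * QuadraticAlgebra.norm r) • 1 := by
    intro r
    rw [hι, CliffordAlgebra.ι_sq_scalar, hermForm_apply, Algebra.algebraMap_eq_smul_one,
      Finset.sum_eq_single i (fun j _ hj => by rw [Pi.single_eq_of_ne hj]; simp) (by simp),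
      Pi.single_eq_same]
  have hsw : ∀ j r s, ι (Pi.single i r) * ι (Pi.single j s) + ι (Pi.single j s) * ι (Pi.single i r)
      = (α i * QuadraticAlgebra.trace (star r * (Pi.single j s : Fin m → QuadraticAlgebra E a 1) i)) • 1 := by
    intro j r s
    rw [hι, CliffordAlgebra.ι_mul_ι_add_swap, polar_hermForm, hermTrace,
      Algebra.algebraMap_eq_smul_one,
      Finset.sum_eq_single i (fun j _ hj => by rw [Pi.single_eq_of_ne hj]; simp) (by simp),
      Pi.single_eq_same]
  obtain ⟨h1, h2, h3⟩ := flip_relations (a := a) hα (v := ι (Pi.single i 1))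
    (v' := ι (Pi.single i QuadraticAlgebra.omega)) (by rw [hsq]; simp)
    (by rw [hsq]; simp [QuadraticAlgebra.norm_def])
    (by rw [hsw, Pi.single_eq_same]; simp [QuadraticAlgebra.trace_def])
  refine ⟨_, Subalgebra.smul_mem _ (ι_mul_ι_mem_even _ _ _) _, by rw [← hι]; exact h1, ?_, ?_,
    fun z hz => ((hz _).mul_right (hz _)).smul_right _⟩
  · intro r
    have : (Pi.single i r : Fin m → QuadraticAlgebra E a 1) =
        r.re • (Pi.single i 1 : Fin m → QuadraticAlgebra E a 1) +
          r.im • (Pi.single i QuadraticAlgebra.omega : Fin m → QuadraticAlgebra E a 1) := by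
      rw [← Pi.single_smul, ← Pi.single_smul, ← Pi.single_add]
      congr 1
      ext <;> simp [QuadraticAlgebra.re_one, QuadraticAlgebra.im_one]
    rw [← hι, this, map_add, map_smul, map_smul, mul_add, add_mul, mul_smul_comm, mul_smul_comm,
      h2, h3, smul_mul_assoc, smul_mul_assoc]
  · intro j hj r
    have h : ∀ s, ι (Pi.single i s) * ι (Pi.single j r) =
        -(ι (Pi.single j r) * ι (Pi.single i s)) := by
      intro s
      rw [eq_neg_iff_add_eq_zero, hsw, Pi.single_eq_of_ne hj.symm]
      simp
    rw [← hι]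
    refine Commute.smul_left ?_ _
    rw [commute_iff_eq, mul_assoc, h, mul_neg, ← mul_assoc, h, neg_mul, neg_neg, mul_assoc]

theorem flip_mul {Y : Type} [Ring Y] {c d z : Y} (hc : c * z = z * (1 - c))
    (hd : Commute d z) :
    (c + d - 2 * (c * d)) * z = z * (1 - (c + d - 2 * (c * d))) := by
  have h1 : c * d * z = z * (1 - c) * d := by rw [mul_assoc, hd.eq, ← mul_assoc, hc]
  rw [sub_mul, add_mul, mul_assoc 2, h1, hc, hd.eq]
  noncomm_ring

theorem flip_sq {Y : Type} [Ring Y] [Algebra E Y] {c d : Y} {s t : E} (hcd : Commute c d)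
    (hc : c * c = c + s • 1) (hd : d * d = d + t • 1) :
    (c + d - 2 * (c * d)) * (c + d - 2 * (c * d)) =
      (c + d - 2 * (c * d)) + (s + t + 4 * s * t) • 1 := by
  have h1 : (c + d - 2 * (c * d)) * (c + d - 2 * (c * d)) =
      c * c + d * d + (c * d + d * c) - 2 * (c * (c * d) + d * (c * d) + (c * d) * c + (c * d) * d)
        + 4 * ((c * d) * (c * d)) := by noncomm_ring
  have h2 : c * (c * d) = c * d + s • d := by rw [← mul_assoc, hc, add_mul, smul_mul_assoc, one_mul]
  have h3 : c * d * d = c * d + t • c := by rw [mul_assoc, hd, mul_add, mul_smul_comm, mul_one]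
  have h4 : c * d * (c * d) = c * d + s • d + t • c + (s * t) • 1 := by
    rw [hcd.symm.mul_mul_mul_comm, hc, hd, add_mul, mul_add, mul_add, smul_mul_smul_comm]
    simp only [smul_mul_assoc, mul_smul_comm, mul_one, one_mul]
    abel
  have h5 : d * (c * d) = c * d * d := by rw [← mul_assoc, hcd.eq]
  have h6 : c * d * c = c * (c * d) := by rw [mul_assoc, hcd.eq]
  rw [h1, h5, h6, ← hcd.eq, h2, h3, h4, hc, hd, add_smul, add_smul]
  have h7 : (4 * s * t) • (1 : Y) = 4 * ((s * t) • 1) := by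
    rw [mul_assoc, mul_smul, ← Nat.cast_ofNat (n := 4), Nat.cast_smul_eq_nsmul, nsmul_eq_mul]
    norm_num
  rw [h7]
  generalize s • (1 : Y) = x1
  noncomm_ring

theorem flip_normalize {Y : Type} [Ring Y] [Algebra E Y] {c : Y} {b : E} (hb : 1 + 4 * b ≠ 0)
    (hc : c * c = c + (b + b + 4 * b * b) • 1) :
    ((1 + 4 * b)⁻¹ • (c + (2 * b) • 1)) * ((1 + 4 * b)⁻¹ • (c + (2 * b) • 1)) =
        (1 + 4 * b)⁻¹ • (c + (2 * b) • 1) ∧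
      ∀ z, c * z = z * (1 - c) → ((1 + 4 * b)⁻¹ • (c + (2 * b) • 1)) * z =
        z * (1 - (1 + 4 * b)⁻¹ • (c + (2 * b) • 1)) := by
  constructor
  · rw [smul_mul_smul_comm, add_mul, mul_add, mul_add, hc, mul_smul, mul_smul_one]
    rw [← sub_eq_zero]
    simp only [smul_mul_assoc, one_mul, ← smul_sub]
    have : (1 + 4 * b)⁻¹ • (c + (b + b + 4 * b * b) • 1 + (2 * b) • c +
        ((2 * b) • c + (2 * b) • (2 * b) • (1 : Y))) = c + (2 * b) • 1 := by
      rw [inv_smul_eq_iff₀ hb]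
      module
    rw [this, sub_self, smul_zero]
  · intro z hz
    rw [mul_sub, mul_one, smul_mul_assoc, add_mul, hz, mul_smul_comm, mul_add, smul_mul_assoc,
      one_mul, mul_smul_comm, mul_one, mul_sub, mul_one]
    rw [eq_sub_iff_add_eq, ← smul_add, inv_smul_eq_iff₀ hb]
    module

theorem exists_flip {m : ℕ} (α : Fin m → E) (b : E) (hb : 1 + 4 * b ≠ 0)
    (hκ : ∀ i, ∃ κ ∈ CliffordAlgebra.even (hermForm (a := a) α), κ * κ = κ + b • 1 ∧
      (∀ r, κ * CliffordAlgebra.ι _ (Pi.single i r) =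
        CliffordAlgebra.ι _ (Pi.single i r) * (1 - κ)) ∧
      (∀ j ≠ i, ∀ r, Commute κ (CliffordAlgebra.ι _ (Pi.single j r))) ∧
      ∀ z, (∀ r, Commute z (CliffordAlgebra.ι _ (Pi.single i r))) → Commute z κ) :
    ∃ c ∈ CliffordAlgebra.even (hermForm (a := a) α),
      c * c = c + (if Even m then 0 else b) • 1 ∧
      ∀ v, c * CliffordAlgebra.ι _ v = CliffordAlgebra.ι _ v * (1 - c) := by
  suffices H : ∀ S : Finset (Fin m), ∃ c ∈ CliffordAlgebra.even (hermForm (a := a) α),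
      c * c = c + (if Even S.card then 0 else b) • 1 ∧
      (∀ i ∈ S, ∀ r, c * CliffordAlgebra.ι _ (Pi.single i r) =
        CliffordAlgebra.ι _ (Pi.single i r) * (1 - c)) ∧
      ∀ i ∉ S, ∀ r, Commute c (CliffordAlgebra.ι _ (Pi.single i r)) by
    obtain ⟨c, h1, h2, h3, -⟩ := H Finset.univ
    rw [Finset.card_univ, Fintype.card_fin] at h2
    refine ⟨c, h1, h2, fun v => ?_⟩
    have hv : v = ∑ i, Pi.single i (v i) := (Finset.univ_sum_single v).symm
    rw [hv, map_sum, Finset.mul_sum, Finset.sum_mul]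
    exact Finset.sum_congr rfl fun i hi => h3 i hi _
  intro S
  induction S using Finset.induction_on with
  | empty => exact ⟨0, zero_mem _, by simp, by simp, fun i _ r => Commute.zero_left _⟩
  | insert i S hi ih =>
    obtain ⟨c, hc, hcc, hcS, hcS'⟩ := ih
    obtain ⟨κ, hκ, hκκ, hκi, hκj, hκz⟩ := hκ i
    have hcκ : Commute c κ := hκz _ (hcS' i hi)
    simp only [Finset.card_insert_of_notMem hi, Nat.even_add_one]
    have hflip : ∀ j ∈ insert i S, ∀ r,
        (c + κ - 2 * (c * κ)) * CliffordAlgebra.ι _ (Pi.single j r) =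
          CliffordAlgebra.ι _ (Pi.single j r) * (1 - (c + κ - 2 * (c * κ))) := by
      intro j hj r
      rw [Finset.mem_insert] at hj
      by_cases hji : j = i
      · subst hji
        have := flip_mul (hκi r) (hcS' j hi r)
        rwa [← hcκ.eq, add_comm κ c] at this
      · exact flip_mul (hcS j (hj.resolve_left hji) r) (hκj j hji r)
    have hcomm : ∀ j ∉ insert i S, ∀ r,
        Commute (c + κ - 2 * (c * κ)) (CliffordAlgebra.ι _ (Pi.single j r)) := by
      intro j hj r
      rw [Finset.mem_insert, not_or] at hj
      exact ((hcS' j hj.2 r).add_left (hκj j hj.1 r)).sub_left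
        ((Commute.ofNat_left 2 _).mul_left ((hcS' j hj.2 r).mul_left (hκj j hj.1 r)))
    have hmem : c + κ - 2 * (c * κ) ∈ CliffordAlgebra.even (hermForm (a := a) α) :=
      sub_mem (add_mem hc hκ) (mul_mem (ofNat_mem _ 2) (mul_mem hc hκ))
    have hsq := flip_sq hcκ hcc hκκ
    by_cases hS : Even S.card
    · refine ⟨_, hmem, ?_, hflip, hcomm⟩
      rw [hsq]
      simp [hS]
    · rw [if_neg hS] at hsq
      obtain ⟨h1, h2⟩ := flip_normalize hb hsq
      refine ⟨_, Subalgebra.smul_mem _ (add_mem hmem (Subalgebra.smul_mem _ (one_mem _) _)) _,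
        ?_, fun j hj r => h2 _ (hflip j hj r), fun j hj r => ?_⟩
      · rw [h1]
        simp [hS]
      · exact ((hcomm j hj r).add_left ((Commute.one_left _).smul_left _)).smul_left _

/-- If the number of coordinates is even, or the quadratic algebra splits, the even Clifford
algebra contains an idempotent exchanging with its complement when moved across vectors. -/
theorem exists_flip_idempotent {m : ℕ} (ha : 1 + 4 * a ≠ 0) (α : Fin m → E) (hα : ∀ i, α i ≠ 0)
    (h : Even m ∨ ∃ r : E, r * r = r + a) :
    ∃ e ∈ CliffordAlgebra.even (hermForm (a := a) α), e * e = e ∧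
      ∀ v, e * CliffordAlgebra.ι _ v = CliffordAlgebra.ι _ v * (1 - e) := by
  obtain h | ⟨r, hr⟩ := h
  · obtain ⟨c, h1, h2, h3⟩ := exists_flip α a ha fun i => exists_coordinate_flip α i (hα i)
    exact ⟨c, h1, by simpa [h] using h2, h3⟩
  · obtain ⟨c, h1, h2, h3⟩ := exists_flip (a := a) α 0 (by simp) fun i => by
      obtain ⟨κ, k1, k2, k3, k4, k5⟩ := exists_coordinate_flip (a := a) α i (hα i)
      have hΔ : (2 * r - 1) * (2 * r - 1) = 1 + 4 * a := by linear_combination 4 * hr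
      have hδ : 2 * r - 1 ≠ 0 := fun h0 => ha (by rw [← hΔ, h0, zero_mul])
      refine ⟨(2 * r - 1)⁻¹ • (κ + (r - 1) • 1), Subalgebra.smul_mem _ (add_mem k1
        (Subalgebra.smul_mem _ (one_mem _) _)) _, ?_, fun s => ?_, fun j hj s =>
          ((k4 j hj s).add_left ((Commute.one_left _).smul_left _)).smul_left _,
        fun z hz => ((k5 z hz).add_right ((Commute.one_right _).smul_right _)).smul_right _⟩
      · rw [smul_mul_smul_comm, mul_smul, zero_smul, add_zero, smul_right_inj (inv_ne_zero hδ),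
          inv_smul_eq_iff₀ hδ, add_mul, mul_add, mul_add, k2]
        simp only [smul_mul_assoc, mul_smul_comm, one_mul, mul_one]
        have h0 : a • (1 : CliffordAlgebra (hermForm (a := a) α)) = (r * r - r) • 1 :=
          congrArg (fun t : E => t • (1 : CliffordAlgebra (hermForm (a := a) α)))
            (by rw [hr]; ring)
        rw [h0]
        module
      · rw [mul_sub, mul_one, smul_mul_assoc, add_mul, k3, mul_smul_comm, mul_add, smul_mul_assoc,
          one_mul, mul_smul_comm, mul_one, mul_sub, mul_one]
        rw [eq_sub_iff_add_eq, ← smul_add, inv_smul_eq_iff₀ hδ]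
        module
    exact ⟨c, h1, by simpa using h2, h3⟩

end Flip

section MatrixUnits

variable {E : Type} [Field E] {Y : Type} [Ring Y] [Algebra E Y]

theorem matrix_centralizer_equiv {n : ℕ} (w : Fin n → Fin n → Y)
    (hw : ∀ i j k l, w i j * w k l = if j = k then w i l else 0) (h1 : ∑ i, w i i = 1)
    (P : Subalgebra E Y) (hP : ∀ y, y ∈ P ↔ ∀ i j, w i j * y = y * w i j) :
    Nonempty (Matrix (Fin n) (Fin n) P ≃ₐ[E] Y) := by
  let f : Matrix (Fin n) (Fin n) P →ₐ[E] Y := AlgHom.ofLinearMap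
    { toFun := fun M => ∑ i, ∑ j, w i j * (M i j : Y)
      map_add' := fun M N => by simp [mul_add, Finset.sum_add_distrib]
      map_smul' := fun c M => by simp [Finset.smul_sum] }
    (by
      change ∑ i, ∑ j, w i j * (((1 : Matrix (Fin n) (Fin n) P) i j : P) : Y) = 1
      rw [← h1]
      refine Finset.sum_congr rfl fun i _ => ?_
      rw [Finset.sum_eq_single i (fun j _ hj => by rw [Matrix.one_apply_ne hj.symm]; simp)
        (by simp), Matrix.one_apply_eq, OneMemClass.coe_one, mul_one])
    (fun M N => by
      change ∑ i, ∑ j, w i j * (((M * N) i j : P) : Y) =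
        (∑ i, ∑ j, w i j * (M i j : Y)) * ∑ i, ∑ j, w i j * (N i j : Y)
      have key : ∀ i j k l, (w i j * (M i j : Y)) * (w k l * (N k l : Y)) =
          if j = k then w i l * ((M i j : Y) * (N k l : Y)) else 0 := by
        intro i j k l
        rw [mul_assoc, ← mul_assoc _ (w k l), ← (hP _).1 (M i j).2 k l, mul_assoc (w k l),
          ← mul_assoc, hw]
        split_ifs <;> simp
      simp_rw [Finset.sum_mul, Finset.mul_sum, key]
      refine Finset.sum_congr rfl fun i _ => ?_
      simp_rw [Matrix.mul_apply, AddSubmonoidClass.coe_finsetSum, MulMemClass.coe_mul,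
        Finset.mul_sum]
      rw [Finset.sum_comm]
      refine Finset.sum_congr rfl fun j _ => ?_
      rw [Finset.sum_comm]
      refine Finset.sum_congr rfl fun l _ => ?_
      simp)
  have hf : ∀ M, f M = ∑ i, ∑ j, w i j * (M i j : Y) := fun _ => rfl
  have hcomp : ∀ M i j, ∑ k, w k i * f M * w j k = M i j := by
    intro M i j
    have key : ∀ k r s, w k i * (w r s * (M r s : Y)) * w j k =
        if i = r then if s = j then w k k * (M r s : Y) else 0 else 0 := by
      intro k r s
      rw [← mul_assoc, hw]
      split_ifs with h1 h2
      · rw [mul_assoc, ← (hP _).1 (M r s).2, ← mul_assoc, hw, if_pos h2]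
      · rw [mul_assoc, ← (hP _).1 (M r s).2, ← mul_assoc, hw, if_neg h2, zero_mul]
      · simp
    simp_rw [hf, Finset.mul_sum, Finset.sum_mul, key]
    simp [← Finset.sum_mul, h1]
  refine ⟨AlgEquiv.ofBijective f ⟨fun M N h => ?_, fun y => ?_⟩⟩
  · ext i j
    rw [← hcomp M, ← hcomp N, h]
  · refine ⟨Matrix.of fun i j => ⟨∑ k, w k i * y * w j k, (hP _).2 fun r s => ?_⟩, ?_⟩
    · simp_rw [Finset.mul_sum, Finset.sum_mul, ← mul_assoc, hw, mul_assoc, hw]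
      simp
    · rw [hf]
      have : ∀ i j, w i j * ∑ k, w k i * y * w j k = w i i * y * w j j := by
        intro i j
        simp_rw [Finset.mul_sum, ← mul_assoc, hw]
        simp
      simp_rw [Matrix.of_apply, this]
      simp_rw [← Finset.mul_sum, h1, ← Finset.sum_mul, h1]
      simp

theorem IsCSA.of_matrix {n : ℕ} (hn : 0 < n) (h : IsCSA E (Matrix (Fin n) (Fin n) Y)) :
    IsCSA E Y := by
  obtain ⟨h1, h2, h3⟩ := h
  let i0 : Fin n := ⟨0, hn⟩
  have : Nonempty (Fin n) := ⟨i0⟩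
  refine ⟨⟨fun z hz => ?_⟩, ⟨?_⟩, ?_⟩
  · have : Matrix.scalar (Fin n) z ∈ Subalgebra.center E (Matrix (Fin n) (Fin n) Y) := by
      rw [Subalgebra.mem_center_iff] at hz ⊢
      intro M
      ext i j
      simp [hz]
    obtain ⟨c, hc⟩ := h1.out this
    refine ⟨c, ?_⟩
    have h4 := congrFun (congrFun hc i0) i0
    simpa [Algebra.ofId_apply, Matrix.algebraMap_matrix_apply] using h4
  · exact TwoSidedIdeal.orderIsoMatrix (n := Fin n) |>.isSimpleOrder
  · refine Module.Finite.of_injective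
      ({ toFun := fun y => Matrix.scalar (Fin n) y
         map_add' := fun x y => by simp
         map_smul' := fun c y => by ext i j; simp [Matrix.diagonal_apply] } :
        Y →ₗ[E] Matrix (Fin n) (Fin n) Y) fun x y hxy => ?_
    have := congrFun (congrFun hxy i0) i0
    simpa using this

/-- An idempotent exchanged with its complement by a unit `x` splits its centraliser. -/
theorem flip_structure {e x : Y} {b : E} (hb : b ≠ 0) (he : e * e = e)
    (hx : x * x = b • 1) (hex : e * x = x * (1 - e)) (S : Subalgebra E Y)
    (hS : ∀ y, y ∈ S ↔ e * y = y * e) :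
    ∃ P : Subalgebra E Y, Nonempty (Matrix (Fin 2) (Fin 2) P ≃ₐ[E] Y) ∧
      Nonempty ((P × P) ≃ₐ[E] S) := by
  have hxe : x * e = (1 - e) * x := by rw [sub_mul, one_mul, hex]; noncomm_ring
  have h0 : e * (1 - e) = 0 := by rw [mul_sub, mul_one, he, sub_self]
  have h0' : (1 - e) * e = 0 := by rw [sub_mul, one_mul, he, sub_self]
  have h11 : (1 - e) * (1 - e) = 1 - e := by rw [mul_sub, mul_one, h0', sub_zero]
  have hexe : e * x * e = 0 := by rw [hex, mul_assoc, h0', mul_zero]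
  have hee : e * x * x = b • e := by rw [mul_assoc, hx, mul_smul_one]
  let P : Subalgebra E Y := Subalgebra.centralizer E {e, x}
  have hPmem : ∀ y, y ∈ P ↔ e * y = y * e ∧ x * y = y * x := by
    intro y
    simp [P, Subalgebra.mem_centralizer_iff]
  let w : Fin 2 → Fin 2 → Y := ![![e, e * x], ![b⁻¹ • (x * e), 1 - e]]
  have hxex : x * e * x = b • (1 - e) := by rw [hxe, mul_assoc, hx, mul_smul_one]
  refine ⟨P, matrix_centralizer_equiv w ?_ ?_ P ?_, ?_⟩
  · have t1 : e * (e * x) = e * x := by rw [← mul_assoc, he]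
    have t2 : e * (x * e) = 0 := by rw [← mul_assoc, hexe]
    have t3 : e * x * (e * x) = 0 := by rw [← mul_assoc, hexe, zero_mul]
    have t4 : e * x * (x * e) = b • e := by rw [← mul_assoc, hee, smul_mul_assoc, he]
    have t5 : e * x * (1 - e) = e * x := by rw [mul_sub, mul_one, hexe, sub_zero]
    have t6 : x * e * e = x * e := by rw [mul_assoc, he]
    have t7 : x * e * (e * x) = b • (1 - e) := by rw [← mul_assoc, t6, hxex]
    have t8 : x * e * (x * e) = 0 := by rw [mul_assoc, t2, mul_zero]
    have t9 : x * e * (1 - e) = 0 := by rw [mul_assoc, h0, mul_zero]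
    have t10 : (1 - e) * (e * x) = 0 := by rw [← mul_assoc, h0', zero_mul]
    have t11 : (1 - e) * (x * e) = x * e := by rw [sub_mul, one_mul, t2, sub_zero]
    intro i j k l
    fin_cases i <;> fin_cases j <;> fin_cases k <;> fin_cases l <;>
      simp [w, he, h0, h0', h11, hexe, t1, t2, t3, t4, t5, t6, t7, t8, t9, t10, t11, hb]
  · simp [w]
  · intro y
    rw [hPmem]
    constructor
    · rintro ⟨h1, h2⟩
      have h3 : (x * e) * y = y * (x * e) := by rw [mul_assoc, h1, ← mul_assoc, h2, mul_assoc]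
      have h4 : (e * x) * y = y * (e * x) := by rw [mul_assoc, h2, ← mul_assoc, h1, mul_assoc]
      intro i j
      fin_cases i <;> fin_cases j <;> simp [w, h1, h3, h4, mul_sub, sub_mul]
    · intro h
      have h1 : e * y = y * e := h 0 0
      have h2 : (e * x) * y = y * (e * x) := h 0 1
      have h3 : b⁻¹ • (x * e) * y = y * b⁻¹ • (x * e) := h 1 0
      rw [smul_mul_assoc, mul_smul_comm, smul_right_inj (inv_ne_zero hb)] at h3
      refine ⟨h1, ?_⟩
      have : x = e * x + x * e := by rw [hex]; noncomm_ring
      rw [this, add_mul, h2, h3, mul_add]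
  · let g : P × P →ₐ[E] S := AlgHom.ofLinearMap
      { toFun := fun p => ⟨e * p.1 + (1 - e) * p.2, (hS _).2 (by
          rw [mul_add, add_mul, mul_assoc, mul_assoc, ← ((hPmem _).1 p.1.2).1,
            ← ((hPmem _).1 p.2.2).1, ← mul_assoc (1 - e) e, h0', ← mul_assoc e (1 - e), h0])⟩
        map_add' := fun p p' => Subtype.ext (by simp [mul_add]; abel)
        map_smul' := fun c p => Subtype.ext (by simp) }
      (Subtype.ext (by simp))
      (fun p p' => Subtype.ext (by
        have h1 := ((hPmem _).1 p.1.2).1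
        have h2 := ((hPmem _).1 p.2.2).1
        have h2' : (1 - e) * (p.2 : Y) = p.2 * (1 - e) := by rw [sub_mul, h2]; noncomm_ring
        have h1' : (1 - e) * (p.1 : Y) = p.1 * (1 - e) := by rw [sub_mul, h1]; noncomm_ring
        change e * ((p.1 : Y) * p'.1) + (1 - e) * ((p.2 : Y) * p'.2) =
          (e * (p.1 : Y) + (1 - e) * p.2) * (e * (p'.1 : Y) + (1 - e) * p'.2)
        rw [add_mul, mul_add, mul_add, h1, h2']
        simp only [mul_assoc]
        simp only [← mul_assoc e, ← mul_assoc (1 - e), he, h0, h0', h11]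
        simp only [zero_mul, mul_zero, add_zero, zero_add, ← mul_assoc, h1, h2']))
    have hg : ∀ p, ((g p : S) : Y) = e * (p.1 : Y) + (1 - e) * p.2 := fun _ => rfl
    refine ⟨AlgEquiv.ofBijective g ⟨?_, ?_⟩⟩
    · rw [injective_iff_map_eq_zero]
      rintro ⟨p, p'⟩ h
      have h1 : e * (p : Y) + (1 - e) * p' = 0 := by rw [← hg ⟨p, p'⟩, h]; rfl
      have h2 : e * (p : Y) = 0 := by
        have := congrArg (e * ·) h1
        simpa [mul_add, ← mul_assoc, he, h0] using this
      have h3 : (1 - e) * (p' : Y) = 0 := by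
        have := congrArg ((1 - e) * ·) h1
        simpa [mul_add, ← mul_assoc, h11, h0'] using this
      have hz : ∀ y : Y, x * y = 0 → y = 0 := by
        intro y hy
        have : b • y = 0 := by rw [← one_mul y, ← smul_mul_assoc, ← hx, mul_assoc, hy, mul_zero]
        exact (smul_eq_zero.1 this).resolve_left hb
      have h4 : (1 - e) * (p : Y) = 0 := by
        have h5 : x * (e * (p : Y)) = 0 := by rw [h2, mul_zero]
        rw [← mul_assoc, hxe, mul_assoc, ((hPmem _).1 p.2).2, ← mul_assoc] at h5
        have h6 : (1 - e) * (p : Y) * (x * x) = 0 := by rw [← mul_assoc, h5, zero_mul]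
        rw [hx, mul_smul_one] at h6
        exact (smul_eq_zero.1 h6).resolve_left hb
      have h5 : e * (p' : Y) = 0 := by
        have h5 : x * ((1 - e) * (p' : Y)) = 0 := by rw [h3, mul_zero]
        rw [← mul_assoc, ← hex, mul_assoc, ((hPmem _).1 p'.2).2, ← mul_assoc] at h5
        have h6 : e * (p' : Y) * (x * x) = 0 := by rw [← mul_assoc, h5, zero_mul]
        rw [hx, mul_smul_one] at h6
        exact (smul_eq_zero.1 h6).resolve_left hb
      have e1 : (p : Y) = 0 := by
        calc (p : Y) = e * p + (1 - e) * p := by noncomm_ring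
          _ = 0 := by rw [h2, h4, add_zero]
      have e2 : (p' : Y) = 0 := by
        calc (p' : Y) = e * p' + (1 - e) * p' := by noncomm_ring
          _ = 0 := by rw [h3, h5, add_zero]
      exact Prod.ext (Subtype.ext e1) (Subtype.ext e2)
    · have hmk : ∀ (t : Y) (d : Y), t * t = t → d * d = d → t * d = 0 → d * t = 0 → t + d = 1 →
          t * x = x * d → d * x = x * t → (∀ y, e * y = y * e ↔ t * y = y * t) → ∀ s ∈ S,
          ∃ p ∈ P, t * p = t * s := by
        intro t d ht hd htd hdt h1 htx hdx hte s hs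
        have hst := (hte _).1 ((hS _).1 hs)
        refine ⟨t * s + b⁻¹ • (x * (t * s) * x), (hPmem _).2 ⟨?_, ?_⟩, ?_⟩
        · rw [hte]
          have a1 : t * (x * (t * s) * x) = 0 := by
            rw [← mul_assoc, ← mul_assoc, htx, mul_assoc x, ← mul_assoc d, hdt, zero_mul, mul_zero,
              zero_mul]
          have a2 : (x * (t * s) * x) * t = 0 := by
            rw [mul_assoc, ← hdx, hst, mul_assoc, mul_assoc s, ← mul_assoc t, htd, zero_mul,
              mul_zero, mul_zero]
          rw [mul_add, add_mul, mul_smul_comm, a1, smul_mul_assoc, a2, ← mul_assoc, ht, mul_assoc,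
            ← hst, ← mul_assoc, ht]
        · rw [mul_add, add_mul, mul_smul_comm, smul_mul_assoc, mul_assoc _ x x, hx, mul_smul_one,
            smul_smul, inv_mul_cancel₀ hb, one_smul]
          have a3 : x * (x * (t * s) * x) = b • (t * s * x) := by
            have : x * (x * (t * s) * x) = (x * x) * (t * s * x) := by noncomm_ring
            rw [this, hx, smul_mul_assoc, one_mul]
          rw [a3, smul_smul, inv_mul_cancel₀ hb, one_smul, add_comm]
        · have a1 : t * (x * (t * s) * x) = 0 := by
            rw [← mul_assoc, ← mul_assoc, htx, mul_assoc x, ← mul_assoc d, hdt, zero_mul, mul_zero,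
              zero_mul]
          rw [mul_add, mul_smul_comm, a1, smul_zero, add_zero, ← mul_assoc, ht]
      rintro ⟨s, hs⟩
      obtain ⟨p, hp, hps⟩ := hmk e (1 - e) he h11 h0 h0' (by noncomm_ring) hex hxe.symm
        (fun y => Iff.rfl) s hs
      obtain ⟨p', hp', hps'⟩ := hmk (1 - e) e h11 he h0' h0 (by noncomm_ring) hxe.symm hex
        (fun y => by rw [sub_mul, mul_sub, one_mul, mul_one, sub_right_inj]) s hs
      refine ⟨(⟨p, hp⟩, ⟨p', hp'⟩), Subtype.ext ?_⟩
      rw [hg]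
      change e * p + (1 - e) * p' = s
      rw [hps, hps']
      noncomm_ring

theorem mem_even_iff_commute {V : Type} [AddCommGroup V] [Module E V] (q : QuadraticForm E V)
    {e : CliffordAlgebra q} (he : e * e = e)
    (hev : ∀ v, e * CliffordAlgebra.ι q v = CliffordAlgebra.ι q v * (1 - e))
    (y : CliffordAlgebra q) : y ∈ CliffordAlgebra.even q ↔ e * y = y * e := by
  have heven : ∀ y ∈ CliffordAlgebra.evenOdd q 0, e * y = y * e := by
    intro y hy
    induction y, hy using CliffordAlgebra.even_induction with
    | algebraMap r => exact (Algebra.commutes r e).symm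
    | add x y _ _ hx hy => rw [mul_add, hx, hy, add_mul]
    | ι_mul_ι_mul v w x _ hx =>
      have h1 : e * (CliffordAlgebra.ι q v * CliffordAlgebra.ι q w) =
          CliffordAlgebra.ι q v * CliffordAlgebra.ι q w * e := by
        rw [← mul_assoc, hev, mul_assoc, sub_mul, one_mul, hev]; noncomm_ring
      rw [← mul_assoc, h1, mul_assoc, hx, ← mul_assoc]
  have hodd : ∀ y ∈ CliffordAlgebra.evenOdd q 1, e * y = y * (1 - e) := by
    intro y hy
    induction y, hy using CliffordAlgebra.odd_induction with
    | ι v => exact hev v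
    | add x y _ _ hx hy => rw [mul_add, hx, hy, add_mul]
    | ι_mul_ι_mul v w x _ hx =>
      have h1 : e * (CliffordAlgebra.ι q v * CliffordAlgebra.ι q w) =
          CliffordAlgebra.ι q v * CliffordAlgebra.ι q w * e := by
        rw [← mul_assoc, hev, mul_assoc, sub_mul, one_mul, hev]; noncomm_ring
      rw [← mul_assoc, h1, mul_assoc, hx, ← mul_assoc]
  refine ⟨fun hy => heven y hy, fun hy => ?_⟩
  obtain ⟨y0, h0, y1, h1, rfl⟩ : ∃ y0 ∈ CliffordAlgebra.evenOdd q 0,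
      ∃ y1 ∈ CliffordAlgebra.evenOdd q 1, y0 + y1 = y := by
    have := (CliffordAlgebra.evenOdd_isCompl q).sup_eq_top ▸ Submodule.mem_top (x := y)
    exact Submodule.mem_sup.1 this
  rw [mul_add, add_mul, heven y0 h0, hodd y1 h1, add_right_inj] at hy
  have h2 : y1 * (1 - 2 * e) = 0 := by
    have : y1 * (1 - 2 * e) = y1 * (1 - e) - y1 * e := by noncomm_ring
    rw [this, hy, sub_self]
  have h3 : y1 = 0 := by
    have : y1 = y1 * (1 - 2 * e) * (1 - 2 * e) := by
      rw [mul_assoc]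
      have : (1 - 2 * e) * (1 - 2 * e) = 1 - 4 * (e - e * e) := by noncomm_ring
      rw [this, he, sub_self]; simp
    rw [this, h2, zero_mul]
  rw [h3, add_zero]
  exact h0

theorem even_clifford_split {V : Type} [AddCommGroup V] [Module E V] (q : QuadraticForm E V)
    (hC : IsCSA E (CliffordAlgebra q)) {e : CliffordAlgebra q} (he : e * e = e)
    (hev : ∀ v, e * CliffordAlgebra.ι q v = CliffordAlgebra.ι q v * (1 - e))
    (x : V) (hx : q x ≠ 0) :
    ∃ (P : Type) (_ : Ring P) (_ : Algebra E P), IsCSA E P ∧ BrauerEquiv E P (CliffordAlgebra q) ∧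
      Nonempty ((P × P) ≃ₐ[E] CliffordAlgebra.even q) := by
  obtain ⟨P, ⟨f⟩, hP⟩ := flip_structure hx he
    (by rw [CliffordAlgebra.ι_sq_scalar, Algebra.algebraMap_eq_smul_one]) (hev x)
    (CliffordAlgebra.even q) (mem_even_iff_commute q he hev)
  exact ⟨P, inferInstance, inferInstance, IsCSA.of_matrix two_pos (IsCSA.of_algEquiv f.symm hC),
    (BrauerEquiv.matrix two_pos).symm.trans (BrauerEquiv.of_algEquiv f), hP⟩

end MatrixUnits

section DualFamilies

variable {E : Type} [Field E] {V : Type} [AddCommGroup V] [Module E V]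

theorem exists_dual_families [Module.Finite E V] (b : LinearMap.BilinForm E V)
    (hb : b.Nondegenerate) (hsym : ∀ x y, b x y = b y x) :
    ∃ (n : ℕ) (e e' : Fin n → V), (∀ x, ∑ i, b (e' i) x • e i = x) ∧
      ∀ x, ∑ i, b (e i) x • e' i = x := by
  let B := Module.finBasis E V
  refine ⟨_, B, b.dualBasis hb B, fun x => ?_, fun x => ?_⟩
  · conv_rhs => rw [← B.sum_repr x]
    refine Finset.sum_congr rfl fun i _ => ?_
    congr 1
    have : b (b.dualBasis hb B i) = B.coord i := B.ext fun j => by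
      rw [LinearMap.BilinForm.apply_dualBasis_left, B.coord_apply, B.repr_self,
        Finsupp.single_apply]
    rw [this, B.coord_apply]
  · conv_rhs => rw [← (b.dualBasis hb B).sum_repr x]
    refine Finset.sum_congr rfl fun i _ => ?_
    rw [LinearMap.BilinForm.dualBasis_repr_apply, hsym]

/-- The endomorphism `x ↦ b(w, x) v`. -/
def rankOne (b : LinearMap.BilinForm E V) : V →ₗ[E] V →ₗ[E] Module.End E V :=
  LinearMap.mk₂ E (fun v w => (b w).smulRight v)
    (fun v v' w => by ext x; simp) (fun c v w => by ext x; simp [smul_comm c])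
    (fun v w w' => by ext x; simp [add_smul]) (fun c v w => by ext x; simp [mul_smul])

@[simp] theorem rankOne_apply (b : LinearMap.BilinForm E V) (v w x : V) :
    rankOne b v w x = b w x • v := rfl

variable {b : LinearMap.BilinForm E V} {n : ℕ} {e e' : Fin n → V}

theorem sum_rankOne (h1 : ∀ x, ∑ i, b (e' i) x • e i = x) (X : Module.End E V) :
    ∑ i, rankOne b (X (e i)) (e' i) = X := by
  ext x
  conv_rhs => rw [← h1 x]
  simp [LinearMap.sum_apply, map_sum]

theorem sum_bilin_rankOne {N : Type} [AddCommGroup N] [Module E N]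
    (hsym : ∀ x y, b x y = b y x) (h2 : ∀ x, ∑ i, b (e i) x • e' i = x)
    (g : V →ₗ[E] V →ₗ[E] N) (v w : V) :
    ∑ i, g (rankOne b v w (e i)) (e' i) = g v w := by
  conv_rhs => rw [← h2 w]
  simp only [rankOne_apply, map_smul, LinearMap.smul_apply, map_sum, hsym w]

theorem trace_eq_sum [Module.Finite E V] (h1 : ∀ x, ∑ i, b (e' i) x • e i = x)
    (X : Module.End E V) : LinearMap.trace E V X = ∑ i, b (e' i) (X (e i)) := by
  conv_lhs => rw [← sum_rankOne h1 X]
  rw [map_sum]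
  exact Finset.sum_congr rfl fun i _ => LinearMap.trace_smulRight _ _

theorem sum_eq_zero_of_skew {N : Type} [AddCommGroup N] (G : Fin n → Fin n → N)
    (hd : ∀ i, G i i = 0) (hs : ∀ i j, G i j = - G j i) : ∑ i, ∑ j, G i j = 0 := by
  rw [← Finset.sum_product' (s := Finset.univ) (t := Finset.univ)]
  refine Finset.sum_involution (fun p _ => p.swap) (fun p _ => ?_) (fun p _ hp hp' => ?_)
    (fun _ _ => Finset.mem_univ _) (fun p _ => by simp)
  · rw [hs p.1]; simp
  · have : p.2 = p.1 := congrArg Prod.fst hp'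
    exact hp (by rw [this, hd])

theorem sum_alternating_self_adjoint {N : Type} [AddCommGroup N] [Module E N]
    (hsym : ∀ x y, b x y = b y x) (h2 : ∀ x, ∑ i, b (e i) x • e' i = x)
    (h : V →ₗ[E] V →ₗ[E] N) (halt : ∀ v, h v v = 0) (S : Module.End E V)
    (hS : ∀ x y, b (S x) y = b x (S y)) : ∑ i, h (S (e i)) (e' i) = 0 := by
  have hskew : ∀ v w, h v w = - h w v := fun v w => by
    have := halt (v + w)
    simp only [map_add, LinearMap.add_apply, halt, zero_add, add_zero] at this
    exact eq_neg_of_add_eq_zero_right this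
  have : ∀ i, h (S (e i)) (e' i) = ∑ j, b (e j) (S (e i)) • h (e' j) (e' i) := fun i => by
    conv_lhs => rw [← h2 (S (e i))]
    simp
  simp only [this]
  refine sum_eq_zero_of_skew _ (fun i => by rw [halt, smul_zero]) fun i j => ?_
  rw [hskew, smul_neg, ← hS, hsym]

theorem sum_swap_of_sandwich {N : Type} [AddCommGroup N] [Module E N]
    (hsym : ∀ x y, b x y = b y x) (h2 : ∀ x, ∑ i, b (e i) x • e' i = x)
    {κ : Type} (s : Finset κ) (X Y Y' : κ → Module.End E V)
    (hY : ∀ k x y, b (Y k x) y = b x (Y' k y))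
    (hXY : ∀ v w, ∑ k ∈ s, X k * rankOne b v w * Y k = ∑ k ∈ s, X k * rankOne b w v * Y k)
    (g : V →ₗ[E] V →ₗ[E] N) (v w : V) :
    ∑ k ∈ s, g (X k v) (Y' k w) = ∑ k ∈ s, g (X k w) (Y' k v) := by
  have key : ∀ k v w, X k * rankOne b v w * Y k = rankOne b (X k v) (Y' k w) := by
    intro k v w
    ext x
    simp [hsym w, hY, hsym (Y' k w)]
  simp only [key] at hXY
  have : ∀ v w, ∑ k ∈ s, g (X k v) (Y' k w) =
      ∑ i, g ((∑ k ∈ s, rankOne b (X k v) (Y' k w)) (e i)) (e' i) := by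
    intro v w
    rw [Finset.sum_congr rfl fun k _ => (sum_bilin_rankOne hsym h2 g (X k v) (Y' k w)).symm,
      Finset.sum_comm]
    simp [LinearMap.sum_apply, map_sum]
  rw [this, this, hXY]

end DualFamilies

section CliffordLinear

variable {E : Type} [Field E] {V : Type} [AddCommGroup V] [Module E V]
variable {b : LinearMap.BilinForm E V} {n : ℕ} {e e' : Fin n → V}

/-- The linear map from endomorphisms to the even Clifford algebra sending `x ↦ b(w, x) v` to
`v w`, expressed through dual families. -/
def endToEven (q : QuadraticForm E V) (e e' : Fin n → V) :
    Module.End E V →ₗ[E] CliffordAlgebra.even q :=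
  ∑ i, ((CliffordAlgebra.even.ι q).bilin.flip (e' i)).comp (LinearMap.applyₗ (e i))

theorem endToEven_apply (q : QuadraticForm E V) (X : Module.End E V) :
    endToEven q e e' X = ∑ i, (CliffordAlgebra.even.ι q).bilin (X (e i)) (e' i) := by
  simp [endToEven, LinearMap.sum_apply]

theorem coe_even_ι (q : QuadraticForm E V) (v w : V) :
    (((CliffordAlgebra.even.ι q).bilin v w : CliffordAlgebra.even q) : CliffordAlgebra q) =
      CliffordAlgebra.ι q v * CliffordAlgebra.ι q w := rfl

theorem endToEven_rankOne (q : QuadraticForm E V) (hsym : ∀ x y, b x y = b y x)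
    (h2 : ∀ x, ∑ i, b (e i) x • e' i = x) (v w : V) :
    endToEven q e e' (rankOne b v w) = (CliffordAlgebra.even.ι q).bilin v w := by
  rw [endToEven_apply, sum_bilin_rankOne hsym h2]

variable (q : QuadraticForm E V) (k : Module.End E V)

/-- The alternating map `(v, w) ↦ v w - b(k v, w)` into the even Clifford algebra, where `k` is an
endomorphism with `q(v) = b(k v, v)`. -/
def evenAlt (b : LinearMap.BilinForm E V) : V →ₗ[E] V →ₗ[E] CliffordAlgebra.even q :=
  (CliffordAlgebra.even.ι q).bilin -
    (b.comp k LinearMap.id).compr₂ (Algebra.linearMap E (CliffordAlgebra.even q))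

theorem evenAlt_apply (v w : V) : evenAlt q k b v w =
    (CliffordAlgebra.even.ι q).bilin v w - algebraMap E _ (b (k v) w) := rfl

theorem evenAlt_self (hk : ∀ v, q v = b (k v) v) (v : V) : evenAlt q k b v v = 0 := by
  rw [evenAlt_apply, (CliffordAlgebra.even.ι q).contract, hk, sub_self]

theorem endToEven_self_adjoint [Module.Finite E V] (hsym : ∀ x y, b x y = b y x)
    (h1 : ∀ x, ∑ i, b (e' i) x • e i = x) (h2 : ∀ x, ∑ i, b (e i) x • e' i = x)
    (hk : ∀ v, q v = b (k v) v) (S : Module.End E V) (hS : ∀ x y, b (S x) y = b x (S y)) :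
    endToEven q e e' S = algebraMap E _ (LinearMap.trace E V (k * S)) := by
  have := sum_alternating_self_adjoint hsym h2 (evenAlt q k b) (evenAlt_self q k hk) S hS
  simp only [evenAlt_apply, Finset.sum_sub_distrib, ← endToEven_apply, ← map_sum] at this
  rw [sub_eq_zero.1 this, trace_eq_sum h1]
  simp only [hsym (e' _), Module.End.mul_apply]

theorem endToEven_sandwich (hsym : ∀ x y, b x y = b y x)
    (h1 : ∀ x, ∑ i, b (e' i) x • e i = x) (h2 : ∀ x, ∑ i, b (e i) x • e' i = x)
    (hk : ∀ v, q v = b (k v) v) {k' : Module.End E V} (hkk' : ∀ x y, b (k x) y = b x (k' y))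
    {τ : Type} (s : Finset τ) (X Y Y' : τ → Module.End E V)
    (hY : ∀ t x y, b (Y t x) y = b x (Y' t y))
    (hXY : ∀ v w, ∑ t ∈ s, X t * rankOne b v w * Y t = ∑ t ∈ s, X t * rankOne b w v * Y t) :
    ∑ t ∈ s, endToEven q e e' (X t) * endToEven q e e' (Y t) =
      ∑ t ∈ s, endToEven q e e' (X t * k' * Y t) := by
  let ι := CliffordAlgebra.ι q
  let h := evenAlt q k b
  have hskew : ∀ v w, h v w = - h w v := fun v w => by
    have := evenAlt_self q k hk (v + w)
    simp only [map_add, LinearMap.add_apply, evenAlt_self q k hk, zero_add, add_zero] at this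
    exact eq_neg_of_add_eq_zero_right this
  let g (i j : Fin n) : V →ₗ[E] V →ₗ[E] CliffordAlgebra q :=
    (LinearMap.mul E (CliffordAlgebra q)).compl₁₂
      ((LinearMap.mulRight E ((h (e' i) (e' j) : CliffordAlgebra.even q) : CliffordAlgebra q)).comp ι) ι
  have hg : ∀ i j v w, g i j v w = ι v * (h (e' i) (e' j) : CliffordAlgebra.even q) * ι w :=
    fun _ _ _ _ => rfl
  have hzero : ∑ i, ∑ j, ∑ t ∈ s, g i j (X t (e i)) (Y' t (e j)) = 0 := by
    refine sum_eq_zero_of_skew _ (fun i => ?_) fun i j => ?_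
    · simp [hg, h, evenAlt_self q k hk]
    · rw [sum_swap_of_sandwich hsym h2 s X Y Y' hY hXY, ← Finset.sum_neg_distrib]
      refine Finset.sum_congr rfl fun t _ => ?_
      rw [hg, hg, hskew (e' i)]
      simp
  have expand : ∀ t, ∑ i, ∑ j, g i j (X t (e i)) (Y' t (e j)) =
      ((endToEven q e e' (X t) * endToEven q e e' (Y t) - endToEven q e e' (X t * k' * Y t) :
        CliffordAlgebra.even q) : CliffordAlgebra q) := by
    intro t
    have h3 : ∀ i, ∑ j, g i j (X t (e i)) (Y' t (e j)) =
        ∑ j, ι (X t (e i)) * ((h (e' i) (Y t (e j)) : CliffordAlgebra.even q) : CliffordAlgebra q) *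
          ι (e' j) := by
      intro i
      have a1 : ∀ j, Y' t (e j) = ∑ l, b (e j) (Y t (e l)) • e' l := fun j => by
        conv_lhs => rw [← h2 (Y' t (e j))]
        refine Finset.sum_congr rfl fun l _ => ?_
        rw [← hY, hsym]
      have a2 : ∀ j, h (e' i) (Y t (e j)) = ∑ l, b (e l) (Y t (e j)) • h (e' i) (e' l) := fun j => by
        conv_lhs => rw [← h2 (Y t (e j))]
        simp
      simp only [hg, a1, a2, map_sum, map_smul, Finset.mul_sum, Finset.sum_mul, mul_smul_comm,
        smul_mul_assoc, AddSubmonoidClass.coe_finsetSum, SetLike.val_smul]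
      exact Finset.sum_comm
    have h4 : ∀ j, X t (k' (Y t (e j))) = ∑ i, b (e' i) (k' (Y t (e j))) • X t (e i) := fun j => by
      conv_lhs => rw [← h1 (k' (Y t (e j)))]
      simp
    simp only [h3]
    simp only [endToEven_apply, Module.End.mul_apply, h4, h, evenAlt_apply, Finset.sum_mul_sum,
      map_sum, map_smul, LinearMap.sum_apply, LinearMap.smul_apply]
    rw [Finset.sum_comm (f := fun j i => b (e' i) (k' (Y t (e j))) •
      (CliffordAlgebra.even.ι q).bilin (X t (e i)) (e' j))]
    simp only [← Finset.sum_sub_distrib, AddSubmonoidClass.coe_finsetSum]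
    refine Finset.sum_congr rfl fun i _ => Finset.sum_congr rfl fun j _ => ?_
    push_cast
    simp only [coe_even_ι, hkk', mul_sub, sub_mul, mul_assoc, Algebra.algebraMap_eq_smul_one,
      mul_smul_comm, smul_mul_assoc, mul_one, one_mul]
    simp [mul_assoc, ι]
  rw [← sub_eq_zero, ← Finset.sum_sub_distrib]
  refine Subtype.ext ?_
  rw [AddSubmonoidClass.coe_finsetSum]
  simp only [← expand]
  rw [Finset.sum_comm, ZeroMemClass.coe_zero, ← hzero]
  exact Finset.sum_congr rfl fun i _ => Finset.sum_comm

end CliffordLinear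

section BaseChangeRelations

variable {F : Type} [Field F]

theorem partialEval_lTensor {E M N : Type} [AddCommGroup E] [Module F E] [AddCommGroup M]
    [Module F M] [AddCommGroup N] [Module F N] (φ : E →ₗ[F] F) (f : M →ₗ[F] N) (t : E ⊗[F] M) :
    ((TensorProduct.lid F N).toLinearMap.comp (TensorProduct.map φ LinearMap.id)) (f.lTensor E t) =
      f (((TensorProduct.lid F M).toLinearMap.comp (TensorProduct.map φ LinearMap.id)) t) := by
  induction t using TensorProduct.induction_on with
  | zero => simp
  | tmul a b => simp
  | add p q hp hq => simp only [map_add, hp, hq]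

/-- Implications between linear equations are preserved by scalar extension. -/
theorem lTensor_eq_zero_of_forall {E M N L τ : Type} [Ring E] [Algebra F E] [AddCommGroup M]
    [Module F M] [AddCommGroup N] [Module F N] [Ring L] [Algebra F L] (f : τ → M →ₗ[F] N)
    (P : M →ₗ[F] L) (h : ∀ x, (∀ z, f z x = 0) → P x = 0) {t : E ⊗[F] M}
    (ht : ∀ z, (f z).lTensor E t = 0) : P.lTensor E t = 0 := by
  refine eq_zero_of_partialEval fun φ => ?_
  rw [partialEval, partialEval_lTensor]
  refine h _ fun z => ?_
  rw [← partialEval_lTensor, ht, map_zero]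

end BaseChangeRelations

section CliffordPresentation

variable {F : Type} [Field F] {A : Type} [Ring A] [Algebra F A] {T : A →ₗ[F] F} {σ : A →ₗ[F] A}
  {ℓ : A}

theorem sand_tmul (a b x : A) : sand F A (a ⊗ₜ b) x = a * x * b := rfl

variable (T σ ℓ) in
/-- The degree-one map `A → C(A, σ, f)` as a linear map. -/
def cliffLin : A →ₗ[F] CliffordAlg F A T σ ℓ :=
  (RingQuot.mkAlgHom F (CliffordRel F A T σ ℓ)).toLinearMap.comp (TensorAlgebra.ι F)

theorem cliffLin_sym (s : A) (hs : σ s = s) :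
    cliffLin T σ ℓ s = algebraMap F _ (T (ℓ * s)) := by
  have := RingQuot.mkAlgHom_rel F (CliffordRel.sym (F := F) (T := T) (ℓ := ℓ) s hs)
  exact this.trans (AlgHom.commutes _ _)

/-- The product of degree-one elements as a linear map on `A ⊗ A`. -/
def cliffMul (T : A →ₗ[F] F) (σ : A →ₗ[F] A) (ℓ : A) : A ⊗[F] A →ₗ[F] CliffordAlg F A T σ ℓ :=
  TensorProduct.lift ((LinearMap.mul F (CliffordAlg F A T σ ℓ)).compl₁₂ (cliffLin T σ ℓ)
    (cliffLin T σ ℓ))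

theorem cliffMul_tmul (x y : A) :
    cliffMul T σ ℓ (x ⊗ₜ y) = cliffLin T σ ℓ x * cliffLin T σ ℓ y := rfl

theorem cliffMul_eq (c : A ⊗[F] A) (hc : ∀ x : A, sand F A c (σ x) = sand F A c x) :
    cliffMul T σ ℓ c = cliffLin T σ ℓ (sand F A c ℓ) := by
  have h := RingQuot.mkAlgHom_rel F (CliffordRel.deg2 (F := F) (T := T) (ℓ := ℓ) c hc)
  refine Eq.trans ?_ h
  have : cliffMul T σ ℓ = (RingQuot.mkAlgHom F (CliffordRel F A T σ ℓ)).toLinearMap.comp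
      (mu2 F A) := by
    ext x y
    change cliffLin T σ ℓ x * cliffLin T σ ℓ y =
      RingQuot.mkAlgHom F (CliffordRel F A T σ ℓ) (TensorAlgebra.ι F x * TensorAlgebra.ι F y)
    rw [map_mul]
    rfl
  rw [this]
  rfl

theorem cliffordAlg_hom_ext {B : Type} [Ring B] [Algebra F B] {f g : CliffordAlg F A T σ ℓ →ₐ[F] B}
    (h : ∀ a, f (cliffLin T σ ℓ a) = g (cliffLin T σ ℓ a)) : f = g := by
  refine RingQuot.ringQuot_ext' F f g (TensorAlgebra.hom_ext ?_)
  ext a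
  exact h a

/-- The universal property of the Clifford algebra. -/
theorem exists_cliffordAlg_hom {B : Type} [Ring B] [Algebra F B] (φ : A →ₗ[F] B)
    (h1 : ∀ s, σ s = s → φ s = algebraMap F B (T (ℓ * s)))
    (h2 : ∀ (s : Finset (A × A)),
      (∀ x, ∑ t ∈ s, t.1 * σ x * t.2 = ∑ t ∈ s, t.1 * x * t.2) →
      ∑ t ∈ s, φ t.1 * φ t.2 = ∑ t ∈ s, φ (t.1 * ℓ * t.2)) :
    ∃ f : CliffordAlg F A T σ ℓ →ₐ[F] B, ∀ a, f (cliffLin T σ ℓ a) = φ a := by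
  have hrel : ∀ ⦃x y⦄, CliffordRel F A T σ ℓ x y →
      TensorAlgebra.lift F φ x = TensorAlgebra.lift F φ y := by
    intro x y h
    cases h with
    | sym s hs => rw [TensorAlgebra.lift_ι_apply, h1 s hs, AlgHom.commutes]
    | deg2 c hc =>
      obtain ⟨S, rfl⟩ := TensorProduct.exists_finset c
      simp only [map_sum, LinearMap.sum_apply, sand_tmul] at hc ⊢
      refine Eq.trans ?_ ((h2 S hc).trans ?_)
      · refine Finset.sum_congr rfl fun t _ => ?_
        change TensorAlgebra.lift F φ (TensorAlgebra.ι F t.1 * TensorAlgebra.ι F t.2) = _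
        rw [map_mul, TensorAlgebra.lift_ι_apply, TensorAlgebra.lift_ι_apply]
      · simp only [TensorAlgebra.lift_ι_apply]
  refine ⟨RingQuot.liftAlgHom F ⟨TensorAlgebra.lift F φ, hrel⟩, fun a => ?_⟩
  change RingQuot.liftAlgHom F _ (RingQuot.mkAlgHom F _ (TensorAlgebra.ι F a)) = _
  rw [RingQuot.liftAlgHom_mkAlgHom_apply, TensorAlgebra.lift_ι_apply]

variable {E : Type} [Field E] [Algebra F E]

theorem baseChange_sym {κ : A} (hTκ : ∀ s, σ s = s → T (ℓ * s) = T (κ * s)) {t : E ⊗[F] A}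
    (ht : σ.lTensor E t = t) :
    (cliffLin T σ ℓ).lTensor E t =
      (((Algebra.linearMap F (CliffordAlg F A T σ ℓ)).comp T).comp
        (LinearMap.mulLeft F κ)).lTensor E t := by
  rw [← sub_eq_zero, ← LinearMap.sub_apply, ← LinearMap.lTensor_sub]
  refine lTensor_eq_zero_of_forall (τ := Unit) (fun _ => σ - LinearMap.id) _ (fun x hx => ?_)
    fun _ => ?_
  · have hx := sub_eq_zero.1 (hx ())
    simp only [LinearMap.id_apply] at hx
    rw [LinearMap.sub_apply, cliffLin_sym x hx, hTκ x hx]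
    exact sub_self _
  · rw [LinearMap.lTensor_sub, LinearMap.sub_apply, ht, LinearMap.lTensor_id]
    exact sub_self _

theorem baseChange_mul {κ z : A} (hz : ℓ - κ = z - σ z) (t t' : E ⊗[F] A)
    (htt : ∀ y : A, t * ((1 : E) ⊗ₜ σ y) * t' = t * ((1 : E) ⊗ₜ y) * t') :
    (cliffLin T σ ℓ).lTensor E t * (cliffLin T σ ℓ).lTensor E t' =
      (cliffLin T σ ℓ).lTensor E (t * ((1 : E) ⊗ₜ κ) * t') := by
  obtain ⟨S, hS⟩ := TensorProduct.exists_finset t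
  obtain ⟨S', hS'⟩ := TensorProduct.exists_finset t'
  let c : E ⊗[F] (A ⊗[F] A) := ∑ p ∈ S, ∑ p' ∈ S', (p.1 * p'.1) ⊗ₜ (p.2 ⊗ₜ p'.2)
  have hc1 : ∀ y, ((sand F A).flip y).lTensor E c = t * ((1 : E) ⊗ₜ y) * t' := by
    intro y
    simp only [c, hS, hS', map_sum, LinearMap.lTensor_tmul, Finset.sum_mul, Finset.mul_sum,
      Algebra.TensorProduct.tmul_mul_tmul, mul_one, LinearMap.flip_apply, sand_tmul]
    rw [Finset.sum_comm]
  have hc2 : (cliffMul T σ ℓ).lTensor E c =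
      (cliffLin T σ ℓ).lTensor E t * (cliffLin T σ ℓ).lTensor E t' := by
    simp only [c, hS, hS', map_sum, LinearMap.lTensor_tmul, Finset.sum_mul_sum,
      Algebra.TensorProduct.tmul_mul_tmul, cliffMul_tmul]
  have hc3 : ((cliffLin T σ ℓ).comp ((sand F A).flip ℓ)).lTensor E c =
      (cliffLin T σ ℓ).lTensor E (t * ((1 : E) ⊗ₜ κ) * t') := by
    rw [LinearMap.lTensor_comp, LinearMap.comp_apply, hc1]
    congr 1
    rw [← sub_eq_zero, ← sub_mul, ← mul_sub, ← TensorProduct.tmul_sub, hz, TensorProduct.tmul_sub,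
      mul_sub, sub_mul, htt, sub_self]
  rw [← hc2, ← hc3, ← sub_eq_zero, ← LinearMap.sub_apply, ← LinearMap.lTensor_sub]
  refine lTensor_eq_zero_of_forall (fun y : A => (sand F A).flip (σ y) - (sand F A).flip y) _
    (fun x hx => ?_) fun y => ?_
  · rw [LinearMap.sub_apply, cliffMul_eq x fun y => sub_eq_zero.1 (hx y)]
    exact sub_self _
  · rw [LinearMap.lTensor_sub, LinearMap.sub_apply, hc1, hc1, htt, sub_self]

end CliffordPresentation

section CliffordSplit

variable {F : Type} [Field F] {A : Type} [Ring A] [Algebra F A] {T : A →ₗ[F] F} {σ : A →ₗ[F] A}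
  {ℓ : A} {E : Type} [Field E] [Algebra F E]
variable {V : Type} [AddCommGroup V] [Module E V] [Module F V] [IsScalarTower F E V]
  [SMulCommClass E F V]

/-- The scalar extension of a representation `A → End_E(V)`. -/
def extRep (ρ : A →ₐ[F] Module.End E V) : E ⊗[F] A →ₐ[E] Module.End E V :=
  Algebra.TensorProduct.lift (Algebra.ofId E _) ρ fun c x => Algebra.commutes c (ρ x)

theorem extRep_tmul (ρ : A →ₐ[F] Module.End E V) (c : E) (x : A) :
    extRep ρ (c ⊗ₜ x) = c • ρ x := by
  refine (Algebra.TensorProduct.lift_tmul _ _ _ _ _).trans ?_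
  rw [Algebra.smul_def]
  rfl

theorem extRep_adjoint {ρ : A →ₐ[F] Module.End E V} {b : LinearMap.BilinForm E V}
    (hadj : ∀ x v w, b (ρ x v) w = b v (ρ (σ x) w)) (t : E ⊗[F] A) (v w : V) :
    b (extRep ρ t v) w = b v (extRep ρ (σ.lTensor E t) w) := by
  induction t using TensorProduct.induction_on with
  | zero => simp
  | tmul c x => simp [extRep_tmul, hadj]
  | add p q hp hq => simp only [map_add, LinearMap.add_apply, hp, hq]

theorem clifford_baseChange_equiv [Module.Finite E V] {ρ : A →ₐ[F] Module.End E V}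
    (hρ : Function.Bijective (extRep ρ)) {b : LinearMap.BilinForm E V}
    (hb : ∀ v, (∀ w, b v w = 0) → v = 0) (hsym : ∀ x y, b x y = b y x)
    (hσ : ∀ x, σ (σ x) = x)
    (hadj : ∀ x v w, b (ρ x v) w = b v (ρ (σ x) w))
    (htr : ∀ x, algebraMap F E (T x) = LinearMap.trace E V (ρ x))
    (q : QuadraticForm E V) {κ : A} (hq : ∀ v, q v = b v (ρ κ v))
    (hTκ : ∀ s, σ s = s → T (ℓ * s) = T (κ * s)) {z : A} (hz : ℓ - κ = z - σ z) :
    Nonempty (E ⊗[F] CliffordAlg F A T σ ℓ ≃ₐ[E] CliffordAlgebra.even q) := by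
  have hnd : b.Nondegenerate := ⟨hb, fun v h => hb v fun w => by rw [hsym, h]⟩
  obtain ⟨n, e, e', h1, h2⟩ := exists_dual_families b hnd hsym
  have hkq : ∀ v, q v = b (ρ κ v) v := fun v => by rw [hq, hsym]
  let R := AlgEquiv.ofBijective (extRep ρ) hρ
  have hR : ∀ t, R t = extRep ρ t := fun _ => rfl
  have hR1 : ∀ x, R ((1 : E) ⊗ₜ x) = ρ x := fun x => by rw [hR, extRep_tmul, one_smul]
  have hadjR : ∀ t v w, b (R t v) w = b v (R (σ.lTensor E t) w) := extRep_adjoint hadj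
  have hflip : ∀ t v w, R t = rankOne b v w → R (σ.lTensor E t) = rankOne b w v := by
    intro t v w h
    ext x
    refine sub_eq_zero.1 (hb _ fun y => ?_)
    rw [map_sub, LinearMap.sub_apply, sub_eq_zero, hsym, ← hadjR, h]
    simp [hsym w, mul_comm]
  obtain ⟨Φ, hΦ⟩ := exists_cliffordAlg_hom (T := T) (σ := σ) (ℓ := ℓ)
    (B := CliffordAlgebra.even q)
    (((endToEven q e e').restrictScalars F).comp ρ.toLinearMap) (by
      intro s hs
      change endToEven q e e' (ρ s) = _
      rw [endToEven_self_adjoint q (ρ κ) hsym h1 h2 hkq (ρ s)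
        (fun x y => by rw [hadj, hs]), ← map_mul, ← htr, hTκ s hs]
      exact (IsScalarTower.algebraMap_apply F E _ _).symm) (by
      intro s hs
      change ∑ t ∈ s, endToEven q e e' (ρ t.1) * endToEven q e e' (ρ t.2) =
        ∑ t ∈ s, endToEven q e e' (ρ (t.1 * ℓ * t.2))
      have hs' : ∀ t, ∑ p ∈ s, ρ p.1 * R (σ.lTensor E t) * ρ p.2 =
          ∑ p ∈ s, ρ p.1 * R t * ρ p.2 := by
        intro t
        induction t using TensorProduct.induction_on with
        | zero => simp
        | tmul c x =>
          have := congrArg (fun y => c • ρ y) (hs x)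
          simpa [hR, extRep_tmul, Finset.smul_sum] using this
        | add p q hp hq => simp only [map_add, mul_add, add_mul, Finset.sum_add_distrib, hp, hq]
      rw [endToEven_sandwich q (ρ κ) hsym h1 h2 hkq (k' := ρ (σ κ)) (hadj κ) s
        (fun p => ρ p.1) (fun p => ρ p.2) (fun p => ρ (σ p.2)) (fun p => hadj p.2)]
      · rw [← map_sum, ← map_sum]
        congr 1
        simp only [← map_mul, ← map_sum]
        congr 1
        rw [hs κ, ← sub_eq_zero, ← Finset.sum_sub_distrib]
        have : ∀ p : A × A, p.1 * κ * p.2 - p.1 * ℓ * p.2 =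
            p.1 * σ z * p.2 - p.1 * z * p.2 := fun p => by
          rw [← sub_mul, ← sub_mul, ← mul_sub, ← mul_sub, ← neg_sub, hz, neg_sub]
        simp only [this]
        rw [Finset.sum_sub_distrib, hs z, sub_self]
      · intro v w
        obtain ⟨t, ht⟩ := R.surjective (rankOne b v w)
        rw [← ht, ← hflip t v w ht, hs'])
  have hΦ : ∀ a, Φ (cliffLin T σ ℓ a) = endToEven q e e' (ρ a) := hΦ
  let ΦE : E ⊗[F] CliffordAlg F A T σ ℓ →ₐ[E] CliffordAlgebra.even q :=
    Algebra.TensorProduct.lift (Algebra.ofId E _) Φ fun c x => Algebra.commutes c (Φ x)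
  have hΦE : ∀ t, ΦE ((cliffLin T σ ℓ).lTensor E t) = endToEven q e e' (R t) := by
    intro t
    induction t using TensorProduct.induction_on with
    | zero => simp
    | tmul c x =>
      rw [LinearMap.lTensor_tmul, hR, extRep_tmul, map_smul, ← hΦ, Algebra.smul_def]
      exact Algebra.TensorProduct.lift_tmul _ _ _ _ _
    | add p q hp hq => simp only [map_add, hp, hq]
  let cE : Module.End E V →ₗ[E] E ⊗[F] CliffordAlg F A T σ ℓ :=
    ((cliffLin T σ ℓ).baseChange E).comp R.symm.toLinearMap
  have hcE : ∀ X, cE X = (cliffLin T σ ℓ).lTensor E (R.symm X) := fun _ => rfl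
  have htrace : ∀ t, ((((Algebra.linearMap F (CliffordAlg F A T σ ℓ)).comp T).comp
        (LinearMap.mulLeft F κ)).lTensor E t) =
      algebraMap E _ (LinearMap.trace E V (ρ κ * R t)) := by
    intro t
    induction t using TensorProduct.induction_on with
    | zero => simp
    | tmul c x =>
      rw [LinearMap.lTensor_tmul, hR, extRep_tmul, mul_smul_comm, ← map_mul, map_smul, ← htr,
        Algebra.TensorProduct.algebraMap_apply]
      change c ⊗ₜ[F] (algebraMap F (CliffordAlg F A T σ ℓ) (T (κ * x))) = _
      rw [Algebra.algebraMap_eq_smul_one, ← TensorProduct.smul_tmul, Algebra.smul_def, mul_comm]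
      rfl
    | add p q hp hq => simp only [map_add, hp, hq, mul_add]
  let ev : CliffordAlgebra.EvenHom q (E ⊗[F] CliffordAlg F A T σ ℓ) :=
    { bilin := (rankOne b).compr₂ cE
      contract := fun v => by
        change cE (rankOne b v v) = _
        have hs : σ.lTensor E (R.symm (rankOne b v v)) = R.symm (rankOne b v v) :=
          R.injective (by rw [hflip _ v v (R.apply_symm_apply _), R.apply_symm_apply])
        rw [hcE, baseChange_sym hTκ hs, htrace, R.apply_symm_apply, trace_eq_sum h1]
        congr 1
        rw [hkq]
        have h := congrArg (b (ρ κ v)) (h2 v)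
        simp only [map_sum, map_smul, smul_eq_mul] at h
        simp only [Module.End.mul_apply, rankOne_apply, map_smul, LinearMap.smul_apply,
          smul_eq_mul, ← h, hsym (e _), hsym (e' _)]
      contract_mid := fun v w x => by
        change cE (rankOne b v w) * cE (rankOne b w x) = q w • cE (rankOne b v x)
        rw [hcE, hcE, baseChange_mul hz, ← map_smul, hcE]
        · congr 1
          apply R.injective
          rw [map_mul, map_mul, R.apply_symm_apply, R.apply_symm_apply, R.apply_symm_apply, hR1]
          ext y
          simp only [Module.End.mul_apply, rankOne_apply, map_smul, LinearMap.smul_apply, hq,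
            smul_smul, mul_comm]
        · intro y
          apply R.injective
          simp only [map_mul, R.apply_symm_apply, hR1]
          ext y'
          simp only [Module.End.mul_apply, rankOne_apply, map_smul]
          congr 2
          rw [hsym, hadj, hσ] }
  let Ψ := CliffordAlgebra.even.lift q ev
  have hΨ : ∀ v w, Ψ ((CliffordAlgebra.even.ι q).bilin v w) = cE (rankOne b v w) :=
    fun v w => CliffordAlgebra.even.lift_ι q ev v w
  have hΨE : ∀ X, Ψ (endToEven q e e' X) = cE X := by
    intro X
    rw [endToEven_apply, map_sum]
    simp only [hΨ]
    rw [← map_sum, sum_rankOne h1]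
  refine ⟨AlgEquiv.ofAlgHom ΦE Ψ ?_ ?_⟩
  · refine CliffordAlgebra.even.algHom_ext q ?_
    ext v w
    change ((ΦE (Ψ ((CliffordAlgebra.even.ι q).bilin v w)) : CliffordAlgebra.even q) :
      CliffordAlgebra q) = _
    rw [hΨ, hcE, hΦE, R.apply_symm_apply, endToEven_rankOne q hsym h2]
    rfl
  · refine Algebra.TensorProduct.ext (Subsingleton.elim _ _) (cliffordAlg_hom_ext fun a => ?_)
    change Ψ (ΦE ((cliffLin T σ ℓ).lTensor E ((1 : E) ⊗ₜ a))) = (1 : E) ⊗ₜ cliffLin T σ ℓ a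
    rw [hΦE, hΨE, hcE, R.symm_apply_apply]
    rfl

end CliffordSplit

section QuadraticExtensionModel

variable {F : Type} [Field F] {K : Type} [CommRing K] [Algebra F K]

theorem quadratic_generator_span (hK2 : finrank F K = 2) {u : K}
    (hugen : u ∉ Set.range (algebraMap F K)) (x : K) :
    ∃ r s : F, x = algebraMap F K r + s • u := by
  have hnt : Nontrivial K := nontrivial_of_finrank_pos (R := F) (by omega)
  have hfin : Module.Finite F K := Module.finite_of_finrank_pos (by omega)
  have hli : LinearIndependent F ![(1 : K), u] := by
    rw [LinearIndependent.pair_iff]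
    intro s t h
    have ht : t = 0 := by
      by_contra ht
      refine hugen ⟨-(t⁻¹ * s), ?_⟩
      have h2 := congrArg (t⁻¹ • ·) h
      simp only [smul_add, smul_smul, inv_mul_cancel₀ ht, one_smul, smul_zero] at h2
      rw [map_neg, Algebra.algebraMap_eq_smul_one]
      exact neg_eq_of_add_eq_zero_right h2
    rw [ht, zero_smul, add_zero] at h
    exact ⟨(smul_eq_zero.1 h).resolve_right one_ne_zero, ht⟩
  have hspan := hli.span_eq_top_of_card_eq_finrank (by simp [hK2])
  have hx : x ∈ Submodule.span F (Set.range ![(1 : K), u]) := hspan ▸ Submodule.mem_top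
  rw [Matrix.range_cons, Matrix.range_cons, Matrix.range_empty, Set.union_empty,
    Set.singleton_union, Submodule.mem_span_pair] at hx
  obtain ⟨r, s, h⟩ := hx
  exact ⟨r, s, by rw [← h, Algebra.algebraMap_eq_smul_one]⟩

variable {E : Type} [Field E] [Algebra F E]

theorem tensor_generator_span (hK2 : finrank F K = 2) {u : K}
    (hugen : u ∉ Set.range (algebraMap F K)) (x : E ⊗[F] K) :
    ∃ r s : E, x = algebraMap E (E ⊗[F] K) r + s • ((1 : E) ⊗ₜ u) := by
  induction x using TensorProduct.induction_on with
  | zero => exact ⟨0, 0, by simp⟩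
  | tmul c y =>
    obtain ⟨r, s, rfl⟩ := quadratic_generator_span hK2 hugen y
    refine ⟨c * algebraMap F E r, c * algebraMap F E s, ?_⟩
    rw [TensorProduct.tmul_add, Algebra.TensorProduct.algebraMap_apply, TensorProduct.smul_tmul',
      Algebra.algebraMap_eq_smul_one, ← TensorProduct.smul_tmul, ← TensorProduct.smul_tmul]
    simp [Algebra.smul_def, mul_comm]
  | add p q hp hq =>
    obtain ⟨r, s, rfl⟩ := hp
    obtain ⟨r', s', rfl⟩ := hq
    exact ⟨r + r', s + s', by rw [map_add, add_smul]; abel⟩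

theorem exists_quadraticAlgebra_equiv (hK2 : finrank F K = 2) {u : K} {a : F}
    (hu : u * u = u + algebraMap F K a) (hugen : u ∉ Set.range (algebraMap F K))
    (ι : K ≃ₐ[F] K) (hι : ι u = 1 - u) :
    ∃ θ : QuadraticAlgebra E (algebraMap F E a) 1 ≃ₐ[E] E ⊗[F] K,
      ∀ x, θ (star x) = Algebra.TensorProduct.map (AlgHom.id E E) ι.toAlgHom (θ x) := by
  have hfin : Module.Finite F K := Module.finite_of_finrank_pos (by omega)
  have hw : ((1 : E) ⊗ₜ[F] u) * ((1 : E) ⊗ₜ u) = algebraMap F E a • 1 + (1 : E) • ((1 : E) ⊗ₜ u) := by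
    rw [Algebra.TensorProduct.tmul_mul_tmul, hu, TensorProduct.tmul_add, mul_one, one_smul,
      add_comm, Algebra.algebraMap_eq_smul_one, ← TensorProduct.smul_tmul,
      Algebra.TensorProduct.one_def, TensorProduct.smul_tmul', Algebra.smul_def, mul_one,
      smul_eq_mul, mul_one]
  let f : QuadraticAlgebra E (algebraMap F E a) 1 →ₐ[E] E ⊗[F] K := QuadraticAlgebra.lift ⟨_, hw⟩
  have hf : ∀ x, f x = algebraMap E _ x.re + x.im • ((1 : E) ⊗ₜ u) := fun x => by
    simp only [Algebra.algebraMap_eq_smul_one (A := E ⊗[F] K)]; rfl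
  have hbij : Function.Bijective f := by
    have hsurj : Function.Surjective f := fun x => by
      obtain ⟨r, s, rfl⟩ := tensor_generator_span hK2 hugen x
      exact ⟨⟨r, s⟩, hf _⟩
    refine ⟨?_, hsurj⟩
    have : finrank E (QuadraticAlgebra E (algebraMap F E a) 1) = finrank E (E ⊗[F] K) := by
      rw [QuadraticAlgebra.finrank_eq_two, Module.finrank_baseChange, hK2]
    exact (LinearMap.injective_iff_surjective_of_finrank_eq_finrank (f := f.toLinearMap) this).2
      hsurj
  refine ⟨AlgEquiv.ofBijective f hbij, fun x => ?_⟩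
  change f (star x) = Algebra.TensorProduct.map (AlgHom.id E E) ι.toAlgHom (f x)
  rw [hf, hf, map_add, map_smul, AlgHom.commutes, Algebra.TensorProduct.map_tmul]
  change _ = _ + x.im • ((1 : E) ⊗ₜ[F] (ι u))
  rw [hι, TensorProduct.tmul_sub, ← Algebra.TensorProduct.one_def, QuadraticAlgebra.re_star,
    QuadraticAlgebra.im_star]
  simp only [Algebra.algebraMap_eq_smul_one]
  module

end QuadraticExtensionModel

section MatrixModel

variable {E : Type} [Field E] {a : E} {m : ℕ}

/-- The matrix of an endomorphism of a free module over a quadratic algebra. -/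
def quadMatrix : Module.End E (Fin m → QuadraticAlgebra E a 1) →ₗ[E]
    Matrix (Fin m) (Fin m) (QuadraticAlgebra E a 1) where
  toFun X := Matrix.of fun i k => X (Pi.single k 1) i
  map_add' _ _ := rfl
  map_smul' _ _ := rfl

theorem quadMatrix_apply (X : Module.End E (Fin m → QuadraticAlgebra E a 1)) (i k : Fin m) :
    quadMatrix X i k = X (Pi.single k 1) i := rfl

theorem quad_linear_of_commute {X : Module.End E (Fin m → QuadraticAlgebra E a 1)}
    (hX : ∀ f, X (fun i => QuadraticAlgebra.omega * f i) = fun i => QuadraticAlgebra.omega * X f i)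
    (r : QuadraticAlgebra E a 1) (f : Fin m → QuadraticAlgebra E a 1) :
    X (r • f) = r • X f := by
  have h : ∀ g : Fin m → QuadraticAlgebra E a 1,
      r • g = r.re • g + r.im • fun i => QuadraticAlgebra.omega * g i := by
    intro g
    ext i <;> simp <;> ring
  rw [h, h, map_add, map_smul, map_smul, hX]

theorem eq_mulVec_of_commute {X : Module.End E (Fin m → QuadraticAlgebra E a 1)}
    (hX : ∀ f, X (fun i => QuadraticAlgebra.omega * f i) = fun i => QuadraticAlgebra.omega * X f i)
    (f : Fin m → QuadraticAlgebra E a 1) : X f = (quadMatrix X).mulVec f := by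
  conv_lhs => rw [pi_eq_sum_univ' f]
  rw [map_sum]
  simp only [quad_linear_of_commute hX]
  ext i : 1
  simp only [Finset.sum_apply, Pi.smul_apply, smul_eq_mul, Matrix.mulVec, dotProduct,
    quadMatrix_apply]
  refine Finset.sum_congr rfl fun k _ => ?_
  rw [mul_comm]

theorem quadMatrix_mul {X Y : Module.End E (Fin m → QuadraticAlgebra E a 1)}
    (hX : ∀ f, X (fun i => QuadraticAlgebra.omega * f i) = fun i => QuadraticAlgebra.omega * X f i) :
    quadMatrix (X * Y) = quadMatrix X * quadMatrix Y := by
  refine Matrix.ext fun i k => ?_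
  rw [quadMatrix_apply, Module.End.mul_apply, eq_mulVec_of_commute hX]
  rfl

theorem quadMatrix_one :
    quadMatrix (1 : Module.End E (Fin m → QuadraticAlgebra E a 1)) = 1 := by
  refine Matrix.ext fun i k => ?_
  rw [quadMatrix_apply, Module.End.one_apply, Matrix.one_apply, Pi.single_apply]

theorem quadMatrix_adjoint (ha : 1 + 4 * a ≠ 0) {α : Fin m → E} (hα : ∀ i, α i ≠ 0)
    {X Y : Module.End E (Fin m → QuadraticAlgebra E a 1)}
    (hY : ∀ f, Y (fun i => QuadraticAlgebra.omega * f i) = fun i => QuadraticAlgebra.omega * Y f i)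
    (hXY : ∀ f g, hermTrace α (X f) g = hermTrace α f (Y g)) (k i : Fin m) :
    quadMatrix Y k i = (α k)⁻¹ • (α i • star (quadMatrix X i k)) := by
  have key : ∀ r : QuadraticAlgebra E a 1,
      α i * QuadraticAlgebra.trace (star (quadMatrix X i k) * r) =
        α k * QuadraticAlgebra.trace (quadMatrix Y k i * r) := by
    intro r
    have h := hXY (Pi.single k 1) (r • (Pi.single i 1 : Fin m → QuadraticAlgebra E a 1))
    rw [quad_linear_of_commute hY] at h
    simp only [hermTrace] at h
    rw [Finset.sum_eq_single i, Finset.sum_eq_single k] at h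
    · simpa [quadMatrix_apply, mul_comm r] using h
    · intro j _ hj; simp [hj]
    · simp
    · intro j _ hj; simp [hj]
    · simp
  have h0 : (fun _ : Fin 1 => star (α k • quadMatrix Y k i - α i • star (quadMatrix X i k))) = 0 := by
    refine hermTrace_nondegenerate ha (α := fun _ => 1) (fun _ => one_ne_zero) _ fun g => ?_
    have := key (g 0)
    simp only [hermTrace, Fin.sum_univ_one, one_mul, star_star, sub_mul, smul_mul_assoc, map_sub,
      map_smul, smul_eq_mul, this, sub_self]
  have h1 := congrFun h0 0
  simp only [Pi.zero_apply, star_eq_zero] at h1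
  rw [← sub_eq_zero.1 h1, smul_smul, inv_mul_cancel₀ (hα k), one_smul]

end MatrixModel

section AdjointModel

variable {F : Type} [Field F] {A C : Type} [Ring A] [Algebra F A] [Ring C] [Algebra F C]

theorem mem_range_of_commute {E : Type} [Field E] [Algebra F E] (j : C →ₐ[F] A)
    (hj : Function.Injective j) {κ : A} (hr : Set.range (j : C → A) = Set.centralizer {κ})
    {t : E ⊗[F] A} (ht : t * ((1 : E) ⊗ₜ κ) = ((1 : E) ⊗ₜ κ) * t) :
    ∃ s : E ⊗[F] C, j.toLinearMap.lTensor E s = t := by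
  obtain ⟨r, hr'⟩ := j.toLinearMap.exists_leftInverse_of_injective (LinearMap.ker_eq_bot.2 hj)
  have hr' : ∀ c, r (j c) = c := fun c => LinearMap.congr_fun hr' c
  refine ⟨r.lTensor E t, ?_⟩
  have h : ∀ t : E ⊗[F] A, (LinearMap.mulRight F κ - LinearMap.mulLeft F κ).lTensor E t =
      t * ((1 : E) ⊗ₜ κ) - ((1 : E) ⊗ₜ κ) * t := by
    intro t
    rw [LinearMap.lTensor_sub, LinearMap.sub_apply]
    induction t using TensorProduct.induction_on with
    | zero => simp
    | tmul c x => simp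
    | add p q hp hq =>
      rw [map_add, map_add, add_sub_add_comm, hp, hq]; noncomm_ring
  have := lTensor_eq_zero_of_forall (τ := Unit)
    (fun _ => LinearMap.mulRight F κ - LinearMap.mulLeft F κ)
    (j.toLinearMap.comp r - LinearMap.id) (fun x hx => ?_) (t := t)
    (fun _ => by rw [h, ht, sub_self])
  · rw [LinearMap.lTensor_sub, LinearMap.sub_apply, LinearMap.lTensor_id, LinearMap.lTensor_comp]
      at this
    exact sub_eq_zero.1 this
  · have hx : x ∈ Set.centralizer {κ} := by
      intro y hy
      rw [Set.mem_singleton_iff.1 hy]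
      exact (sub_eq_zero.1 (hx ())).symm
    rw [← hr] at hx
    obtain ⟨c, rfl⟩ := hx
    simp [hr']

variable {E : Type} [Field E] [Algebra F E] {a : F} {m : ℕ}

theorem exists_adjoint_model {K : Type} [CommRing K] [Algebra F K] (hK2 : finrank F K = 2) {u : K}
    (hu : u * u = u + algebraMap F K a) (hugen : u ∉ Set.range (algebraMap F K))
    (ha : 1 + 4 * a ≠ 0) (ι : K ≃ₐ[F] K) (hι : ι u = 1 - u)
    (j : C →ₐ[F] A) (hj : Function.Injective j) {κ : A}
    (hr : Set.range (j : C → A) = Set.centralizer {κ}) {σ : A →ₗ[F] A} {σC : C →ₗ[F] C}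
    (hσj : ∀ x, σ (j x) = j (σC x)) {α : Fin m → E} (hα : ∀ i, α i ≠ 0)
    (ρ : A →ₐ[F] Module.End E (Fin m → QuadraticAlgebra E (algebraMap F E a) 1))
    (hκ : ∀ f, ρ κ f = fun i => QuadraticAlgebra.omega * f i)
    (hadj : ∀ x f g, hermTrace α (ρ x f) g = hermTrace α f (ρ (σ x) g))
    (hρ : Function.Bijective (extRep (E := E) ρ)) :
    ∃ ψ : E ⊗[F] C ≃ₐ[E] Matrix (Fin m) (Fin m) (E ⊗[F] K), ∀ x : C,
      ψ ((1 : E) ⊗ₜ[F] σC x) =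
        Matrix.diagonal (fun i => algebraMap E (E ⊗[F] K) (α i)⁻¹) *
          Matrix.transpose ((ψ ((1 : E) ⊗ₜ[F] x)).map
            (Algebra.TensorProduct.map (AlgHom.id E E) ι.toAlgHom)) *
          Matrix.diagonal (fun i => algebraMap E (E ⊗[F] K) (α i)) := by
  obtain ⟨θ, hθ⟩ := exists_quadraticAlgebra_equiv (E := E) hK2 hu hugen ι hι
  have hcomm : ∀ x : C, j x * κ = κ * j x := fun x => by
    have : j x ∈ Set.centralizer {κ} := hr ▸ ⟨x, rfl⟩
    exact (this κ rfl).symm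
  have hlin : ∀ t : E ⊗[F] C, ∀ f, extRep (E := E) ρ (j.toLinearMap.lTensor E t)
      (fun i => QuadraticAlgebra.omega * f i) =
      fun i => QuadraticAlgebra.omega * extRep (E := E) ρ (j.toLinearMap.lTensor E t) f i := by
    intro t f
    rw [← hκ, ← hκ]
    induction t using TensorProduct.induction_on with
    | zero => simp
    | tmul c x =>
      have := congrArg (fun y => c • ρ y f) (hcomm x)
      simpa [extRep_tmul] using this
    | add p q hp hq => simp only [map_add, LinearMap.add_apply, hp, hq]
  have hmul : ∀ s t : E ⊗[F] C, j.toLinearMap.lTensor E (s * t) =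
      j.toLinearMap.lTensor E s * j.toLinearMap.lTensor E t :=
    fun s t => map_mul (Algebra.TensorProduct.map (AlgHom.id F E) j) s t
  let g : E ⊗[F] C →ₐ[E] Matrix (Fin m) (Fin m) (QuadraticAlgebra E (algebraMap F E a) 1) :=
    AlgHom.ofLinearMap
      (quadMatrix.comp ((extRep ρ).toLinearMap.comp (j.toLinearMap.baseChange E)))
      (by
        change quadMatrix (extRep ρ ((1 : E) ⊗ₜ j 1)) = 1
        rw [map_one j, ← Algebra.TensorProduct.one_def, map_one, quadMatrix_one])
      (fun s t => by
        change quadMatrix (extRep ρ (j.toLinearMap.lTensor E (s * t))) = _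
        rw [hmul, map_mul, quadMatrix_mul (hlin s)]
        rfl)
  have hg : ∀ t, g t = quadMatrix (extRep ρ (j.toLinearMap.lTensor E t)) := fun _ => rfl
  have hginj : Function.Injective g := by
    rw [injective_iff_map_eq_zero]
    intro t ht
    have h0 : extRep (E := E) ρ (j.toLinearMap.lTensor E t) = 0 := by
      refine LinearMap.ext fun f => ?_
      rw [eq_mulVec_of_commute (hlin t), ← hg, ht, Matrix.zero_mulVec, LinearMap.zero_apply]
    have h1 := hρ.1 (h0.trans (map_zero _).symm)
    exact Module.Flat.lTensor_preserves_injective_linearMap j.toLinearMap hj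
      (h1.trans (map_zero _).symm)
  have hgsurj : Function.Surjective g := by
    intro M
    let X : Module.End E (Fin m → QuadraticAlgebra E (algebraMap F E a) 1) :=
      (Matrix.mulVecLin M).restrictScalars E
    have hX : ∀ f, X f = M.mulVec f := fun _ => rfl
    obtain ⟨t, ht⟩ := hρ.2 X
    obtain ⟨s, rfl⟩ := mem_range_of_commute j hj hr (t := t) (by
      apply hρ.1
      rw [map_mul, map_mul, ht, extRep_tmul, one_smul]
      refine LinearMap.ext fun f => ?_
      rw [Module.End.mul_apply, Module.End.mul_apply, hκ, hκ, hX, hX]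
      exact Matrix.mulVec_smul M
        (QuadraticAlgebra.omega : QuadraticAlgebra E (algebraMap F E a) 1) f)
    refine ⟨s, ?_⟩
    rw [hg, ht]
    refine Matrix.ext fun i k => ?_
    rw [quadMatrix_apply, hX, Matrix.mulVec_single_one]
    rfl
  have hone : ∀ x : C, g ((1 : E) ⊗ₜ x) = quadMatrix (ρ (j x)) := fun x => by
    rw [hg, LinearMap.lTensor_tmul, extRep_tmul, one_smul]; rfl
  refine ⟨(AlgEquiv.ofBijective g ⟨hginj, hgsurj⟩).trans θ.mapMatrix, fun x => ?_⟩
  change (g ((1 : E) ⊗ₜ σC x)).map θ = Matrix.diagonal _ *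
    (((g ((1 : E) ⊗ₜ x)).map θ).map _).transpose * Matrix.diagonal _
  refine Matrix.ext fun k i => ?_
  rw [Matrix.mul_diagonal, Matrix.diagonal_mul, Matrix.transpose_apply, Matrix.map_apply,
    Matrix.map_apply, Matrix.map_apply, ← hθ, hone, hone,
    quadMatrix_adjoint (X := ρ (j x))
      (by have := (map_ne_zero (algebraMap F E)).2 ha
          rwa [map_add, map_mul, map_one, map_ofNat] at this) hα
      (fun f => ?_) (fun f g => by rw [hadj, hσj]), map_smul, map_smul, Algebra.smul_def,
      Algebra.smul_def]
  · ring
  · have := hlin ((1 : E) ⊗ₜ σC x) f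
    simpa [extRep_tmul] using this

end AdjointModel

section KeyFact

variable {F : Type} [Field F] {K : Type} [CommRing K] [Algebra F K]

theorem quadratic_isField (hK2 : finrank F K = 2) {u : K} {a : F}
    (hu : u * u = u + algebraMap F K a) (hugen : u ∉ Set.range (algebraMap F K))
    (hroot : ¬ ∃ r : F, r * r = r + a) : IsField K := by
  have : Nontrivial K := Module.nontrivial_of_finrank_pos (R := F) (by omega)
  refine ⟨exists_pair_ne K, mul_comm, fun {x} hx => ?_⟩
  obtain ⟨r, s, rfl⟩ := quadratic_generator_span hK2 hugen x
  have hN : r * r + r * s - s * s * a ≠ 0 := by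
    intro h0
    by_cases hs : s = 0
    · subst hs
      have : r = 0 := by simpa using h0
      exact hx (by simp [this])
    · refine hroot ⟨-r / s, ?_⟩
      field_simp
      linear_combination h0
  refine ⟨algebraMap F K (r * r + r * s - s * s * a)⁻¹ *
    (algebraMap F K (r + s) - s • u), ?_⟩
  have h1 : algebraMap F K (r * r + r * s - s * s * a)⁻¹ *
      algebraMap F K (r * r + r * s - s * s * a) = 1 := by
    rw [← map_mul, inv_mul_cancel₀ hN, map_one]
  simp only [map_add, map_sub, map_mul] at h1
  rw [Algebra.smul_def, map_add]
  linear_combination h1 - algebraMap F K (r * r + r * s - s * s * a)⁻¹ *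
    algebraMap F K s * algebraMap F K s * hu

theorem finrank_of_isField {C : Type} [Ring C] [Algebra F C] [Algebra K C] [IsScalarTower F K C]
    (hK : IsField K) : finrank F K * finrank K C = finrank F C := by
  let := hK.toField
  exact Module.finrank_mul_finrank F K C

end KeyFact

section KeyTheorem

variable {F : Type} [Field F] {K : Type} [CommRing K] [Algebra F K]
  {C : Type} [Ring C] [Algebra F C] [Algebra K C] [IsScalarTower F K C]
  {A : Type} [Ring A] [Algebra F A] {D : Type} [Ring D] [Algebra F D]

theorem exists_clifford_split (hK2 : finrank F K = 2)
    {u : K} {a : F} (hu : u * u = u + algebraMap F K a)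
    (hugen : u ∉ Set.range (algebraMap F K)) (ha : (1 : F) + 4 * a ≠ 0)
    (ι : K ≃ₐ[F] K) (hι : ι u = 1 - u) {σC : C →ₗ[F] C}
    (hunitary : ∀ x : K, σC (algebraMap K C x) = algebraMap K C (ι x))
    (heven : Even (deg K C)) (hA : IsCSA F A) {T : A →ₗ[F] F} (hT : IsReducedTrace F A T)
    {σ : A →ₗ[F] A} {ℓ : A} (hqp : IsQuadraticPair F A T σ ℓ)
    (hext : IsQPQuadExt F A T σ ℓ C σC (algebraMap K C u))
    (hD : IsDiscriminantAlgebraOf F K ι C σC D)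
    {E : Type} [Field E] [Algebra F E] (hE : SplitBy F A E) :
    ∃ (P : Type) (_ : Ring P) (_ : Algebra E P), IsCSA E P ∧ BrauerEquiv E P (E ⊗[F] D) ∧
      Nonempty ((E ⊗[F] CliffordAlg F A T σ ℓ) ≃ₐ[E] P × P) := by
  obtain ⟨_, _, _⟩ := hA
  obtain ⟨hσ, hdim, -, -⟩ := hqp
  obtain ⟨j, hj, hσj, hr, ℓK, hmem, hℓ, hℓ2, hTℓ⟩ := hext
  set κ := j (algebraMap K C u) with hκdef
  have hκ : κ * κ = κ + algebraMap F A a := by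
    rw [hκdef, ← map_mul, ← map_mul, hu, map_add, map_add, ← IsScalarTower.algebraMap_apply,
      AlgHom.commutes]
  have hκσ : σ κ = 1 - κ := by
    rw [hκdef, hσj, hunitary, hι, map_sub, map_sub, map_one, map_one]
  have hTκ : ∀ s, σ s = s → T (ℓ * s) = T (κ * s) := fun s hs =>
    (hTℓ s hs).trans (semitrace_eq_of_adjoin hT hσ ha hκ hκσ hmem hℓ hℓ2 s hs)
  obtain ⟨z, hz⟩ := exists_eq_sub_involution hT hσ (ℓ - κ) (fun s hs => by
    rw [sub_mul, map_sub, hTκ s hs, sub_self])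
  obtain ⟨m, α, hα, hm, ρ, hρκ, hadj, htr⟩ := exists_hermitian_model hT hσ hdim hE ha hκ hκσ
  have haE : 1 + 4 * algebraMap F E a ≠ 0 := by
    have := (map_ne_zero (algebraMap F E)).2 ha
    rwa [map_add, map_mul, map_one, map_ofNat] at this
  have hApos : 0 < finrank F A := finrank_pos
  have hmpos : 0 < m := by
    rcases Nat.eq_zero_or_pos m with rfl | h
    · omega
    · exact h
  have : Nonempty (Fin m) := ⟨⟨0, hmpos⟩⟩
  have hVdim : finrank E (Fin m → QuadraticAlgebra E (algebraMap F E a) 1) = m * 2 := by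
    rw [Module.finrank_pi_fintype]
    simp [QuadraticAlgebra.finrank_eq_two]
  have hρ : Function.Bijective (extRep (E := E) ρ) := by
    refine algHom_bijective_of_finrank_eq _ ?_
    rw [Module.finrank_baseChange, ← hm, Module.finrank_linearMap, hVdim]
    ring
  obtain ⟨ψ, hψ⟩ := exists_adjoint_model hK2 hu hugen ha ι hι j hj hr hσj hα ρ hρκ hadj hρ
  have hDW := hD.2 E m α hα ψ hψ
  have hKE : finrank E (E ⊗[F] K) = 2 := by rw [Module.finrank_baseChange, hK2]
  have : Nontrivial (E ⊗[F] K) := Module.nontrivial_of_finrank_pos (R := E) (by omega)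
  have hQW := quaternion_equiv_adjoin (R := E ⊗[F] K) haE
    (d := (-1) ^ (m * (m - 1) / 2) * ∏ i, α i)
    (mul_ne_zero (pow_ne_zero _ (by simp)) (Finset.prod_ne_zero_iff.2 fun i _ => hα i))
    (Algebra.TensorProduct.map (AlgHom.id E E) ι.toAlgHom) (w := (1 : E) ⊗ₜ u)
    (by
      rw [Algebra.TensorProduct.tmul_mul_tmul, mul_one, hu, TensorProduct.tmul_add,
        Algebra.TensorProduct.algebraMap_apply, Algebra.algebraMap_self, RingHom.id_apply,
        Algebra.algebraMap_eq_smul_one, TensorProduct.tmul_smul, TensorProduct.smul_tmul',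
        Algebra.smul_def, mul_one])
    (by
      change (1 : E) ⊗ₜ ι u = _
      rw [hι, TensorProduct.tmul_sub, Algebra.TensorProduct.one_def])
    (tensor_generator_span hK2 hugen)
  obtain ⟨hCl, hClQ⟩ := clifford_hermForm_class haE m α hα
  have hpar : Even m ∨ ∃ r : E, r * r = r + algebraMap F E a := by
    by_cases hroot : ∃ r : F, r * r = r + a
    · obtain ⟨r, hr⟩ := hroot
      exact Or.inr ⟨algebraMap F E r, by rw [← map_mul, hr, map_add]⟩
    · left
      have h1 := finrank_of_isField (F := F) (C := C) (quadratic_isField hK2 hu hugen hroot)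
      have h2 : finrank E (E ⊗[F] C) = m * m * 2 := by
        rw [ψ.toLinearEquiv.finrank_eq, Module.finrank_matrix, hKE, Fintype.card_fin]
      rw [Module.finrank_baseChange] at h2
      have h3 : finrank K C = m * m := by rw [hK2] at h1; omega
      rwa [deg, h3, Nat.sqrt_eq] at heven
  obtain ⟨e, -, he, hev⟩ := exists_flip_idempotent haE α hα hpar
  obtain ⟨P, _, _, hP, hPC, ⟨g⟩⟩ := even_clifford_split _ hCl he hev
    (Pi.single ⟨0, hmpos⟩ 1 : Fin m → QuadraticAlgebra E (algebraMap F E a) 1) (by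
      rw [hermForm_apply, Finset.sum_eq_single ⟨0, hmpos⟩]
      · simpa using hα _
      · intro i _ hi
        simp [Pi.single_eq_of_ne hi]
      · simp)
  obtain ⟨g'⟩ := clifford_baseChange_equiv hρ (b := hermBilin α)
    (hermTrace_nondegenerate haE hα) (hermTrace_comm α) hσ.2 hadj htr (hermForm α)
    (fun v => by rw [hρκ]; rfl) hTκ hz
  exact ⟨P, _, _, hP, hPC.trans (hClQ.trans (hQW.trans hDW.symm)), ⟨g'.trans g.symm⟩⟩

end KeyTheorem

section Descent

variable {F : Type} [Field F] {E : Type} [Field E] [Algebra F E]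

theorem one_tmul_injective (X : Type) [Ring X] [Algebra F X] :
    Function.Injective fun x : X => (1 : E) ⊗ₜ[F] x :=
  Algebra.TensorProduct.includeRight_injective (algebraMap F E).injective

theorem exists_dual_eq_one {X : Type} [AddCommGroup X] [Module F X] {x y : X}
    (h : x ∉ Submodule.span F {y}) : ∃ χ : X →ₗ[F] F, χ x = 1 ∧ χ y = 0 := by
  obtain ⟨f, hf, hy⟩ := Submodule.exists_le_ker_of_notMem h
  exact ⟨(f x)⁻¹ • f, by simp [hf],
    by simp [LinearMap.mem_ker.1 (hy (Submodule.mem_span_singleton_self y))]⟩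

/-- Contraction of the second tensor factor along a linear form. -/
def contractRight (E : Type) [Field E] [Algebra F E] {X : Type} [AddCommGroup X] [Module F X]
    (χ : X →ₗ[F] F) : E ⊗[F] X →ₗ[E] E :=
  (TensorProduct.AlgebraTensorModule.rid F E E).toLinearMap.comp (χ.baseChange E)

@[simp] theorem contractRight_tmul {X : Type} [AddCommGroup X] [Module F X] (χ : X →ₗ[F] F)
    (c : E) (x : X) : contractRight E χ (c ⊗ₜ x) = χ x • c := by
  simp [contractRight]

theorem eq_algebraMap_of_one_tmul_eq {X : Type} [Ring X] [Algebra F X] [Nontrivial X] {x : X}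
    {p : E} (h : (1 : E) ⊗ₜ[F] x = p ⊗ₜ 1) : ∃ r : F, p = algebraMap F E r ∧ x = r • 1 := by
  obtain ⟨χ, h1, -⟩ := exists_dual_eq_one (F := F) (x := (1 : X)) (y := 0) (by simp)
  have hp : p = algebraMap F E (χ x) := by
    have := congrArg (contractRight E χ) h
    simpa [h1, Algebra.smul_def] using this.symm
  refine ⟨χ x, hp, one_tmul_injective (F := F) (E := E) X ?_⟩
  change (1 : E) ⊗ₜ[F] x = 1 ⊗ₜ (χ x • (1 : X))
  rw [h, hp, TensorProduct.tmul_smul, TensorProduct.smul_tmul', Algebra.smul_def, mul_one]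

theorem mul_partialEval {X : Type} [Ring X] [Algebra F X] (φ : E →ₗ[F] F) (t : E ⊗[F] X) (x : X) :
    partialEval φ (t * (1 ⊗ₜ x)) = partialEval φ t * x ∧
      partialEval φ ((1 ⊗ₜ x) * t) = x * partialEval φ t := by
  induction t using TensorProduct.induction_on with
  | zero => simp
  | tmul c y => simp
  | add p q hp hq =>
    simp only [add_mul, mul_add, map_add, hp.1, hp.2, hq.1, hq.2, and_self]

theorem prod_center {P : Type} [Ring P] [Algebra E P] [Algebra.IsCentral E P] {x : P × P}
    (hx : ∀ y, x * y = y * x) :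
    ∃ p p' : E, x = (algebraMap E P p, algebraMap E P p') := by
  have h1 : x.1 ∈ Subalgebra.center E P := Subalgebra.mem_center_iff.2 fun y =>
    (congrArg Prod.fst (hx (y, 0))).symm
  have h2 : x.2 ∈ Subalgebra.center E P := Subalgebra.mem_center_iff.2 fun y =>
    (congrArg Prod.snd (hx (0, y))).symm
  rw [Algebra.IsCentral.center_eq_bot, Algebra.mem_bot] at h1 h2
  obtain ⟨p, hp⟩ := h1
  obtain ⟨p', hp'⟩ := h2
  exact ⟨p, p', Prod.ext hp.symm hp'.symm⟩

theorem exists_central_of_split {X : Type} [Ring X] [Algebra F X] {P : Type} [Ring P] [Algebra E P]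
    [Algebra.IsCentral E P] [Nontrivial P] (g : E ⊗[F] X ≃ₐ[E] P × P) :
    ∃ z : X, (∀ x, z * x = x * z) ∧ ∃ p p' : E, p ≠ p' ∧
      g (1 ⊗ₜ z) = (algebraMap E P p, algebraMap E P p') := by
  have hX : Nontrivial X := by
    by_contra h
    rw [not_nontrivial_iff_subsingleton] at h
    have : Subsingleton (P × P) := g.symm.toEquiv.subsingleton
    exact zero_ne_one (Subsingleton.elim (0 : P × P) 1)
  by_contra! hcon
  set e := g.symm (1, 0) with he
  have hcent : ∀ t, e * t = t * e := fun t => g.injective (by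
    rw [map_mul, map_mul, he, AlgEquiv.apply_symm_apply]
    exact Prod.ext (by simp) (by simp))
  have hz : ∀ φ : E →ₗ[F] F, ∃ r : F, partialEval φ e = r • 1 := fun φ => by
    have hc : ∀ x, partialEval φ e * x = x * partialEval φ e := fun x => by
      rw [← (mul_partialEval φ e x).1, hcent, (mul_partialEval φ e x).2]
    have hc' : ∀ t : E ⊗[F] X, (1 ⊗ₜ partialEval φ e) * t = t * (1 ⊗ₜ partialEval φ e) := fun t => by
      induction t using TensorProduct.induction_on with
      | zero => simp
      | tmul c y => simp [hc]
      | add p q hp hq => rw [mul_add, add_mul, hp, hq]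
    obtain ⟨p, p', hp⟩ := prod_center (E := E) (x := g (1 ⊗ₜ partialEval φ e)) fun y => by
      rw [← g.apply_symm_apply y, ← map_mul, hc', map_mul]
    have hpp : p = p' := by
      by_contra hne
      exact hcon _ hc p p' hne hp
    subst hpp
    obtain ⟨r, -, hr⟩ := eq_algebraMap_of_one_tmul_eq (x := partialEval φ e) (p := p)
      (g.injective (by
        rw [hp]
        have : (p ⊗ₜ (1 : X) : E ⊗[F] X) = algebraMap E (E ⊗[F] X) p := rfl
        rw [this, AlgEquiv.commutes]; rfl))
    exact ⟨r, hr⟩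
  obtain ⟨χ, h1, -⟩ := exists_dual_eq_one (F := F) (x := (1 : X)) (y := 0) (by simp)
  have h0 : (LinearMap.id - (LinearMap.toSpanSingleton F X 1).comp χ).lTensor E e = 0 := by
    refine eq_zero_of_partialEval fun φ => ?_
    rw [partialEval, partialEval_lTensor]
    obtain ⟨r, hr⟩ := hz φ
    rw [partialEval] at hr
    rw [hr]
    simp [h1]
  rw [LinearMap.lTensor_sub, LinearMap.sub_apply, LinearMap.lTensor_id, LinearMap.id_apply,
    sub_eq_zero] at h0
  have h2 : ∀ t : E ⊗[F] X, ((LinearMap.toSpanSingleton F X 1).comp χ).lTensor E t =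
      algebraMap E _ (contractRight E χ t) := fun t => by
    induction t using TensorProduct.induction_on with
    | zero => simp
    | tmul c y =>
      simp [Algebra.TensorProduct.algebraMap_apply, TensorProduct.smul_tmul]
    | add p q hp hq => rw [map_add, map_add, map_add, hp, hq]
  rw [h2] at h0
  have h3 := congrArg g h0
  rw [he, AlgEquiv.apply_symm_apply, AlgEquiv.commutes] at h3
  have h4 := congrArg Prod.fst h3
  have h5 := congrArg Prod.snd h3
  change (1 : P) = algebraMap E P _ at h4
  change (0 : P) = algebraMap E P _ at h5
  exact one_ne_zero (h4.trans h5.symm)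

theorem exists_central_idempotent (hcl : ∀ (x : E) (c : F), x * x - x = algebraMap F E c →
      x ∈ Set.range (algebraMap F E)) {X : Type} [Ring X] [Algebra F X] {P : Type} [Ring P]
    [Algebra E P] [Algebra.IsCentral E P] [Nontrivial P] (g : E ⊗[F] X ≃ₐ[E] P × P) :
    ∃ e : X, (∀ x, e * x = x * e) ∧ g (1 ⊗ₜ e) = (1, 0) := by
  obtain ⟨z, hz, p, p', hne, hadd, hp⟩ : ∃ z : X, (∀ x, z * x = x * z) ∧ ∃ p p' : E, p ≠ p' ∧
      p + p' ≠ 0 ∧ g (1 ⊗ₜ z) = (algebraMap E P p, algebraMap E P p') := by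
    obtain ⟨z, hz, p, p', hne, hp⟩ := exists_central_of_split g
    by_cases h : p + p' = 0
    · refine ⟨z + 1, fun x => by rw [add_mul, mul_add, hz, one_mul, mul_one], p + 1, p' + 1,
        fun h => hne (add_right_cancel h), fun h2 => hne ?_, ?_⟩
      · have h3 : (2 : E) = 0 := by linear_combination h2 - h
        linear_combination h - p' * h3
      · rw [TensorProduct.tmul_add, map_add, hp, ← Algebra.TensorProduct.one_def, map_one]
        simp [Prod.ext_iff]
    · exact ⟨z, hz, p, p', hne, h, hp⟩
  have hX : Nontrivial X := by
    by_contra h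
    rw [not_nontrivial_iff_subsingleton] at h
    have : Subsingleton (P × P) := g.symm.toEquiv.subsingleton
    exact zero_ne_one (Subsingleton.elim (0 : P × P) 1)
  have hg1 : ∀ r : E, g (r ⊗ₜ 1) = (algebraMap E P r, algebraMap E P r) := fun r =>
    (g.commutes r)
  have hsq : (1 : E) ⊗ₜ[F] (z * z) = (p + p') ⊗ₜ z - (p * p') ⊗ₜ 1 := by
    apply g.injective
    have h1 : ((1 : E) ⊗ₜ[F] (z * z)) = (1 ⊗ₜ z) * (1 ⊗ₜ z) := by simp
    have h2 : ((p + p') ⊗ₜ[F] z) = ((p + p') ⊗ₜ 1) * (1 ⊗ₜ z) := by simp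
    rw [h1, h2, map_sub, map_mul, map_mul, hp, hg1, hg1]
    simp only [Prod.mk_mul_mk, Prod.mk_sub_mk, ← map_mul, ← map_sub]
    congr 2 <;> ring
  have hzspan : z ∉ Submodule.span F {(1 : X)} := fun h => by
    obtain ⟨r, rfl⟩ := Submodule.mem_span_singleton.1 h
    have h1 : ((1 : E) ⊗ₜ[F] (r • (1 : X))) = (algebraMap F E r) ⊗ₜ 1 := by
      rw [TensorProduct.tmul_smul, TensorProduct.smul_tmul', Algebra.smul_def, mul_one]
    rw [h1, hg1] at hp
    have h2 := (algebraMap E P).injective (congrArg Prod.fst hp)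
    have h3 := (algebraMap E P).injective (congrArg Prod.snd hp)
    exact hne (h2.symm.trans h3)
  obtain ⟨χ, hχz, hχ1⟩ := exists_dual_eq_one hzspan
  have hs : p + p' = algebraMap F E (χ (z * z)) := by
    have := congrArg (contractRight E χ) hsq
    simpa [hχz, hχ1, Algebra.smul_def] using this.symm
  set c := χ (z * z)
  obtain ⟨d, hd, -⟩ := eq_algebraMap_of_one_tmul_eq (F := F) (E := E) (x := z * z - c • z) (p := -(p * p'))
    (by rw [TensorProduct.tmul_sub, hsq, hs, TensorProduct.tmul_smul, TensorProduct.smul_tmul',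
          Algebra.smul_def c (1 : E), mul_one, TensorProduct.neg_tmul]; abel)
  have hsub : p - p' ≠ 0 := sub_ne_zero.2 hne
  have hdisc : (p - p') * (p - p') = algebraMap F E (c * c + 4 * d) := by
    rw [map_add, map_mul, map_mul, map_ofNat, ← hd, ← hs]; ring
  obtain ⟨s, hs'⟩ := hcl (-p' / (p - p')) (-d / (c * c + 4 * d)) (by
    rw [map_div₀, ← hdisc, map_neg, ← hd]
    field_simp
    ring)
  refine ⟨s • 1 + ((1 - 2 * s) / c) • z, fun x => ?_, ?_⟩
  · simp [add_mul, mul_add, hz]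
  · have ht : algebraMap F E ((1 - 2 * s) / c) = 1 / (p - p') := by
      rw [map_div₀, map_sub, map_mul, map_one, map_ofNat, hs', ← hs]
      field_simp
      ring
    have h2 : ((1 / (p - p')) ⊗ₜ[F] z : E ⊗[F] X) = ((1 / (p - p')) ⊗ₜ 1) * (1 ⊗ₜ z) := by simp
    have h3 : ∀ (r : F) (x : X), ((1 : E) ⊗ₜ[F] (r • x)) = (algebraMap F E r) ⊗ₜ x := fun r x => by
      rw [TensorProduct.tmul_smul, TensorProduct.smul_tmul', Algebra.smul_def, mul_one]
    rw [TensorProduct.tmul_add, h3, h3, hs', ht, map_add, h2, map_mul, hg1, hg1, hp]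
    simp only [Prod.mk_mul_mk, Prod.mk_add_mk, ← map_mul, ← map_add]
    have e1 : -p' / (p - p') + 1 / (p - p') * p = 1 := by field_simp; ring
    have e2 : -p' / (p - p') + 1 / (p - p') * p' = 0 := by field_simp; ring
    rw [e1, e2, map_one, map_zero]

end Descent

section DescentComponents

variable {F : Type} [Field F] {E : Type} [Field E] [Algebra F E]

theorem IsCSA.of_baseChange {X : Type} [Ring X] [Algebra F X] (h : IsCSA E (E ⊗[F] X)) :
    IsCSA F X := by
  obtain ⟨_, _, _⟩ := h
  have hX : Nontrivial X := by
    by_contra h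
    rw [not_nontrivial_iff_subsingleton] at h
    exact not_subsingleton (E ⊗[F] X) inferInstance
  refine ⟨⟨fun x hx => ?_⟩, IsSimpleRing.of_eq_bot_or_eq_top fun I => ?_, ?_⟩
  · rw [Subalgebra.mem_center_iff] at hx
    have hc : (1 : E) ⊗ₜ[F] x ∈ Subalgebra.center E (E ⊗[F] X) :=
      Subalgebra.mem_center_iff.2 fun t => by
        induction t using TensorProduct.induction_on with
        | zero => simp
        | tmul c y => simp [hx]
        | add p q hp hq => rw [mul_add, add_mul, hp, hq]
    rw [Algebra.IsCentral.center_eq_bot, Algebra.mem_bot] at hc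
    obtain ⟨p, hp⟩ := hc
    obtain ⟨r, -, hr⟩ := eq_algebraMap_of_one_tmul_eq (F := F) (E := E) hp.symm
    exact Algebra.mem_bot.2 ⟨r, by rw [hr, Algebra.algebraMap_eq_smul_one]⟩
  · let q : X →ₐ[F] I.ringCon.Quotient :=
      { I.ringCon.mk' with commutes' := fun _ => rfl }
    have hq : ∀ x, q x = 0 ↔ x ∈ I := fun x => by
      rw [TwoSidedIdeal.mem_iff]
      exact RingCon.eq I.ringCon (a := x) (b := 0)
    let Q := Algebra.TensorProduct.map (AlgHom.id E E) q
    rcases subsingleton_or_nontrivial (E ⊗[F] I.ringCon.Quotient) with hs | hn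
    · refine Or.inr (eq_top_iff.2 fun x _ => (hq x).1 ?_)
      exact one_tmul_injective (F := F) (E := E) _ (Subsingleton.elim _ _)
    · refine Or.inl (eq_bot_iff.2 fun x hx => ?_)
      have h1 : Q (1 ⊗ₜ x) = 0 := by
        change (1 : E) ⊗ₜ[F] q x = 0
        rw [(hq x).2 hx, TensorProduct.tmul_zero]
      have h2 := Q.toRingHom.injective (h1.trans (map_zero Q).symm)
      exact one_tmul_injective (F := F) (E := E) X (h2.trans (TensorProduct.tmul_zero _ _).symm)
  · rw [← Module.rank_lt_aleph0_iff]
    have := Module.rank_lt_aleph0 E (E ⊗[F] X)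
    rwa [Module.rank_baseChange, Cardinal.lift_id] at this

variable {X : Type} [Ring X] [Algebra F X] {P : Type} [Ring P] [Algebra E P] [Algebra F P]
  [IsScalarTower F E P]

/-- The map from an algebra to a component of its scalar extension. -/
def componentHom (g : E ⊗[F] X →ₐ[E] P) : X →ₐ[F] P :=
  (g.restrictScalars F).comp Algebra.TensorProduct.includeRight

theorem component_baseChange_equiv (g : E ⊗[F] X →ₐ[E] P) (hg : Function.Surjective g)
    {e : X} (he : ∀ t, g t = 0 → (1 ⊗ₜ e) * t = 0) (he1 : g (1 ⊗ₜ e) = 1) :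
    Nonempty (E ⊗[F] (componentHom g).range ≃ₐ[E] P) := by
  let r := (componentHom g).rangeRestrict
  let Θ : E ⊗[F] (componentHom g).range →ₐ[E] P :=
    Algebra.TensorProduct.lift (Algebra.ofId E P) (componentHom g).range.val
      fun c y => Algebra.commutes c _
  let R : E ⊗[F] X →ₐ[E] E ⊗[F] (componentHom g).range :=
    Algebra.TensorProduct.map (AlgHom.id E E) r
  have hΘ : ∀ s, Θ (R s) = g s := fun s => by
    have : Θ.comp R = g := by
      refine Algebra.TensorProduct.ext' fun c x => ?_
      change algebraMap E P c * g (1 ⊗ₜ x) = g (c ⊗ₜ x)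
      rw [← g.commutes, ← map_mul]
      simp [Algebra.TensorProduct.algebraMap_apply]
    exact DFunLike.congr_fun this s
  have hR : Function.Surjective R :=
    LinearMap.lTensor_surjective E (g := r.toLinearMap) (AlgHom.rangeRestrict_surjective _)
  have hRe : R (1 ⊗ₜ e) = 1 := by
    have : r e = 1 := Subtype.ext he1
    change (1 : E) ⊗ₜ[F] r e = 1
    rw [this, Algebra.TensorProduct.one_def]
  refine ⟨AlgEquiv.ofBijective Θ ⟨?_, fun y => ?_⟩⟩
  · rw [injective_iff_map_eq_zero]
    intro t ht
    obtain ⟨s, rfl⟩ := hR t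
    rw [hΘ] at ht
    have := congrArg R (he s ht)
    rwa [map_mul, hRe, one_mul, map_zero] at this
  · obtain ⟨s, rfl⟩ := hg y
    exact ⟨R s, hΘ s⟩

theorem exists_components (g : E ⊗[F] X ≃ₐ[E] P × P) (hP : IsCSA E P) {e : X}
    (he1 : g (1 ⊗ₜ e) = (1, 0)) :
    ∃ Cp Cm : CSAlg F, Nonempty (X ≃ₐ[F] Cp.A × Cm.A) ∧
      Nonempty (E ⊗[F] Cp.A ≃ₐ[E] P) := by
  let g₁ : E ⊗[F] X →ₐ[E] P := (AlgHom.fst E P P).comp g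
  let g₂ : E ⊗[F] X →ₐ[E] P := (AlgHom.snd E P P).comp g
  have hg₁ : ∀ t, g₁ t = (g t).1 := fun _ => rfl
  have hg₂ : ∀ t, g₂ t = (g t).2 := fun _ => rfl
  have he2 : g (1 ⊗ₜ (1 - e)) = (0, 1) := by
    rw [TensorProduct.tmul_sub, map_sub, he1, ← Algebra.TensorProduct.one_def, map_one]
    simp [Prod.ext_iff]
  obtain ⟨Θ₁⟩ := component_baseChange_equiv g₁ (e := e)
    (fun y => ⟨g.symm (y, 0), by rw [hg₁, AlgEquiv.apply_symm_apply]⟩)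
    (fun t ht => g.injective (by
      rw [map_mul, he1, map_zero]; exact Prod.ext ((one_mul _).trans ht) (zero_mul _)))
    (by rw [hg₁, he1])
  obtain ⟨Θ₂⟩ := component_baseChange_equiv g₂ (e := 1 - e)
    (fun y => ⟨g.symm (0, y), by rw [hg₂, AlgEquiv.apply_symm_apply]⟩)
    (fun t ht => g.injective (by
      rw [map_mul, he2, map_zero]; exact Prod.ext (zero_mul _) ((one_mul _).trans ht)))
    (by rw [hg₂, he2])
  let φ : X →ₐ[F] (componentHom g₁).range × (componentHom g₂).range :=
    (componentHom g₁).rangeRestrict.prod (componentHom g₂).rangeRestrict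
  have hφ1 : ∀ x, ((φ x).1 : P) = (g (1 ⊗ₜ x)).1 := fun _ => rfl
  have hφ2 : ∀ x, ((φ x).2 : P) = (g (1 ⊗ₜ x)).2 := fun _ => rfl
  have hmul : ∀ x y : X, g (1 ⊗ₜ (x * y)) = g (1 ⊗ₜ x) * g (1 ⊗ₜ y) := fun x y => by
    rw [← map_mul, Algebra.TensorProduct.tmul_mul_tmul, one_mul]
  refine ⟨⟨_, IsCSA.of_baseChange (E := E) (hP.of_algEquiv Θ₁.symm)⟩,
    ⟨_, IsCSA.of_baseChange (E := E) (hP.of_algEquiv Θ₂.symm)⟩,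
    ⟨AlgEquiv.ofBijective φ ⟨fun x y hxy => ?_, ?_⟩⟩, ⟨Θ₁⟩⟩
  · apply one_tmul_injective (F := F) (E := E) X
    apply g.injective
    refine Prod.ext ?_ ?_
    · exact (hφ1 x).symm.trans ((congrArg (fun z => (z.1 : P)) hxy).trans (hφ1 y))
    · exact (hφ2 x).symm.trans ((congrArg (fun z => (z.2 : P)) hxy).trans (hφ2 y))
  · rintro ⟨⟨_, x, rfl⟩, ⟨_, y, rfl⟩⟩
    refine ⟨e * x + (1 - e) * y, Prod.ext (Subtype.ext ?_) (Subtype.ext ?_)⟩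
    · rw [hφ1, TensorProduct.tmul_add, map_add, hmul, hmul, he1, he2]
      change 1 * (g (1 ⊗ₜ x)).1 + 0 * _ = (g (1 ⊗ₜ x)).1
      rw [one_mul, zero_mul, add_zero]
    · rw [hφ2, TensorProduct.tmul_add, map_add, hmul, hmul, he1, he2]
      change 0 * _ + 1 * (g (1 ⊗ₜ y)).2 = (g (1 ⊗ₜ y)).2
      rw [one_mul, zero_mul, zero_add]

end DescentComponents

section ProductComponents

variable {E : Type} [Field E] {X₁ X₂ P : Type} [Ring X₁] [Algebra E X₁] [Ring X₂] [Algebra E X₂]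
  [Ring P] [Algebra E P]

theorem component_equiv_of_map_one [IsSimpleRing X₁] [Nontrivial P] (π : X₁ × X₂ →ₐ[E] P)
    (hπ : Function.Surjective π) (h1 : π (1, 0) = 1) : Nonempty (X₁ ≃ₐ[E] P) := by
  let f : X₁ →ₐ[E] P := AlgHom.ofLinearMap (π.toLinearMap.comp (LinearMap.inl E X₁ X₂)) h1
    fun x y => by
      change π (x * y, 0) = π (x, 0) * π (y, 0)
      rw [← map_mul, Prod.mk_mul_mk, mul_zero]
  have hf : ∀ x, f x = π (x, 0) := fun _ => rfl
  refine ⟨AlgEquiv.ofBijective f ⟨f.toRingHom.injective, fun y => ?_⟩⟩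
  obtain ⟨⟨x, x'⟩, rfl⟩ := hπ y
  refine ⟨x, ?_⟩
  have := map_mul π (1, 0) (x, x')
  rw [h1, one_mul, Prod.mk_mul_mk, one_mul, zero_mul] at this
  rw [hf, this]

theorem component_equiv_of_prod_equiv [IsSimpleRing X₁] [Algebra.IsCentral E P] [Nontrivial P]
    (h : (X₁ × X₂) ≃ₐ[E] P × P) : Nonempty (X₁ ≃ₐ[E] P) := by
  obtain ⟨p, p', hp⟩ := prod_center (E := E) (x := h (1, 0)) fun y => by
    rw [← h.apply_symm_apply y, ← map_mul, ← map_mul]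
    exact congrArg h (Prod.ext (by simp) (by simp))
  have hidem : h (1, 0) * h (1, 0) = h (1, 0) := by
    rw [← map_mul, Prod.mk_mul_mk, mul_one, mul_zero]
  rw [hp, Prod.mk_mul_mk, ← map_mul, ← map_mul] at hidem
  have h1 := (algebraMap E P).injective (congrArg Prod.fst hidem)
  have h2 := (algebraMap E P).injective (congrArg Prod.snd hidem)
  rcases (IsIdempotentElem.iff_eq_zero_or_one.1 h1) with rfl | rfl
  · rcases (IsIdempotentElem.iff_eq_zero_or_one.1 h2) with rfl | rfl
    · exfalso
      rw [map_zero] at hp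
      have := h.injective (hp.trans (map_zero h).symm)
      exact one_ne_zero (congrArg Prod.fst this)
    · exact component_equiv_of_map_one ((AlgHom.snd E P P).comp h.toAlgHom)
        (Prod.snd_surjective.comp h.surjective) ((congrArg Prod.snd hp).trans (map_one _))
  · exact component_equiv_of_map_one ((AlgHom.fst E P P).comp h.toAlgHom)
      (Prod.fst_surjective.comp h.surjective) ((congrArg Prod.fst hp).trans (map_one _))

end ProductComponents

section BrauerDifference

variable {F : Type} [Field F]

theorem IsCSA.op {D : Type} [Ring D] [Algebra F D] (h : IsCSA F D) : IsCSA F Dᵐᵒᵖ := by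
  obtain ⟨_, _, _⟩ := h
  exact ⟨inferInstance, inferInstance, inferInstance⟩

theorem SplitBy.of_algEquiv {X Y : Type} [Ring X] [Algebra F X] [Ring Y] [Algebra F Y] {M : Type}
    [Field M] [Algebra F M] (e : X ≃ₐ[F] Y) (h : SplitBy F X M) : SplitBy F Y M := by
  obtain ⟨n, hn, ⟨f⟩⟩ := h
  exact ⟨n, hn.trans e.toLinearEquiv.finrank_eq, ⟨f.comp e.symm.toAlgHom⟩⟩

variable {E : Type} [Field E] [Algebra F E]

/-- Columns over an algebra as a module over the matrix algebra. -/
def columnRep (E : Type) [Field E] {Y : Type} [Ring Y] [Algebra E Y] (l : ℕ) :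
    Matrix (Fin l) (Fin l) Y →ₐ[E] Module.End E (Fin l → Y) :=
  AlgHom.ofLinearMap
    { toFun := fun M =>
        { toFun := fun v => M.mulVec v
          map_add' := M.mulVec_add
          map_smul' := fun c v => M.mulVec_smul c v }
      map_add' := fun M N => LinearMap.ext fun v => Matrix.add_mulVec M N v
      map_smul' := fun c M => LinearMap.ext fun v => Matrix.smul_mulVec c M v }
    (LinearMap.ext fun v => Matrix.one_mulVec v)
    (fun M N => LinearMap.ext fun v => (Matrix.mulVec_mulVec v M N).symm)

theorem columnRep_apply {Y : Type} [Ring Y] [Algebra E Y] {l : ℕ} (M : Matrix (Fin l) (Fin l) Y)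
    (v : Fin l → Y) : columnRep E l M v = M.mulVec v := rfl

/-- The action of the opposite algebra on columns by right multiplication. -/
def columnOpRep (E : Type) [Field E] [Algebra F E] (D : Type) [Ring D] [Algebra F D] (l : ℕ) :
    Dᵐᵒᵖ →ₐ[F] Module.End E (Fin l → E ⊗[F] D) :=
  AlgHom.ofLinearMap
    { toFun := fun d => (LinearMap.mulRight E ((1 : E) ⊗ₜ[F] d.unop)).compLeft (Fin l)
      map_add' := fun d d' => LinearMap.ext fun v => funext fun i => by
        simp [TensorProduct.tmul_add, mul_add]
      map_smul' := fun c d => LinearMap.ext fun v => funext fun i => by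
        simp }
    (LinearMap.ext fun v => funext fun i => by
      simp [← Algebra.TensorProduct.one_def])
    (fun d d' => LinearMap.ext fun v => funext fun i => by
      simp [mul_assoc])

theorem splitBy_of_brauerEquiv_baseChange {X D : Type} [Ring X] [Algebra F X] [Ring D]
    [Algebra F D] (hX : IsCSA F X) (hD : IsCSA F D)
    (h : BrauerEquiv E (E ⊗[F] X) (E ⊗[F] D)) : SplitBy F (X ⊗[F] Dᵐᵒᵖ) E := by
  obtain ⟨k, l, hk, hl, ⟨φ⟩⟩ := h
  obtain ⟨_, _, _⟩ := hX.tensor hD.op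
  obtain ⟨_, _, _⟩ := hX
  obtain ⟨_, _, _⟩ := hD
  have hdim : k * k * finrank F X = l * l * finrank F D := by
    have := φ.toLinearEquiv.finrank_eq
    rwa [Module.finrank_matrix, Module.finrank_matrix, Module.finrank_baseChange,
      Module.finrank_baseChange, Fintype.card_fin, Fintype.card_fin] at this
  let f : Matrix (Fin k) (Fin k) X →ₐ[F] Module.End E (Fin l → E ⊗[F] D) :=
    (((columnRep E l).comp φ.toAlgHom).restrictScalars F).comp
      (Algebra.TensorProduct.includeRight : X →ₐ[F] E ⊗[F] X).mapMatrix
  have hcomm : ∀ d x, Commute (columnOpRep E D l d) (f x) := fun d x =>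
    LinearMap.ext fun v => funext fun i => by
      change (columnRep E l _ v) i * _ = columnRep E l _ (columnOpRep E D l d v) i
      rw [columnRep_apply, columnRep_apply, Matrix.mulVec, Matrix.mulVec, dotProduct, dotProduct,
        Finset.sum_mul]
      exact Finset.sum_congr rfl fun j _ => mul_assoc _ _ _
  let Ψ : Dᵐᵒᵖ ⊗[F] Matrix (Fin k) (Fin k) X →ₐ[F] Module.End E (Fin l → E ⊗[F] D) :=
    Algebra.TensorProduct.lift (columnOpRep E D l) f hcomm
  have hs : finrank E (Fin l → E ⊗[F] D) = l * finrank F D := by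
    rw [Module.finrank_pi_fintype]
    simp
  let b := Module.finBasisOfFinrankEq E _ hs
  let Φ := (((LinearMap.toMatrixAlgEquiv b).toAlgHom.restrictScalars F).comp Ψ).comp
    ((tensorMatrix F Dᵐᵒᵖ X k).symm.toAlgHom.comp
      (Algebra.TensorProduct.comm F X Dᵐᵒᵖ).toAlgHom.mapMatrix)
  refine splitBy_of_matrix_hom hk Φ ?_
  have hop : finrank F Dᵐᵒᵖ = finrank F D := (MulOpposite.opLinearEquiv F).finrank_eq.symm
  rw [Module.finrank_tensorProduct, hop]
  calc l * finrank F D * (l * finrank F D) = l * l * finrank F D * finrank F D := by ring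
    _ = _ := by rw [← hdim]; ring

theorem IsSplit.brauerEquiv {X : Type} [Ring X] [Algebra F X] (h : IsSplit F X) :
    BrauerEquiv F X F := by
  obtain ⟨n, hn, ⟨e⟩⟩ := h
  exact (BrauerEquiv.of_algEquiv e).trans (BrauerEquiv.matrix hn)

theorem IsInvolution.tensor_self_split {A : Type} [Ring A] [Algebra F A] (hA : IsCSA F A)
    {σ : A →ₗ[F] A} (hσ : IsInvolution F σ) : BrauerEquiv F (A ⊗[F] A) F := by
  obtain ⟨_, _, _⟩ := hA
  let s : A →ₐ[F] Aᵐᵒᵖ := AlgHom.ofLinearMap ((MulOpposite.opLinearEquiv F).toLinearMap.comp σ)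
    (by simp [hσ.map_one]) (fun x y => by simp [hσ.1])
  have hs : Function.Bijective s := by
    refine (MulOpposite.opLinearEquiv F).bijective.comp ⟨fun x y hxy => ?_, fun x => ⟨σ x, hσ.2 x⟩⟩
    rw [← hσ.2 x, hxy, hσ.2]
  let e1 := Algebra.TensorProduct.congr (AlgEquiv.refl : A ≃ₐ[F] A) (AlgEquiv.ofBijective s hs)
  let e2 := AlgEquiv.ofBijective _ (mulLeftRight_bijective F A)
  let b := Module.finBasis F A
  exact IsSplit.brauerEquiv ⟨_, finrank_pos,
    ⟨(e1.trans e2).trans (LinearMap.toMatrixAlgEquiv b)⟩⟩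

theorem BrauerEquiv.of_tensor_split {A B : Type} [Ring A] [Algebra F A] [Ring B] [Algebra F B]
    (hA : IsCSA F A) {σ : A →ₗ[F] A} (hσ : IsInvolution F σ) (h : IsSplit F (B ⊗[F] A)) :
    BrauerEquiv F B A := by
  have h1 : BrauerEquiv F (B ⊗[F] (A ⊗[F] A)) (B ⊗[F] F) :=
    (hσ.tensor_self_split hA).tensor_left
  have h2 : BrauerEquiv F (A ⊗[F] (B ⊗[F] A)) (A ⊗[F] F) := h.brauerEquiv.tensor_left
  have e : B ⊗[F] (A ⊗[F] A) ≃ₐ[F] A ⊗[F] (B ⊗[F] A) :=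
    (Algebra.TensorProduct.assoc F F F B A A).symm.trans (Algebra.TensorProduct.comm F _ _)
  exact (BrauerEquiv.of_algEquiv (Algebra.TensorProduct.rid F F B).symm).trans
    (h1.symm.trans ((BrauerEquiv.of_algEquiv e).trans
      (h2.trans (BrauerEquiv.of_algEquiv (Algebra.TensorProduct.rid F F A)))))

end BrauerDifference

/-- Lemma 3.7 of the paper.  Let `(A, σ, f)` be an `F`-algebra with
quadratic pair which is a quadratic extension of an `F`-algebra with `K/F`-unitary
involution `(C, σ_C)` of even degree (so `4 ∣ deg A`).  Then `(σ, f)` has trivial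
discriminant, and its Clifford invariant (the Brauer class of a simple component of the
Clifford algebra, taken modulo the subgroup generated by `[A]`) coincides with the
class of the discriminant algebra `D(C, σ_C)` in `Br(F)/⟨[A]⟩`. -/
theorem clifford_invariant_of_quad_ext (F : Type) [Field F]
    -- the étale quadratic F-algebra K = F[u] with automorphism ι
    (K : Type) [CommRing K] [Algebra F K] (hK2 : Module.finrank F K = 2)
    (u : K) (a : F) (hu : u * u = u + algebraMap F K a)
    (hugen : u ∉ Set.range (algebraMap F K)) (ha : (1 : F) + 4 * a ≠ 0)
    (ι : K ≃ₐ[F] K) (hι : ι u = 1 - u)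
    -- the K-algebra with K/F-unitary involution (C, σ_C), of even degree over K
    (C : Type) [Ring C] [Algebra F C] [Algebra K C] [IsScalarTower F K C]
    (hCfin : Module.Finite F C) (hCss : IsSemisimpleRing C)
    (hCcentral : Algebra.IsCentral K C)
    (σC : C →ₗ[F] C) (hσC : IsInvolution F σC)
    (hunitary : ∀ x : K, σC (algebraMap K C x) = algebraMap K C (ι x))
    (heven : Even (deg K C))
    -- the F-algebra with quadratic pair (A, σ, f), a quadratic extension of (C, σ_C)
    (A : Type) [Ring A] [Algebra F A] (hA : IsCSA F A)
    (T : A →ₗ[F] F) (hT : IsReducedTrace F A T)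
    (σ : A →ₗ[F] A) (ℓ : A) (hqp : IsQuadraticPair F A T σ ℓ)
    (hext : IsQPQuadExt F A T σ ℓ C σC (algebraMap K C u))
    -- the discriminant algebra D(C, σ_C)
    (D : Type) [Ring D] [Algebra F D]
    (hD : IsDiscriminantAlgebraOf F K ι C σC D) :
    HasTrivialDiscriminant F A T σ ℓ ∧
    ∃ Cp Cm : CSAlg F,
      Nonempty (CliffordAlg F A T σ ℓ ≃ₐ[F] Cp.A × Cm.A) ∧
      (IsSplit F (Cp.A ⊗[F] Dᵐᵒᵖ) ∨ BrauerEquiv F (Cp.A ⊗[F] Dᵐᵒᵖ) A) := by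
  have key := fun (E : Type) [Field E] [Algebra F E] (hE : SplitBy F A E) =>
    exists_clifford_split hK2 hu hugen ha ι hι hunitary heven hA hT hqp hext hD hE
  have hA' := hA
  obtain ⟨_, _, _⟩ := hA'
  obtain ⟨E, _, _, hE, hcl, -⟩ := exists_generic_splitting (B := A) hqp.1
  obtain ⟨P, _, _, hP, -, ⟨g⟩⟩ := key E hE
  have hP' := hP
  obtain ⟨_, _, _⟩ := hP'
  obtain ⟨e, he, hge⟩ := exists_central_idempotent hcl g
  have h01 : (1 : P) ≠ 0 := one_ne_zero
  refine ⟨⟨e, Subalgebra.mem_center_iff.2 fun x => (he x).symm, ?_, ?_, ?_⟩, ?_⟩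
  · apply one_tmul_injective (F := F) (E := E) _
    apply g.injective
    change g (1 ⊗ₜ (e * e)) = g (1 ⊗ₜ e)
    have : (1 : E) ⊗ₜ[F] (e * e) = (1 ⊗ₜ e) * (1 ⊗ₜ e) := by simp
    rw [this, map_mul, hge, Prod.mk_mul_mk, mul_one, mul_zero]
  · rintro rfl
    rw [TensorProduct.tmul_zero, map_zero] at hge
    exact h01 (congrArg Prod.fst hge).symm
  · rintro rfl
    rw [← Algebra.TensorProduct.one_def, map_one] at hge
    exact h01 (congrArg Prod.snd hge)
  let : Algebra F P := Algebra.compHom P (algebraMap F E)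
  have : IsScalarTower F E P := IsScalarTower.of_algebraMap_eq fun _ => rfl
  obtain ⟨Cp, Cm, ⟨h⟩, -⟩ := exists_components g hP hge
  refine ⟨Cp, Cm, ⟨h⟩, ?_⟩
  obtain ⟨_, _, _⟩ := Cp.csa.tensor hD.1.op
  obtain ⟨_, _, _⟩ := Cp.csa
  obtain ⟨L, _, _, hL, -, hB⟩ := exists_generic_splitting (B := Cp.A ⊗[F] Dᵐᵒᵖ) hqp.1
  obtain ⟨Q, _, _, ⟨_, _, _⟩, hQD, ⟨g'⟩⟩ := key L hL
  obtain ⟨θ⟩ := component_equiv_of_prod_equiv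
    ((Algebra.TensorProduct.prodRight F L L Cp.A Cm.A).symm.trans
      ((Algebra.TensorProduct.congr AlgEquiv.refl h.symm).trans g'))
  rcases hB (splitBy_of_brauerEquiv_baseChange Cp.csa hD.1
    ((BrauerEquiv.of_algEquiv θ).trans hQD)) with hB | hB
  · exact Or.inl hB.isSplit
  · obtain ⟨_, _, _⟩ := (Cp.csa.tensor hD.1.op).tensor hA
    exact Or.inr (BrauerEquiv.of_tensor_split hA hqp.1 hB.isSplit)


end

end Triality
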